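/- Suppose (C,D,h) ∈ W_n with associated map f_h : C → D, W is a connected open subset of D such that W ∩ Bd D is connected and nonempty, and Y is the connected component of f_h⁻¹(W) containing h⁻¹(W ∩ Bd D). Then f_h induces an epimorphism of fundamental groups π₁(Y ∩ Int C) → π₁(W ∩ Int D); precisely, for every y₀ ∈ Y ∩ Int C and every loop γ in W ∩ Int D based at f_h(y₀), there is a loop γ′ in Y ∩ Int C based at y₀ such that f_h ∘ γ′ is path-homotopic to γ within W ∩ Int D. (Lemma 3.1) -/

import Mathlib

noncomputable section

open Metric Set unitInterval

/-- The ambient Euclidean space `ℝ^{n+1}` in which the sphere `S^n` lives. -/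
abbrev Amb (n : ℕ) := EuclideanSpace ℝ (Fin (n + 1))

/-- The unit sphere `S^n` inside `ℝ^{n+1}`. -/
def Sph (n : ℕ) : Set (Amb n) := Metric.sphere 0 1

/-- A crumpled `n`-cube: the union of the image `bd` of a topological embedding of the
sphere `S^{n-1}` into `S^n` together with one of the connected components `int` of
`S^n \ bd`. -/
structure CrumpledCube (n : ℕ) where
  bd : Set (Amb n)
  int : Set (Amb n)
  bd_subset_sphere : bd ⊆ Sph n
  exists_embedding : ∃ e : ↥(Sph (n - 1)) → Amb n,
      Continuous e ∧ Function.Injective e ∧ Set.range e = bd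
  int_component : ∃ x, x ∈ Sph n \ bd ∧ int = connectedComponentIn (Sph n \ bd) x

namespace CrumpledCube

/-- The underlying set of a crumpled cube. -/
def carrier {n : ℕ} (C : CrumpledCube n) : Set (Amb n) := C.bd ∪ C.int

lemma bd_subset_carrier {n : ℕ} (C : CrumpledCube n) : C.bd ⊆ C.carrier :=
  Set.subset_union_left

end CrumpledCube

/-- `f : C → D` is a map associated with the triple `(C, D, h)`: it is continuous,
restricts to `h` on `Bd C`, and satisfies `f⁻¹(Bd D) = Bd C`. -/
def IsAssociatedMap {n : ℕ} (C D : CrumpledCube n) (h : ↥C.bd ≃ₜ ↥D.bd)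
    (f : ↥C.carrier → ↥D.carrier) : Prop :=
  Continuous f ∧
    (∀ (x : ↥C.carrier) (hx : (x : Amb n) ∈ C.bd),
      ((f x : ↥D.carrier) : Amb n) = ((h ⟨(x : Amb n), hx⟩ : ↥D.bd) : Amb n)) ∧
    (∀ x : ↥C.carrier, ((f x : ↥D.carrier) : Amb n) ∈ D.bd ↔ (x : Amb n) ∈ C.bd)

/-- The triple `(C, D, h)` belongs to the collection `𝒲_n`. -/
def MemW {n : ℕ} (C D : CrumpledCube n) (h : ↥C.bd ≃ₜ ↥D.bd) : Prop :=
  ∃ f : ↥C.carrier → ↥D.carrier, IsAssociatedMap C D h f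

/-- The image `h(T)` of a subset `T` of `Bd C` under a boundary homeomorphism
`h : Bd C → Bd D`, as a subset of the ambient space. -/
def bdImage {n : ℕ} {C D : CrumpledCube n} (h : ↥C.bd ≃ₜ ↥D.bd) (T : Set (Amb n)) :
    Set (Amb n) :=
  (fun x : ↥C.bd => ((h x : ↥D.bd) : Amb n)) '' {x : ↥C.bd | (x : Amb n) ∈ T}

/-- `T` is a homotopy taming set for the crumpled cube `C`. -/
def IsHomotopyTamingSet {n : ℕ} (C : CrumpledCube n) (T : Set (Amb n)) : Prop :=
  T ⊆ C.bd ∧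
    ∀ (m : C(I × I, ↥C.carrier)) (ε : ℝ), 0 < ε →
      ∃ m' : C(I × I, ↥C.carrier),
        (∀ x, dist (m x) (m' x) < ε) ∧ ∀ x, ((m' x : ↥C.carrier) : Amb n) ∈ T ∪ C.int

/-- `Bd C` is locally collared in `C` at the point `p`. -/
def LocallyCollaredAt {n : ℕ} (C : CrumpledCube n) (p : ↥C.carrier) : Prop :=
  ∃ N : Set ↥C.carrier, IsOpen N ∧ p ∈ N ∧
    ∃ φ : ↥N ≃ₜ ↥(N ∩ {x : ↥C.carrier | (x : Amb n) ∈ C.bd}) × ↥(Set.Ico (0 : ℝ) 1),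
      ∀ (x : ↥N) (hx : ((x : ↥C.carrier) : Amb n) ∈ C.bd),
        φ x = (⟨(x : ↥C.carrier), ⟨x.2, hx⟩⟩, ⟨0, ⟨le_rfl, zero_lt_one⟩⟩)

/-- The wild set of a crumpled cube: the points of `Bd C` at which `Bd C` fails to be
locally collared in `C`. -/
def wildSet {n : ℕ} (C : CrumpledCube n) : Set (Amb n) :=
  {p | ∃ hp : p ∈ C.bd, ¬ LocallyCollaredAt C ⟨p, C.bd_subset_carrier hp⟩}

/-- `C` is strictly wilder than `D`. -/
def StrictlyWilder {n : ℕ} (C D : CrumpledCube n) : Prop :=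
  (∃ h : ↥C.bd ≃ₜ ↥D.bd, MemW C D h) ∧ ∀ H : ↥D.bd ≃ₜ ↥C.bd, ¬ MemW D C H

/-- A crumpled `n`-cube is a closed `n`-cell-complement if the complement of its
interior in `S^n` is an `n`-cell. -/
def IsClosedCellComplement {n : ℕ} (C : CrumpledCube n) : Prop :=
  Nonempty (↥(Sph n \ C.int) ≃ₜ ↥(Metric.closedBall (0 : EuclideanSpace ℝ (Fin n)) 1))

open MeasureTheory Topology Filter
open scoped ContDiff

/-- The Euclidean space `ℝ^n`. -/
abbrev Euc (n : ℕ) := EuclideanSpace ℝ (Fin n)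

/-- The standard basis of `ℝ^n`. -/
def stdB (n : ℕ) : Module.Basis (Fin n) ℝ (Euc n) := (EuclideanSpace.basisFun (Fin n) ℝ).toBasis

/-- The determinant form on `ℝ^n`, as a continuous multilinear map. -/
def volForm (n : ℕ) : ContinuousMultilinearMap ℝ (fun _ : Fin n => Euc n) ℝ where
  toMultilinearMap := (stdB n).det.toMultilinearMap
  cont := by
    have : (stdB n).det.toMultilinearMap.toFun = fun v => ((stdB n).toMatrix v).det := by
      funext v
      exact (stdB n).det_apply v
    rw [this]
    refine Continuous.matrix_det ?_
    refine continuous_matrix fun i j => ?_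
    simp only [Module.Basis.toMatrix_apply]
    exact ((stdB n).coord i).continuous_of_finiteDimensional.comp (continuous_apply j)

lemma volForm_apply {n : ℕ} (v : Fin n → Euc n) : volForm n v = (stdB n).det v := rfl

lemma volForm_clm {n : ℕ} (A : Euc n →L[ℝ] Euc n) :
    volForm n (fun i => A (stdB n i)) = A.det := by
  have := (stdB n).det_comp (A : Euc n →ₗ[ℝ] Euc n) (stdB n)
  rw [(stdB n).det_self, mul_one] at this
  exact this

lemma sum_volForm_update {n : ℕ} (a : Fin n → Euc n) (v : Euc n) (l : Euc n →L[ℝ] ℝ) :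
    ∑ i, l (a i) * volForm n (Function.update a i v) = l v * volForm n a := by
  have h1 : ∑ i, volForm n (Function.update a i v) • a i = volForm n a • v := by
    apply (stdB n).repr.injective
    ext k
    have := congrFun (Matrix.mulVec_cramer ((stdB n).toMatrix a) ((stdB n).repr v)) k
    simp only [Matrix.mulVec, dotProduct, Matrix.cramer_apply, ← Module.Basis.toMatrix_update,
      ← Module.Basis.det_apply] at this
    simp only [map_sum, map_smul, volForm_apply, Finsupp.coe_finsetSum, Finset.sum_apply,
      Finsupp.smul_apply, smul_eq_mul]
    simp only [Pi.smul_apply, smul_eq_mul, Module.Basis.toMatrix_apply] at this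
    rw [← this]
    exact Finset.sum_congr rfl fun i _ => mul_comm _ _
  have h2 := congrArg l h1
  simp only [map_sum, map_smul, smul_eq_mul] at h2
  rw [mul_comm, ← h2]
  exact Finset.sum_congr rfl fun i _ => mul_comm _ _

lemma volForm_swap {n : ℕ} (a : Fin n → Euc n) (v w : Euc n) {i j : Fin n} (hij : i ≠ j) :
    volForm n (Function.update (Function.update a i v) j w) =
      - volForm n (Function.update (Function.update a j v) i w) := by
  have := (stdB n).det.map_swap (Function.update (Function.update a j v) i w) hij
  rw [volForm_apply, volForm_apply, ← this]
  congr 1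
  funext k
  simp only [Function.comp_apply]
  rcases eq_or_ne k i with rfl | hi
  · simp [hij, hij.symm]
  · rcases eq_or_ne k j with rfl | hj
    · simp
    · rw [Equiv.swap_apply_of_ne_of_ne hi hj]
      simp [hi, hj]

lemma sum_volForm_symm {n : ℕ} (a : Fin n → Euc n) (v : Euc n) (s : Fin n → Fin n → Euc n)
    (hs : ∀ i j, s i j = s j i) :
    ∑ i, ∑ j ∈ Finset.univ.erase i,
      volForm n (Function.update (Function.update a i v) j (s i j)) = 0 := by
  have key : ∀ i j : Fin n, (if j = i then 0 else
      volForm n (Function.update (Function.update a i v) j (s i j))) =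
      -(if i = j then 0 else
      volForm n (Function.update (Function.update a j v) i (s j i))) := by
    intro i j
    rcases eq_or_ne i j with rfl | h
    · simp
    · rw [if_neg h, if_neg h.symm, volForm_swap a v _ h, hs]
  have h1 : ∀ i, ∑ j ∈ Finset.univ.erase i,
      volForm n (Function.update (Function.update a i v) j (s i j)) =
      ∑ j, (if j = i then 0 else
      volForm n (Function.update (Function.update a i v) j (s i j))) := by
    intro i
    rw [← Finset.add_sum_erase _ _ (Finset.mem_univ i), if_pos rfl, zero_add]
    refine Finset.sum_congr rfl fun j hj => ?_
    rw [if_neg (Finset.ne_of_mem_erase hj)]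
  simp only [h1]
  have h2 : ∑ i, ∑ j, (if j = i then 0 else
      volForm n (Function.update (Function.update a i v) j (s i j))) =
      - ∑ i, ∑ j, (if j = i then 0 else
      volForm n (Function.update (Function.update a i v) j (s i j))) := by
    conv_lhs => rw [Finset.sum_comm]
    rw [← Finset.sum_neg_distrib]
    refine Finset.sum_congr rfl fun i _ => ?_
    rw [← Finset.sum_neg_distrib]
    exact Finset.sum_congr rfl fun j _ => key j i
  linarith

lemma hasFDerivAt_volForm {n : ℕ} {X : Type*} [NormedAddCommGroup X] [NormedSpace ℝ X]
    {a : X → Fin n → Euc n} {a' : X →L[ℝ] (Fin n → Euc n)} {x : X} (h : HasFDerivAt a a' x) :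
    HasFDerivAt (fun x => volForm n (a x)) (((volForm n).linearDeriv (a x)).comp a') x :=
  ((volForm n).hasFDerivAt (a x)).comp x h

lemma integral_fderiv_eq_zero {n : ℕ} {X : Euc n → ℝ} (hX : ContDiff ℝ 1 X)
    (hc : HasCompactSupport X) (v : Euc n) : ∫ x, fderiv ℝ X x v = 0 := by
  have hi : Integrable (fun x => fderiv ℝ X x v) :=
    ((hX.continuous_fderiv one_ne_zero).clm_apply continuous_const).integrable_of_hasCompactSupport
      (hc.fderiv_apply (𝕜 := ℝ) v)
  have := integral_mul_fderiv_eq_neg_fderiv_mul_of_integrable (μ := (volume : Measure (Euc n)))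
    (f := fun _ => (1 : ℝ)) (g := X) (v := v) (by simp)
    (by simpa using hi)
    (by simpa using hX.continuous.integrable_of_hasCompactSupport hc) (by simp)
    (fun x _ => (hX.differentiable one_ne_zero) x)
  simpa using this

lemma integral_eq_of_integral_deriv_eq_zero {n : ℕ} {G G' : ℝ → Euc n → ℝ}
    (hd : ∀ t x, HasDerivAt (fun t => G t x) (G' t x) t)
    (hG : ∀ t, Continuous (G t)) (hG' : Continuous fun p : ℝ × Euc n => G' p.1 p.2)
    {K : Set (Euc n)} (hK : IsCompact K) (h0 : ∀ t, ∀ x ∉ K, G t x = 0)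
    (h0' : ∀ t, ∀ x ∉ K, G' t x = 0)
    (hint : ∀ t ∈ Icc (0 : ℝ) 1, ∫ x, G' t x = 0) : ∫ x, G 0 x = ∫ x, G 1 x := by
  have hGs : ∀ t, HasCompactSupport (G t) := fun t => HasCompactSupport.intro hK (h0 t)
  have hGs' : ∀ t, HasCompactSupport (G' t) := fun t => HasCompactSupport.intro hK (h0' t)
  have hG'c : ∀ t, Continuous (G' t) := fun t => hG'.comp (Continuous.prodMk_right t)
  have hder : ∀ t, HasDerivAt (fun t => ∫ x, G t x) (∫ x, G' t x) t := by
    intro t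
    obtain ⟨M, hM⟩ := ((isCompact_Icc (a := t - 1) (b := t + 1)).prod hK).exists_bound_of_continuousOn
      hG'.continuousOn
    refine (hasDerivAt_integral_of_dominated_loc_of_deriv_le (F := G) (F' := G')
      (bound := K.indicator fun _ => M) (s := Icc (t - 1) (t + 1)) (Icc_mem_nhds (by linarith) (by linarith)) ?_ ?_ ?_ ?_ ?_ ?_).2
    · exact Eventually.of_forall fun s => (hG s).aestronglyMeasurable
    · exact (hG t).integrable_of_hasCompactSupport (hGs t)
    · exact (hG'c t).aestronglyMeasurable
    · refine Eventually.of_forall fun x s hs => ?_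
      by_cases hx : x ∈ K
      · rw [indicator_of_mem hx]
        exact hM (s, x) ⟨hs, hx⟩
      · rw [indicator_of_notMem hx, h0' s x hx, norm_zero]
    · rw [integrable_indicator_iff hK.measurableSet]
      exact integrableOn_const hK.measure_lt_top.ne
    · exact Eventually.of_forall fun x s _ => hd s x
  have := constant_of_has_deriv_right_zero (f := fun t => ∫ x, G t x) (a := 0) (b := 1)
    (fun t _ => (hder t).continuousAt.continuousWithinAt)
    (fun t ht => by
      have := hder t
      rw [hint t ⟨ht.1, ht.2.le⟩] at this
      exact this.hasDerivWithinAt) 1 ⟨zero_le_one, le_rfl⟩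
  exact this.symm

lemma one_add_one_le_infty : (1 + 1 : WithTop ℕ∞) ≤ ∞ := by
  have : ((2 : ℕ∞) : WithTop ℕ∞) ≤ ((⊤ : ℕ∞) : WithTop ℕ∞) := WithTop.coe_le_coe.2 le_top
  simpa [one_add_one_eq_two] using this

/-- The vector field whose divergence computes the variation of the degree integrand. -/
def variationField {n : ℕ} (χ φ : Euc n → ℝ) (F V : Euc n → Euc n) (i : Fin n) (x : Euc n) : ℝ :=
  χ x * φ (F x) * volForm n (Function.update (fun j => fderiv ℝ F x (stdB n j)) i (V x))

lemma contDiff_variationField {n : ℕ} {χ φ : Euc n → ℝ} {F V : Euc n → Euc n}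
    (hχ : ContDiff ℝ ∞ χ) (hφ : ContDiff ℝ ∞ φ) (hF : ContDiff ℝ ∞ F) (hV : ContDiff ℝ ∞ V)
    (i : Fin n) : ContDiff ℝ 1 (variationField χ φ F V i) := by
  have h1 : ContDiff ℝ 1 χ := hχ.of_le (by exact_mod_cast le_top)
  have h2 : ContDiff ℝ 1 (fun x => φ (F x)) := (hφ.comp hF).of_le (by exact_mod_cast le_top)
  have h3 : ContDiff ℝ 1 (fderiv ℝ F) := hF.fderiv_right (m := 1) one_add_one_le_infty
  have h4 : ContDiff ℝ 1 V := hV.of_le (by exact_mod_cast le_top)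
  refine (h1.mul h2).mul ((volForm n).contDiff.comp (contDiff_pi.2 fun j => ?_))
  rcases eq_or_ne j i with rfl | hj
  · simpa using h4
  · simpa [hj] using h3.clm_apply contDiff_const

lemma sum_fderiv_variationField {n : ℕ} {χ φ : Euc n → ℝ} {F V : Euc n → Euc n}
    (hχ : ContDiff ℝ ∞ χ) (hφ : ContDiff ℝ ∞ φ) (hF : ContDiff ℝ ∞ F) (hV : ContDiff ℝ ∞ V)
    (x : Euc n) (h0 : φ (F x) ≠ 0 → fderiv ℝ χ x = 0) :
    ∑ i, fderiv ℝ (variationField χ φ F V i) x (stdB n i) =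
      χ x * (fderiv ℝ φ (F x) (V x) * volForm n (fun j => fderiv ℝ F x (stdB n j)) +
        φ (F x) * ∑ i, volForm n (Function.update (fun j => fderiv ℝ F x (stdB n j)) i
          (fderiv ℝ V x (stdB n i)))) := by
  set a : Fin n → Euc n := fun j => fderiv ℝ F x (stdB n j) with ha
  have hχ' : HasFDerivAt χ (fderiv ℝ χ x) x := (hχ.differentiable (by simp) x).hasFDerivAt
  have hF' : HasFDerivAt F (fderiv ℝ F x) x := (hF.differentiable (by simp) x).hasFDerivAt
  have hφ' : HasFDerivAt (fun y => φ (F y)) ((fderiv ℝ φ (F x)).comp (fderiv ℝ F x)) x :=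
    (hφ.differentiable (by simp) (F x)).hasFDerivAt.comp x hF'
  have hV' : HasFDerivAt V (fderiv ℝ V x) x := (hV.differentiable (by simp) x).hasFDerivAt
  have hDF : HasFDerivAt (fderiv ℝ F) (fderiv ℝ (fderiv ℝ F) x) x := by
    have : ContDiff ℝ 1 (fderiv ℝ F) := hF.fderiv_right (m := 1) one_add_one_le_infty
    exact (this.differentiable one_ne_zero x).hasFDerivAt
  have hsymm : ∀ i j, fderiv ℝ (fderiv ℝ F) x (stdB n i) (stdB n j) =
      fderiv ℝ (fderiv ℝ F) x (stdB n j) (stdB n i) := fun i j =>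
    (hF.contDiffAt (x := x)).isSymmSndFDerivAt (by simpa [one_add_one_eq_two] using one_add_one_le_infty) _ _
  have hcol : ∀ j, HasFDerivAt (fun y => fderiv ℝ F y (stdB n j))
      ((fderiv ℝ (fderiv ℝ F) x).flip (stdB n j)) x := fun j => by
    simpa using hDF.clm_apply (hasFDerivAt_const (stdB n j) x)
  have hX : ∀ i, fderiv ℝ (variationField χ φ F V i) x (stdB n i) =
      χ x * φ (F x) * ∑ j, volForm n (Function.update (Function.update a i (V x)) j
        (if j = i then fderiv ℝ V x (stdB n i) else
          fderiv ℝ (fderiv ℝ F) x (stdB n i) (stdB n j))) +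
      χ x * fderiv ℝ φ (F x) (a i) * volForm n (Function.update a i (V x)) := by
    intro i
    have hu : HasFDerivAt (fun y => Function.update (fun j => fderiv ℝ F y (stdB n j)) i (V y))
        (ContinuousLinearMap.pi fun j => if j = i then fderiv ℝ V x else
          (fderiv ℝ (fderiv ℝ F) x).flip (stdB n j)) x := by
      rw [hasFDerivAt_pi']
      intro j
      rcases eq_or_ne j i with rfl | hj
      · simpa [ContinuousLinearMap.proj_pi] using hV'
      · simpa [hj, ContinuousLinearMap.proj_pi] using hcol j
    have := ((hχ'.mul hφ').mul (hasFDerivAt_volForm hu)).fderiv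
    have e : variationField χ φ F V i = fun y => χ y * φ (F y) *
      volForm n (Function.update (fun j => fderiv ℝ F y (stdB n j)) i (V y)) := rfl
    rw [e]
    erw [this]
    simp only [add_apply, smul_apply, smul_eq_mul,
      ContinuousLinearMap.comp_apply, ContinuousMultilinearMap.linearDeriv_apply,
      ContinuousLinearMap.pi_apply]
    have hz : volForm n (Function.update a i (V x)) * (φ (F x) * fderiv ℝ χ x (stdB n i)) = 0 := by
      by_cases h : φ (F x) = 0
      · simp [h]
      · simp [h0 h]
    have hs : ∀ j, (if j = i then fderiv ℝ V x else
        (fderiv ℝ (fderiv ℝ F) x).flip (stdB n j)) (stdB n i) = (if j = i then fderiv ℝ V x (stdB n i) else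
          fderiv ℝ (fderiv ℝ F) x (stdB n i) (stdB n j)) := by
      intro j; split_ifs <;> rfl
    simp only [hs, Pi.mul_apply]
    linear_combination hz
  have hsplit : ∀ i, ∑ j, volForm n (Function.update (Function.update a i (V x)) j
        (if j = i then fderiv ℝ V x (stdB n i) else
          fderiv ℝ (fderiv ℝ F) x (stdB n i) (stdB n j))) =
      volForm n (Function.update a i (fderiv ℝ V x (stdB n i))) +
      ∑ j ∈ Finset.univ.erase i, volForm n (Function.update (Function.update a i (V x)) j
          (fderiv ℝ (fderiv ℝ F) x (stdB n i) (stdB n j))) := by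
    intro i
    rw [← Finset.add_sum_erase _ _ (Finset.mem_univ i), if_pos rfl, Function.update_idem]
    congr 1
    refine Finset.sum_congr rfl fun j hj => ?_
    rw [if_neg (Finset.ne_of_mem_erase hj)]
  simp only [hX, hsplit]
  rw [Finset.sum_add_distrib, ← Finset.mul_sum, Finset.sum_add_distrib,
    sum_volForm_symm a (V x) (fun i j => fderiv ℝ (fderiv ℝ F) x (stdB n i) (stdB n j)) hsymm,
    ← sum_volForm_update a (V x) (fderiv ℝ φ (F x))]
  have : ∑ i, χ x * fderiv ℝ φ (F x) (a i) * volForm n (Function.update a i (V x)) =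
      χ x * ∑ i, fderiv ℝ φ (F x) (a i) * volForm n (Function.update a i (V x)) := by
    rw [Finset.mul_sum]
    exact Finset.sum_congr rfl fun i _ => by ring
  rw [this]
  ring

/-- The degree integral of a smooth map. -/
def degIntegral {n : ℕ} (F : Euc n → Euc n) (φ : Euc n → ℝ) (O : Set (Euc n)) : ℝ :=
  ∫ x in O, φ (F x) * (fderiv ℝ F x).det

lemma exists_smooth_cutoff {n : ℕ} {C O : Set (Euc n)} (hC : IsCompact C) (hO : IsOpen O)
    (hCO : C ⊆ O) : ∃ (χ : Euc n → ℝ) (L : Set (Euc n)), ContDiff ℝ ∞ χ ∧ IsCompact L ∧ L ⊆ O ∧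
      (∀ x ∉ L, χ x = 0) ∧ (∀ x ∈ C, χ =ᶠ[𝓝 x] 1) ∧ ∀ x, χ x ∈ Icc (0 : ℝ) 1 := by
  obtain ⟨L1, hL1, hCL1, hL1O⟩ := exists_compact_between hC hO hCO
  obtain ⟨L2, hL2, hL12, hL2O⟩ := exists_compact_between hL1 hO hL1O
  obtain ⟨χ, hχ, hχ0, hχ1⟩ := exists_contMDiff_zero_iff_one_iff_of_isClosed (n := (⊤ : ℕ∞)) (modelWithCornersSelf ℝ (Euc n))
    (isOpen_interior (s := L2)).isClosed_compl hL1.isClosed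
    (disjoint_compl_left_iff_subset.2 hL12)
  refine ⟨χ, L2, contMDiff_iff_contDiff.1 hχ, hL2, hL2O, fun x hx => ?_, fun x hx => ?_, fun x => ?_⟩
  · exact (hχ1.1 x).1 fun h => hx (interior_subset h)
  · filter_upwards [isOpen_interior.mem_nhds (hCL1 hx)] with y hy
    exact (hχ1.2 y).1 (interior_subset hy)
  · exact hχ0 ⟨x, rfl⟩

set_option maxHeartbeats 1000000 in
lemma degIntegral_eq_of_segment {n : ℕ} {F₀ F₁ : Euc n → Euc n} {φ : Euc n → ℝ}
    {O : Set (Euc n)} (hO : IsOpen O) (hOb : Bornology.IsBounded O) (hF₀ : ContDiff ℝ ∞ F₀)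
    (hF₁ : ContDiff ℝ ∞ F₁) (hφ : ContDiff ℝ ∞ φ)
    (hfr : ∀ t ∈ Icc (0 : ℝ) 1, ∀ x ∈ frontier O, F₀ x + t • (F₁ x - F₀ x) ∉ tsupport φ) :
    degIntegral F₀ φ O = degIntegral F₁ φ O := by
  set V : Euc n → Euc n := fun x => F₁ x - F₀ x with hVdef
  have hV : ContDiff ℝ ∞ V := hF₁.sub hF₀
  have hcF := hF₀.continuous
  have hcV := hV.continuous
  have hcDF : Continuous (fderiv ℝ F₀) := hF₀.continuous_fderiv (by simp)
  have hcDV : Continuous (fderiv ℝ V) := hV.continuous_fderiv (by simp)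
  have hcφ := hφ.continuous
  have hcDφ : Continuous (fderiv ℝ φ) := hφ.continuous_fderiv (by simp)
  set S : Set (ℝ × Euc n) := (Icc 0 1 ×ˢ closure O) ∩
    (fun p : ℝ × Euc n => F₀ p.2 + p.1 • V p.2) ⁻¹' tsupport φ with hS
  have hScomp : IsCompact S := by
    refine (isCompact_Icc.prod hOb.isCompact_closure).inter_right ?_
    exact (isClosed_tsupport φ).preimage (by fun_prop)
  have hCO : Prod.snd '' S ⊆ O := by
    rintro _ ⟨⟨t, x⟩, ⟨⟨ht, hx⟩, hφx⟩, rfl⟩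
    by_contra hxO
    exact hfr t ht x (by rw [hO.frontier_eq]; exact ⟨hx, hxO⟩) hφx
  obtain ⟨χ, L, hχ, hL, hLO, hχ0, hχ1, -⟩ := exists_smooth_cutoff (hScomp.image continuous_snd) hO hCO
  have hcχ := hχ.continuous
  have hmemC : ∀ t ∈ Icc (0 : ℝ) 1, ∀ x ∈ O, φ (F₀ x + t • V x) ≠ 0 → x ∈ Prod.snd '' S :=
    fun t ht x hx h => ⟨(t, x), ⟨⟨ht, subset_closure hx⟩, subset_tsupport _ h⟩, rfl⟩
  have hdχ : ∀ t ∈ Icc (0 : ℝ) 1, ∀ x, φ (F₀ x + t • V x) ≠ 0 → fderiv ℝ χ x = 0 := by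
    intro t ht x h
    by_cases hx : x ∈ O
    · rw [(hχ1 x (hmemC t ht x hx h)).fderiv_eq]
      exact fderiv_const_apply (1 : ℝ)
    · have : χ =ᶠ[𝓝 x] fun _ => 0 := by
        filter_upwards [hL.isClosed.isOpen_compl.mem_nhds fun h => hx (hLO h)] with y hy using hχ0 y hy
      rw [this.fderiv_eq]
      exact fderiv_const_apply (0 : ℝ)
  have hFt : ∀ t : ℝ, ContDiff ℝ ∞ fun x => F₀ x + t • V x := fun t => hF₀.add (hV.const_smul t)
  have hDFt : ∀ (t : ℝ) x, fderiv ℝ (fun x => F₀ x + t • V x) x = fderiv ℝ F₀ x + t • fderiv ℝ V x := by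
    intro t x
    have h1 : HasFDerivAt F₀ (fderiv ℝ F₀ x) x := (hF₀.differentiable (by simp) x).hasFDerivAt
    have h2 : HasFDerivAt V (fderiv ℝ V x) x := (hV.differentiable (by simp) x).hasFDerivAt
    exact (h1.add (h2.const_smul t)).fderiv
  set a : ℝ → Euc n → Fin n → Euc n := fun t x j =>
    fderiv ℝ F₀ x (stdB n j) + t • fderiv ℝ V x (stdB n j) with ha
  have haeq : ∀ t x, (fun j => fderiv ℝ (fun x => F₀ x + t • V x) x (stdB n j)) = a t x := by
    intro t x; funext j; rw [hDFt]; rfl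
  have hac : Continuous fun p : ℝ × Euc n => a p.1 p.2 := by
    refine continuous_pi fun j => ?_
    simp only [ha]
    fun_prop
  set G : ℝ → Euc n → ℝ := fun t x => χ x * (φ (F₀ x + t • V x) * volForm n (a t x)) with hG
  set G' : ℝ → Euc n → ℝ := fun t x => χ x * (fderiv ℝ φ (F₀ x + t • V x) (V x) * volForm n (a t x) +
        φ (F₀ x + t • V x) * ∑ i, volForm n (Function.update (a t x) i
          (fderiv ℝ V x (stdB n i)))) with hG'
  have hGeq : ∀ t ∈ Icc (0 : ℝ) 1, ∫ x, G t x = degIntegral (fun x => F₀ x + t • V x) φ O := by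
    intro t ht
    rw [degIntegral, ← integral_indicator hO.measurableSet]
    congr 1
    funext x
    simp only [hG, ← haeq, volForm_clm]
    by_cases hx : x ∈ O
    · rw [indicator_of_mem hx]
      by_cases h : φ (F₀ x + t • V x) = 0
      · simp [h]
      · rw [(hχ1 x (hmemC t ht x hx h)).eq_of_nhds, Pi.one_apply, one_mul]
    · rw [indicator_of_notMem hx, hχ0 x fun h => hx (hLO h), zero_mul]
  have key : ∫ x, G 0 x = ∫ x, G 1 x := by
    refine integral_eq_of_integral_deriv_eq_zero (G' := G') ?_ ?_ ?_ hL ?_ ?_ ?_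
    · intro t x
      have h1 : HasDerivAt (fun t : ℝ => F₀ x + t • V x) (V x) t := by
        simpa using ((hasDerivAt_id t).smul_const (V x)).const_add (F₀ x)
      have h2 := ((hφ.differentiable (by simp) (F₀ x + t • V x)).hasFDerivAt).comp_hasDerivAt t h1
      have h3 : HasDerivAt (fun t : ℝ => a t x) (fun j => fderiv ℝ V x (stdB n j)) t := by
        rw [hasDerivAt_pi]
        intro j
        exact (((hasDerivAt_id t).smul_const (fderiv ℝ V x (stdB n j))).const_add
          (fderiv ℝ F₀ x (stdB n j))).congr_deriv (one_smul _ _)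
      have h4 := ((volForm n).hasFDerivAt (a t x)).comp_hasDerivAt t h3
      rw [ContinuousMultilinearMap.linearDeriv_apply] at h4
      exact ((h2.mul h4).const_mul (χ x))
    · intro t
      have : Continuous (a t) := hac.comp (Continuous.prodMk_right t)
      have hv : Continuous fun x => volForm n (a t x) := (volForm n).cont.comp this
      simp only [hG]
      fun_prop
    · have hv : Continuous fun p : ℝ × Euc n => volForm n (a p.1 p.2) := (volForm n).cont.comp hac
      have hv2 : ∀ i, Continuous fun p : ℝ × Euc n => volForm n (Function.update (a p.1 p.2) i
          (fderiv ℝ V p.2 (stdB n i))) := fun i => (volForm n).cont.comp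
            (hac.update i (by fun_prop))
      have hFc : Continuous fun p : ℝ × Euc n => F₀ p.2 + p.1 • V p.2 := by fun_prop
      have hd : Continuous fun p : ℝ × Euc n => fderiv ℝ φ (F₀ p.2 + p.1 • V p.2) (V p.2) :=
        (hcDφ.comp hFc).clm_apply (hcV.comp continuous_snd)
      exact (hcχ.comp continuous_snd).mul ((hd.mul hv).add ((hcφ.comp hFc).mul
        (continuous_finset_sum _ fun i _ => hv2 i)))
    · intro t x hx
      simp [hG, hχ0 x hx]
    · intro t x hx
      simp [hG', hχ0 x hx]
    · intro t ht
      have : G' t = fun x => ∑ i, fderiv ℝ (variationField χ φ (fun x => F₀ x + t • V x) V i) x (stdB n i) := by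
        funext x
        rw [sum_fderiv_variationField hχ hφ (hFt t) hV x (hdχ t ht x)]
        simp only [haeq, hG']
      rw [this]
      have hcd := fun i => contDiff_variationField hχ hφ (hFt t) hV i
      have hcs : ∀ i, HasCompactSupport (variationField χ φ (fun x => F₀ x + t • V x) V i) := fun i =>
        HasCompactSupport.intro hL fun x hx => by simp [variationField, hχ0 x hx]
      rw [integral_finset_sum]
      · exact Finset.sum_eq_zero fun i _ => integral_fderiv_eq_zero (hcd i) (hcs i) _
      · intro i _
        exact (((hcd i).continuous_fderiv one_ne_zero).clm_apply
          continuous_const).integrable_of_hasCompactSupport ((hcs i).fderiv_apply (𝕜 := ℝ) _)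
  rw [hGeq 0 (by simp), hGeq 1 (by simp)] at key
  simpa [hVdef] using key

lemma degIntegral_sub_const {n : ℕ} {F : Euc n → Euc n} {φ : Euc n → ℝ}
    {O : Set (Euc n)} (hO : IsOpen O) (hOb : Bornology.IsBounded O) (hF : ContDiff ℝ ∞ F)
    (hφ : ContDiff ℝ ∞ φ) {a : Euc n}
    (hfr : ∀ t ∈ Icc (0 : ℝ) 1, ∀ x ∈ frontier O, F x - t • a ∉ tsupport φ) :
    ∫ x in O, φ (F x - a) * (fderiv ℝ F x).det = degIntegral F φ O := by
  rw [degIntegral_eq_of_segment hO hOb hF (hF.sub contDiff_const : ContDiff ℝ ∞ fun x => F x - a) hφ]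
  · simp [degIntegral, fderiv_sub_const]
  · intro t ht x hx
    have := hfr t ht x hx
    have e : F x + t • (F x - a - F x) = F x - t • a := by module
    rwa [e]

lemma integral_mul_degIntegral {n : ℕ} {F : Euc n → Euc n} {φ ψ : Euc n → ℝ}
    {O : Set (Euc n)} (hO : IsOpen O) (hOb : Bornology.IsBounded O) (hF : ContDiff ℝ ∞ F)
    (hφ : ContDiff ℝ ∞ φ) (hψ : ContDiff ℝ ∞ ψ) {ε : ℝ}
    (hφs : tsupport φ ⊆ ball 0 ε) (hψs : tsupport ψ ⊆ ball 0 ε) (hφ1 : ∫ y, φ y = 1)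
    (hfr : ∀ x ∈ frontier O, 3 * ε ≤ ‖F x‖) :
    degIntegral F ψ O = ∫ x in O, (∫ a, φ a * ψ (F x - a)) * (fderiv ℝ F x).det := by
  have hdet : Continuous fun x => (fderiv ℝ F x).det :=
    ContinuousLinearMap.continuous_det.comp (hF.continuous_fderiv (by simp))
  have hz : ∀ a ∉ closedBall (0 : Euc n) ε, φ a = 0 := fun a ha => by
    by_contra h
    exact ha (ball_subset_closedBall (hφs (subset_tsupport _ h)))
  have hK : ∀ g : Euc n → ℝ, ∫ a in closedBall (0 : Euc n) ε, φ a * g a = ∫ a, φ a * g a := fun g =>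
    setIntegral_eq_integral_of_forall_compl_eq_zero fun a ha => by rw [hz a ha, zero_mul]
  have h1 : degIntegral F ψ O = ∫ a, φ a * ∫ x in O, ψ (F x - a) * (fderiv ℝ F x).det := by
    have : ∀ a, φ a * ∫ x in O, ψ (F x - a) * (fderiv ℝ F x).det = φ a * degIntegral F ψ O := by
      intro a
      by_cases ha : φ a = 0
      · simp [ha]
      · rw [degIntegral_sub_const hO hOb hF hψ]
        intro t ht x hx h
        have h2 := mem_ball_zero_iff.1 (hψs h)
        have h3 := mem_ball_zero_iff.1 (hφs (subset_tsupport _ ha))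
        have h4 : ‖t • a‖ ≤ ‖a‖ := by
          rw [norm_smul, Real.norm_of_nonneg ht.1]
          exact mul_le_of_le_one_left (norm_nonneg _) ht.2
        have h5 := hfr x hx
        have h6 := norm_sub_norm_le (F x) (t • a)
        have h7 := norm_nonneg a
        linarith
    simp only [this]
    rw [integral_mul_const, hφ1, one_mul]
  rw [h1, ← hK]
  have h2 : ∀ a, φ a * ∫ x in O, ψ (F x - a) * (fderiv ℝ F x).det =
      ∫ x in O, φ a * (ψ (F x - a) * (fderiv ℝ F x).det) := fun a => (integral_const_mul _ _).symm
  simp only [h2]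
  rw [integral_integral_swap]
  · congr 1
    funext x
    rw [← hK, ← integral_mul_const]
    congr 1
    funext a
    ring
  · rw [Measure.prod_restrict]
    have hc : Continuous (Function.uncurry fun a x => φ a * (ψ (F x - a) * (fderiv ℝ F x).det)) := by
      have := hφ.continuous
      have := hψ.continuous
      have := hF.continuous
      have hd : Continuous fun p : Euc n × Euc n => (fderiv ℝ F p.2).det := hdet.comp continuous_snd
      unfold Function.uncurry
      fun_prop
    have : IntegrableOn (Function.uncurry fun a x => φ a * (ψ (F x - a) * (fderiv ℝ F x).det))
        (closedBall (0 : Euc n) ε ×ˢ closure O) (volume.prod volume) :=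
      hc.continuousOn.integrableOn_compact ((isCompact_closedBall _ _).prod hOb.isCompact_closure)
    exact this.mono_set (prod_mono subset_rfl subset_closure)

lemma degIntegral_eq_of_test {n : ℕ} {F : Euc n → Euc n} {φ ψ : Euc n → ℝ}
    {O : Set (Euc n)} (hO : IsOpen O) (hOb : Bornology.IsBounded O) (hF : ContDiff ℝ ∞ F)
    (hφ : ContDiff ℝ ∞ φ) (hψ : ContDiff ℝ ∞ ψ) {ε : ℝ}
    (hφs : tsupport φ ⊆ ball 0 ε) (hψs : tsupport ψ ⊆ ball 0 ε) (hφ1 : ∫ y, φ y = 1)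
    (hψ1 : ∫ y, ψ y = 1) (hfr : ∀ x ∈ frontier O, 3 * ε ≤ ‖F x‖) :
    degIntegral F φ O = degIntegral F ψ O := by
  rw [integral_mul_degIntegral hO hOb hF hφ hψ hφs hψs hφ1 hfr,
    integral_mul_degIntegral hO hOb hF hψ hφ hψs hφs hψ1 hfr]
  congr 1
  funext x
  congr 1
  rw [← integral_sub_left_eq_self _ _ (F x)]
  congr 1
  funext a
  rw [sub_sub_cancel, mul_comm]

lemma exists_continuous_extension {X : Type*} [TopologicalSpace X] [NormalSpace X] {n : ℕ}
    {K : Set X} (hK : IsClosed K) {F : X → Euc n} (hF : ContinuousOn F K) :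
    ∃ F' : X → Euc n, Continuous F' ∧ EqOn F' F K := by
  have : TietzeExtension (Euc n) := TietzeExtension.of_tvs ℝ
  obtain ⟨g, hg⟩ := ContinuousMap.exists_restrict_eq hK
    (⟨K.restrict F, hF.restrict⟩ : C(K, Euc n))
  exact ⟨g, g.continuous, fun x hx => congrArg (fun h : C(K, Euc n) => h ⟨x, hx⟩) hg⟩

lemma exists_smooth_approx {n : ℕ} {K : Set (Euc n)} (hK : IsClosed K) {F : Euc n → Euc n}
    (hF : ContinuousOn F K) {ε : ℝ} (hε : 0 < ε) :
    ∃ F' : Euc n → Euc n, ContDiff ℝ ∞ F' ∧ ∀ x ∈ K, ‖F' x - F x‖ ≤ ε := by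
  obtain ⟨g, hg, hgF⟩ := exists_continuous_extension hK hF
  obtain ⟨F', hF', h, -⟩ := hg.exists_contDiff_approx (⊤ : ℕ∞) (ε := fun _ => ε) continuous_const
    (fun _ => hε)
  refine ⟨F', hF', fun x hx => ?_⟩
  rw [← hgF hx, ← dist_eq_norm]
  exact (h x).le

/-- Smooth test functions of integral one supported in the ball of radius `ε`. -/
structure IsTest {n : ℕ} (φ : Euc n → ℝ) (ε : ℝ) : Prop where
  smooth : ContDiff ℝ ∞ φ
  supp : tsupport φ ⊆ ball 0 ε
  int : ∫ y, φ y = 1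

lemma IsTest.mono {n : ℕ} {φ : Euc n → ℝ} {ε ε' : ℝ} (h : IsTest φ ε) (hε : ε ≤ ε') :
    IsTest φ ε' := ⟨h.smooth, h.supp.trans (ball_subset_ball hε), h.int⟩

lemma IsTest.eq_zero {n : ℕ} {φ : Euc n → ℝ} {ε : ℝ} (h : IsTest φ ε) {y : Euc n}
    (hy : ε ≤ ‖y‖) : φ y = 0 := by
  by_contra hne
  exact absurd (mem_ball_zero_iff.1 (h.supp (subset_tsupport _ hne))) (not_lt.2 hy)

lemma exists_isTest (n : ℕ) {ε : ℝ} (hε : 0 < ε) : ∃ φ : Euc n → ℝ, IsTest φ ε := by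
  let b : ContDiffBump (0 : Euc n) := ⟨ε / 3, ε / 2, by linarith, by linarith⟩
  refine ⟨b.normed volume, b.contDiff_normed, ?_, b.integral_normed⟩
  rw [b.tsupport_normed_eq]
  exact closedBall_subset_ball (by change ε / 2 < ε; linarith)

/-- `F` is an `ε`-admissible smooth approximation on `O`. -/
structure IsDegData {n : ℕ} (F : Euc n → Euc n) (Ω : Set (Euc n)) (O : Set (Euc n)) (ε : ℝ)
    (F' : Euc n → Euc n) (φ : Euc n → ℝ) : Prop where
  isOpen : IsOpen O
  bdd : Bornology.IsBounded O
  closure_subset : closure O ⊆ Ω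
  zeros : ∀ x ∈ Ω, F x = 0 → x ∈ O
  pos : 0 < ε
  frontier_le : ∀ x ∈ frontier O, 4 * ε ≤ ‖F x‖
  smooth : ContDiff ℝ ∞ F'
  approx : ∀ x ∈ closure O, ‖F' x - F x‖ ≤ ε
  test : IsTest φ ε

/-- A continuous map on an open set with compact zero set. -/
structure DegAdm {n : ℕ} (F : Euc n → Euc n) (Ω : Set (Euc n)) : Prop where
  isOpen : IsOpen Ω
  cont : ContinuousOn F Ω
  compact : IsCompact {x ∈ Ω | F x = 0}

lemma exists_pos_le_norm {X : Type*} [TopologicalSpace X] {n : ℕ} {K : Set X} (hK : IsCompact K)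
    {F : X → Euc n}
    (hF : ContinuousOn F K) (h0 : ∀ x ∈ K, F x ≠ 0) : ∃ m > 0, ∀ x ∈ K, m ≤ ‖F x‖ := by
  rcases K.eq_empty_or_nonempty with rfl | hne
  · exact ⟨1, one_pos, by simp⟩
  · obtain ⟨x, hx, hmin⟩ := hK.exists_isMinOn hne hF.norm
    exact ⟨‖F x‖, norm_pos_iff.2 (h0 x hx), fun y hy => hmin hy⟩

lemma exists_bounded_open_between {n : ℕ} {K Ω : Set (Euc n)} (hK : IsCompact K) (hΩ : IsOpen Ω)
    (h : K ⊆ Ω) : ∃ O, IsOpen O ∧ Bornology.IsBounded O ∧ K ⊆ O ∧ closure O ⊆ Ω := by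
  obtain ⟨L, hL, hKL, hLΩ⟩ := exists_compact_between hK hΩ h
  exact ⟨interior L, isOpen_interior, hL.isBounded.subset interior_subset, hKL,
    (closure_minimal interior_subset hL.isClosed).trans hLΩ⟩

lemma DegAdm.exists_data {n : ℕ} {F : Euc n → Euc n} {Ω : Set (Euc n)} (h : DegAdm F Ω) :
    ∃ O ε F' φ, IsDegData F Ω O ε F' φ := by
  obtain ⟨O, hO, hOb, hKO, hOΩ⟩ := exists_bounded_open_between h.compact h.isOpen (fun x hx => hx.1)
  obtain ⟨m, hm, hmF⟩ := exists_pos_le_norm (K := frontier O)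
    (hOb.isCompact_closure.of_isClosed_subset isClosed_frontier frontier_subset_closure)
    (h.cont.mono (frontier_subset_closure.trans hOΩ)) (fun x hx h0 => by
      have h1 := hKO ⟨hOΩ (frontier_subset_closure hx), h0⟩
      rw [hO.frontier_eq] at hx
      exact hx.2 h1)
  obtain ⟨F', hF', hFF'⟩ := exists_smooth_approx isClosed_closure (h.cont.mono hOΩ)
    (ε := m / 4) (by linarith)
  obtain ⟨φ, hφ⟩ := exists_isTest n (ε := m / 4) (by linarith)
  exact ⟨O, m / 4, F', φ, hO, hOb, hOΩ, fun x hx h0 => hKO ⟨hx, h0⟩, by linarith,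
    fun x hx => by linarith [hmF x hx], hF', hFF', hφ⟩

lemma degIntegral_congr_open {n : ℕ} {F : Euc n → Euc n} {φ : Euc n → ℝ} {O O' : Set (Euc n)}
    (hO' : IsOpen O') (hO : IsOpen O) (hsub : O' ⊆ O) (h0 : ∀ x ∈ O \ O', φ (F x) = 0) :
    degIntegral F φ O = degIntegral F φ O' := by
  rw [degIntegral, degIntegral, ← integral_indicator hO.measurableSet,
    ← integral_indicator hO'.measurableSet]
  congr 1
  funext x
  by_cases hx' : x ∈ O'
  · rw [indicator_of_mem hx', indicator_of_mem (hsub hx')]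
  · rw [indicator_of_notMem hx']
    by_cases hx : x ∈ O
    · rw [indicator_of_mem hx, h0 x ⟨hx, hx'⟩, zero_mul]
    · rw [indicator_of_notMem hx]

lemma norm_segment_ge {n : ℕ} {y a b : Euc n} {ε m t : ℝ} (hy : m ≤ ‖y‖) (ha : ‖a - y‖ ≤ ε)
    (hb : ‖b - y‖ ≤ ε) (ht : t ∈ Icc (0 : ℝ) 1) : m - ε ≤ ‖a + t • (b - a)‖ := by
  have h1 : y - (a + t • (b - a)) = -((1 - t) • (a - y) + t • (b - y)) := by module
  have h2 : ‖y - (a + t • (b - a))‖ ≤ ε := by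
    rw [h1, norm_neg]
    refine (norm_add_le _ _).trans ?_
    rw [norm_smul, norm_smul, Real.norm_of_nonneg ht.1, Real.norm_of_nonneg (sub_nonneg.2 ht.2)]
    nlinarith [ht.1, ht.2]
  have := norm_sub_norm_le y (a + t • (b - a))
  linarith

lemma IsDegData.refine {n : ℕ} {F : Euc n → Euc n} {Ω O : Set (Euc n)} {ε : ℝ}
    {F' : Euc n → Euc n} {φ : Euc n → ℝ} (h : IsDegData F Ω O ε F' φ) {O' : Set (Euc n)}
    (hO' : IsOpen O') (hsub : O' ⊆ O) {δ : ℝ} (hδ : δ ≤ ε)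
    (hlow : ∀ x ∈ O \ O', 2 * δ ≤ ‖F x‖) {F'' : Euc n → Euc n} (hF'' : ContDiff ℝ ∞ F'')
    (happ : ∀ x ∈ closure O, ‖F'' x - F x‖ ≤ δ) {ψ : Euc n → ℝ} (hψ : IsTest ψ δ) :
    degIntegral F' φ O = degIntegral F'' ψ O' := by
  have hψ' := hψ.mono hδ
  have h1 : degIntegral F' φ O = degIntegral F' ψ O := by
    refine degIntegral_eq_of_test h.isOpen h.bdd h.smooth h.test.smooth hψ.smooth h.test.supp
      hψ'.supp h.test.int hψ.int fun x hx => ?_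
    have h2 := h.frontier_le x hx
    have h3 := h.approx x (frontier_subset_closure hx)
    have h4 := norm_sub_norm_le (F x) (F' x)
    rw [norm_sub_rev] at h4
    linarith
  rw [h1, degIntegral_eq_of_segment h.isOpen h.bdd h.smooth hF'' hψ.smooth]
  · refine degIntegral_congr_open hO' h.isOpen hsub fun x hx => hψ.eq_zero ?_
    have h2 := hlow x hx
    have h3 := happ x (subset_closure hx.1)
    have h4 := norm_sub_norm_le (F x) (F'' x)
    rw [norm_sub_rev] at h4
    linarith
  · intro t ht x hx hmem
    have h2 := norm_segment_ge (h.frontier_le x hx) (h.approx x (frontier_subset_closure hx))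
      ((happ x (frontier_subset_closure hx)).trans hδ) ht
    have h3 := mem_ball_zero_iff.1 (hψ'.supp hmem)
    linarith [h.pos]

lemma IsDegData.unique {n : ℕ} {F : Euc n → Euc n} {Ω O₁ O₂ : Set (Euc n)} {ε₁ ε₂ : ℝ}
    {F₁ F₂ : Euc n → Euc n} {φ₁ φ₂ : Euc n → ℝ} (hF : ContinuousOn F Ω)
    (h₁ : IsDegData F Ω O₁ ε₁ F₁ φ₁)
    (h₂ : IsDegData F Ω O₂ ε₂ F₂ φ₂) : degIntegral F₁ φ₁ O₁ = degIntegral F₂ φ₂ O₂ := by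
  set K := (closure O₁ ∪ closure O₂) \ (O₁ ∩ O₂) with hK
  have hKc : IsCompact K := (h₁.bdd.isCompact_closure.union h₂.bdd.isCompact_closure).diff
    (h₁.isOpen.inter h₂.isOpen)
  have hsubΩ : closure O₁ ∪ closure O₂ ⊆ Ω := union_subset h₁.closure_subset h₂.closure_subset
  obtain ⟨m, hm, hmF⟩ := exists_pos_le_norm hKc (hF.mono (diff_subset.trans hsubΩ))
    (fun x hx h0 => hx.2 ⟨h₁.zeros x (hsubΩ hx.1) h0, h₂.zeros x (hsubΩ hx.1) h0⟩)
  obtain ⟨δ, hδ, hδ1, hδ2, hδm⟩ : ∃ δ > 0, δ ≤ ε₁ ∧ δ ≤ ε₂ ∧ 2 * δ ≤ m :=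
    ⟨min (min ε₁ ε₂) (m / 2), lt_min (lt_min h₁.pos h₂.pos) (by linarith),
      (min_le_left _ _).trans (min_le_left _ _), (min_le_left _ _).trans (min_le_right _ _), by
        linarith [min_le_right (min ε₁ ε₂) (m / 2)]⟩
  obtain ⟨F', hF', happ⟩ := exists_smooth_approx (isClosed_closure.union isClosed_closure)
    (hF.mono hsubΩ) hδ
  obtain ⟨φ, hφ⟩ := exists_isTest n hδ
  have hO := h₁.isOpen.inter h₂.isOpen
  rw [h₁.refine hO inter_subset_left hδ1 (fun x hx => hδm.trans (hmF x ⟨Or.inl (subset_closure hx.1), hx.2⟩))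
      hF' (fun x hx => happ x (Or.inl hx)) hφ,
    h₂.refine hO inter_subset_right hδ2 (fun x hx => hδm.trans (hmF x ⟨Or.inr (subset_closure hx.1), hx.2⟩))
      hF' (fun x hx => happ x (Or.inr hx)) hφ]

open Classical in
/-- The Brouwer degree of `F` on `Ω` over `0`. -/
def locDeg {n : ℕ} (F : Euc n → Euc n) (Ω : Set (Euc n)) : ℝ :=
  if h : ∃ d, ∃ O ε F' φ, IsDegData F Ω O ε F' φ ∧ d = degIntegral F' φ O then h.choose else 0

lemma IsDegData.locDeg_eq {n : ℕ} {F : Euc n → Euc n} {Ω O : Set (Euc n)} {ε : ℝ}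
    {F' : Euc n → Euc n} {φ : Euc n → ℝ} (h : IsDegData F Ω O ε F' φ) (hF : ContinuousOn F Ω) :
    locDeg F Ω = degIntegral F' φ O := by
  have h' : ∃ d, ∃ O ε F' φ, IsDegData F Ω O ε F' φ ∧ d = degIntegral F' φ O :=
    ⟨_, O, ε, F', φ, h, rfl⟩
  rw [locDeg, dif_pos h']
  obtain ⟨O₁, ε₁, F₁, φ₁, h₁, e⟩ := h'.choose_spec
  rw [e]
  exact h₁.unique hF h

lemma exists_isDegData_of_frontier {n : ℕ} {F : Euc n → Euc n} {Ω O : Set (Euc n)}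
    (hF : ContinuousOn F Ω) (hO : IsOpen O) (hOb : Bornology.IsBounded O) (hOΩ : closure O ⊆ Ω)
    (hz : ∀ x ∈ Ω, F x = 0 → x ∈ O) {ε : ℝ} (hε : 0 < ε)
    (hfr : ∀ x ∈ frontier O, 4 * ε ≤ ‖F x‖) : ∃ F', ∀ φ, IsTest φ ε → IsDegData F Ω O ε F' φ := by
  obtain ⟨F', hF', happ⟩ := exists_smooth_approx isClosed_closure (hF.mono hOΩ) hε
  exact ⟨F', fun φ hφ => ⟨hO, hOb, hOΩ, hz, hε, hfr, hF', happ, hφ⟩⟩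

lemma locDeg_eq_of_segment {n : ℕ} {F G : Euc n → Euc n} {Ω₁ Ω₂ O : Set (Euc n)}
    (hF : ContinuousOn F Ω₁) (hG : ContinuousOn G Ω₂) (hO : IsOpen O)
    (hOb : Bornology.IsBounded O) (hOΩ₁ : closure O ⊆ Ω₁) (hOΩ₂ : closure O ⊆ Ω₂)
    (hzF : ∀ x ∈ Ω₁, F x = 0 → x ∈ O) (hzG : ∀ x ∈ Ω₂, G x = 0 → x ∈ O)
    (hfr : ∀ t ∈ Icc (0 : ℝ) 1, ∀ x ∈ frontier O, F x + t • (G x - F x) ≠ 0) :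
    locDeg F Ω₁ = locDeg G Ω₂ := by
  have hfc : IsCompact (frontier O) :=
    hOb.isCompact_closure.of_isClosed_subset isClosed_frontier frontier_subset_closure
  have hFf := hF.mono (frontier_subset_closure.trans hOΩ₁)
  have hGf := hG.mono (frontier_subset_closure.trans hOΩ₂)
  have hs : MapsTo Prod.snd (Icc (0 : ℝ) 1 ×ˢ frontier O) (frontier O) := fun p hp => hp.2
  obtain ⟨m, hm, hmin⟩ := exists_pos_le_norm (K := Icc (0 : ℝ) 1 ×ˢ frontier O)
    (isCompact_Icc.prod hfc) (F := fun p => F p.2 + p.1 • (G p.2 - F p.2))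
    ((hFf.comp continuousOn_snd hs).add (continuousOn_fst.smul
      ((hGf.comp continuousOn_snd hs).sub (hFf.comp continuousOn_snd hs))))
    (fun p hp => hfr p.1 hp.1 p.2 hp.2)
  have hm4 : 0 < m / 4 := by linarith
  obtain ⟨F', hF'⟩ := exists_isDegData_of_frontier hF hO hOb hOΩ₁ hzF hm4 (fun x hx => by
    have := hmin (0, x) ⟨by simp, hx⟩
    simp only [zero_smul, add_zero] at this
    linarith)
  obtain ⟨G', hG'⟩ := exists_isDegData_of_frontier hG hO hOb hOΩ₂ hzG hm4 (fun x hx => by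
    have := hmin (1, x) ⟨by simp, hx⟩
    simp only [one_smul, add_sub_cancel] at this
    linarith)
  obtain ⟨φ, hφ⟩ := exists_isTest n hm4
  have dF := hF' φ hφ
  have dG := hG' φ hφ
  rw [dF.locDeg_eq hF, dG.locDeg_eq hG]
  refine degIntegral_eq_of_segment hO hOb dF.smooth dG.smooth hφ.smooth fun t ht x hx hmem => ?_
  have h1 := hmin (t, x) ⟨ht, hx⟩
  have h2 := mem_ball_zero_iff.1 (hφ.supp hmem)
  have h3 := dF.approx x (frontier_subset_closure hx)
  have h4 := dG.approx x (frontier_subset_closure hx)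
  have h5 : (F x + t • (G x - F x)) - (F' x + t • (G' x - F' x)) =
    -((1 - t) • (F' x - F x) + t • (G' x - G x)) := by module
  have h6 : ‖(F x + t • (G x - F x)) - (F' x + t • (G' x - F' x))‖ ≤ m / 4 := by
    rw [h5, norm_neg]
    refine (norm_add_le _ _).trans ?_
    rw [norm_smul, norm_smul, Real.norm_of_nonneg ht.1, Real.norm_of_nonneg (sub_nonneg.2 ht.2)]
    nlinarith [ht.1, ht.2]
  have h7 := norm_sub_norm_le (F x + t • (G x - F x)) (F' x + t • (G' x - F' x))
  simp only at h1
  linarith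

lemma locDeg_eq_of_homotopy {n : ℕ} {F G : Euc n → Euc n} {Ω : Set (Euc n)} (hΩ : IsOpen Ω)
    (hF : ContinuousOn F Ω) (hG : ContinuousOn G Ω) {K : Set (Euc n)} (hK : IsCompact K)
    (hKΩ : K ⊆ Ω)
    (hZ : ∀ t ∈ Icc (0 : ℝ) 1, ∀ x ∈ Ω, F x + t • (G x - F x) = 0 → x ∈ K) :
    locDeg F Ω = locDeg G Ω := by
  obtain ⟨O, hO, hOb, hKO, hOΩ⟩ := exists_bounded_open_between hK hΩ hKΩ
  refine locDeg_eq_of_segment hF hG hO hOb hOΩ hOΩ (fun x hx h => hKO (hZ 0 (by simp) x hx (by simpa)))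
    (fun x hx h => hKO (hZ 1 (by simp) x hx (by simpa))) fun t ht x hx h0 => ?_
  have := hKO (hZ t ht x (hOΩ (frontier_subset_closure hx)) h0)
  rw [hO.frontier_eq] at hx
  exact hx.2 this

lemma locDeg_congr_excision {n : ℕ} {F G : Euc n → Euc n} {Ω Ω' : Set (Euc n)} (hF : DegAdm F Ω)
    (hG : ContinuousOn G Ω') (hΩ' : IsOpen Ω') (hFG : EqOn F G Ω') (hsub : Ω' ⊆ Ω)
    (hz : ∀ x ∈ Ω, F x = 0 → x ∈ Ω') : locDeg F Ω = locDeg G Ω' := by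
  obtain ⟨O, hO, hOb, hKO, hOΩ⟩ := exists_bounded_open_between hF.compact hΩ'
    (fun x hx => hz x hx.1 hx.2)
  refine locDeg_eq_of_segment hF.cont hG hO hOb (hOΩ.trans hsub) hOΩ
    (fun x hx h => hKO ⟨hx, h⟩) (fun x hx h => hKO ⟨hsub hx, (hFG hx).trans h⟩) ?_
  intro t ht x hx h0
  have hx' := hOΩ (frontier_subset_closure hx)
  rw [← hFG hx', sub_self, smul_zero, add_zero] at h0
  rw [hO.frontier_eq] at hx
  exact hx.2 (hKO ⟨hsub hx', h0⟩)

lemma locDeg_congr {n : ℕ} {F G : Euc n → Euc n} {Ω : Set (Euc n)} (hF : DegAdm F Ω)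
    (hFG : EqOn F G Ω) : locDeg F Ω = locDeg G Ω :=
  locDeg_congr_excision hF (hF.cont.congr fun _ hx => (hFG hx).symm) hF.isOpen hFG subset_rfl
    fun _ hx _ => hx

lemma DegAdm.mono {n : ℕ} {F : Euc n → Euc n} {Ω Ω' : Set (Euc n)} (hF : DegAdm F Ω)
    (hΩ' : IsOpen Ω') (hsub : Ω' ⊆ Ω) (hz : ∀ x ∈ Ω, F x = 0 → x ∈ Ω') : DegAdm F Ω' := by
  refine ⟨hΩ', hF.cont.mono hsub, ?_⟩
  convert hF.compact using 1
  ext x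
  exact ⟨fun h => ⟨hsub h.1, h.2⟩, fun h => ⟨hz x h.1 h.2, h.2⟩⟩

lemma locDeg_excision {n : ℕ} {F : Euc n → Euc n} {Ω Ω' : Set (Euc n)} (hF : DegAdm F Ω)
    (hΩ' : IsOpen Ω') (hsub : Ω' ⊆ Ω) (hz : ∀ x ∈ Ω, F x = 0 → x ∈ Ω') :
    locDeg F Ω = locDeg F Ω' :=
  locDeg_congr_excision hF (hF.cont.mono hsub) hΩ' (fun _ _ => rfl) hsub hz

lemma locDeg_eq_zero {n : ℕ} {F : Euc n → Euc n} {Ω : Set (Euc n)} (hF : ContinuousOn F Ω)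
    (hz : ∀ x ∈ Ω, F x ≠ 0) : locDeg F Ω = 0 := by
  obtain ⟨F', hF'⟩ := exists_isDegData_of_frontier hF isOpen_empty Bornology.isBounded_empty
    (by simp) (fun x hx h => hz x hx h) one_pos (by simp)
  obtain ⟨φ, hφ⟩ := exists_isTest n one_pos
  rw [(hF' φ hφ).locDeg_eq hF]
  simp [degIntegral]

lemma locDeg_id_sub {n : ℕ} {Ω : Set (Euc n)} (hΩ : IsOpen Ω) {q : Euc n} (hq : q ∈ Ω) :
    locDeg (fun x => x - q) Ω = 1 := by
  obtain ⟨r, hr, hball⟩ := Metric.nhds_basis_closedBall.mem_iff.1 (hΩ.mem_nhds hq)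
  obtain ⟨φ, hφ⟩ := exists_isTest n (ε := r / 4) (by linarith)
  have hd : IsDegData (fun x => x - q) Ω (ball q r) (r / 4) (fun x => x - q) φ := by
    refine ⟨isOpen_ball, isBounded_ball, closure_ball_subset_closedBall.trans hball, ?_, by linarith, ?_, ?_, ?_, hφ⟩
    · intro x _ hx
      rw [sub_eq_zero.1 hx]
      exact mem_ball_self hr
    · intro x hx
      have := frontier_ball_subset_sphere hx
      rw [mem_sphere, dist_eq_norm] at this
      rw [this]
      linarith
    · exact contDiff_id.sub contDiff_const
    · intro x _
      rw [sub_self, norm_zero]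
      linarith
  rw [hd.locDeg_eq (by fun_prop), degIntegral]
  have hdet : ∀ x, (fderiv ℝ (fun x : Euc n => x - q) x).det = 1 := by
    intro x
    rw [fderiv_sub_const, fderiv_fun_id]
    exact LinearMap.det_id
  simp only [hdet, mul_one]
  rw [setIntegral_eq_integral_of_forall_compl_eq_zero]
  · rw [integral_sub_right_eq_self φ q, hφ.int]
  · intro x hx
    refine hφ.eq_zero ?_
    rw [mem_ball, dist_eq_norm, not_lt] at hx
    linarith

lemma locDeg_union {n : ℕ} {F : Euc n → Euc n} {Ω₁ Ω₂ : Set (Euc n)} (h₁ : DegAdm F Ω₁)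
    (h₂ : DegAdm F Ω₂) (hd : Disjoint Ω₁ Ω₂) : locDeg F (Ω₁ ∪ Ω₂) = locDeg F Ω₁ + locDeg F Ω₂ := by
  obtain ⟨O₁, ε₁, F₁, φ₁, d₁⟩ := h₁.exists_data
  obtain ⟨O₂, ε₂, F₂, φ₂, d₂⟩ := h₂.exists_data
  have hc : ContinuousOn F (Ω₁ ∪ Ω₂) := h₁.cont.union_of_isOpen h₂.cont h₁.isOpen h₂.isOpen
  have hclos : closure (O₁ ∪ O₂) ⊆ Ω₁ ∪ Ω₂ := by
    rw [closure_union]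
    exact union_subset_union d₁.closure_subset d₂.closure_subset
  set ε := min ε₁ ε₂ with hε
  have hεpos : 0 < ε := lt_min d₁.pos d₂.pos
  obtain ⟨F', hF', happ⟩ := exists_smooth_approx isClosed_closure (hc.mono hclos) hεpos
  obtain ⟨φ, hφ⟩ := exists_isTest n hεpos
  have hle1 : ε ≤ ε₁ := min_le_left _ _
  have hle2 : ε ≤ ε₂ := min_le_right _ _
  have e₁ : IsDegData F Ω₁ O₁ ε F' φ := ⟨d₁.isOpen, d₁.bdd, d₁.closure_subset, d₁.zeros, hεpos,
    fun x hx => by linarith [d₁.frontier_le x hx], hF',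
    fun x hx => happ x (closure_mono subset_union_left hx), hφ⟩
  have e₂ : IsDegData F Ω₂ O₂ ε F' φ := ⟨d₂.isOpen, d₂.bdd, d₂.closure_subset, d₂.zeros, hεpos,
    fun x hx => by linarith [d₂.frontier_le x hx], hF',
    fun x hx => happ x (closure_mono subset_union_right hx), hφ⟩
  have e : IsDegData F (Ω₁ ∪ Ω₂) (O₁ ∪ O₂) ε F' φ := by
    refine ⟨d₁.isOpen.union d₂.isOpen, d₁.bdd.union d₂.bdd, hclos, ?_, hεpos, ?_, hF', happ, hφ⟩
    · rintro x (hx | hx) h0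
      · exact Or.inl (d₁.zeros x hx h0)
      · exact Or.inr (d₂.zeros x hx h0)
    · intro x hx
      rcases frontier_union_subset _ _ hx with h | h
      · exact e₁.frontier_le x h.1
      · exact e₂.frontier_le x h.2
  rw [e.locDeg_eq hc, e₁.locDeg_eq h₁.cont, e₂.locDeg_eq h₂.cont, degIntegral]
  have hcont : Continuous fun x => φ (F' x) * (fderiv ℝ F' x).det :=
    (hφ.smooth.continuous.comp hF'.continuous).mul
      (ContinuousLinearMap.continuous_det.comp (hF'.continuous_fderiv (by simp)))
  have hint : ∀ O : Set (Euc n), Bornology.IsBounded O →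
      IntegrableOn (fun x => φ (F' x) * (fderiv ℝ F' x).det) O := fun O hO =>
    (hcont.continuousOn.integrableOn_compact hO.isCompact_closure).mono_set subset_closure
  exact setIntegral_union (hd.mono (subset_closure.trans d₁.closure_subset)
    (subset_closure.trans d₂.closure_subset)) d₂.isOpen.measurableSet (hint _ d₁.bdd) (hint _ d₂.bdd)

lemma DegAdm.union {n : ℕ} {F : Euc n → Euc n} {Ω₁ Ω₂ : Set (Euc n)} (h₁ : DegAdm F Ω₁)
    (h₂ : DegAdm F Ω₂) : DegAdm F (Ω₁ ∪ Ω₂) := by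
  refine ⟨h₁.isOpen.union h₂.isOpen, h₁.cont.union_of_isOpen h₂.cont h₁.isOpen h₂.isOpen, ?_⟩
  convert h₁.compact.union h₂.compact using 1
  ext x
  simp only [mem_union, mem_setOf_eq]
  tauto

lemma locDeg_biUnion {n : ℕ} {ι : Type*} {F : Euc n → Euc n} (Z : Finset ι)
    (Ω : ι → Set (Euc n)) (h : ∀ i ∈ Z, DegAdm F (Ω i)) (hd : (Z : Set ι).PairwiseDisjoint Ω) :
    DegAdm F (⋃ i ∈ Z, Ω i) ∧ locDeg F (⋃ i ∈ Z, Ω i) = ∑ i ∈ Z, locDeg F (Ω i) := by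
  classical
  induction Z using Finset.induction_on with
  | empty =>
    refine ⟨⟨by simp, by simp, by simp⟩, ?_⟩
    rw [Finset.sum_empty]
    exact locDeg_eq_zero (by simp) (by simp)
  | insert a s ha ih =>
    obtain ⟨ih1, ih2⟩ := ih (fun i hi => h i (Finset.mem_insert_of_mem hi))
      (hd.subset (by simp))
    have ha' := h a (Finset.mem_insert_self a s)
    rw [Finset.set_biUnion_insert, Finset.sum_insert ha]
    refine ⟨ha'.union ih1, ?_⟩
    rw [locDeg_union ha' ih1, ih2]
    rw [disjoint_iUnion₂_right]
    intro i hi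
    refine hd (by simp) (by simp [hi]) ?_
    rintro rfl
    exact ha hi

lemma locDeg_eq_sum {n : ℕ} {ι : Type*} {F : Euc n → Euc n} {Ω : Set (Euc n)} (hF : DegAdm F Ω)
    (Z : Finset ι) (Ω' : ι → Set (Euc n)) (ho : ∀ i ∈ Z, IsOpen (Ω' i))
    (hsub : ∀ i ∈ Z, Ω' i ⊆ Ω) (hd : (Z : Set ι).PairwiseDisjoint Ω')
    (hz : ∀ x ∈ Ω, F x = 0 → ∃ i ∈ Z, x ∈ Ω' i) : locDeg F Ω = ∑ i ∈ Z, locDeg F (Ω' i) := by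
  have hadm : ∀ i ∈ Z, DegAdm F (Ω' i) := by
    intro i hi
    refine ⟨ho i hi, hF.cont.mono (hsub i hi), ?_⟩
    have : {x ∈ Ω' i | F x = 0} = {x ∈ Ω | F x = 0} \ ⋃ j ∈ {j | j ∈ Z ∧ j ≠ i}, Ω' j := by
      ext x
      simp only [mem_setOf_eq, mem_diff, mem_iUnion, not_exists]
      constructor
      · rintro ⟨hx, h0⟩
        refine ⟨⟨hsub i hi hx, h0⟩, ?_⟩
        rintro j ⟨hj, hji⟩ hxj
        exact (hd hj hi hji).le_bot ⟨hxj, hx⟩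
      · rintro ⟨⟨hx, h0⟩, hn⟩
        obtain ⟨j, hj, hxj⟩ := hz x hx h0
        by_cases hji : j = i
        · exact ⟨hji ▸ hxj, h0⟩
        · exact absurd hxj (hn j ⟨hj, hji⟩)
    rw [this]
    exact hF.compact.diff (isOpen_biUnion fun j hj => ho j hj.1)
  obtain ⟨-, h2⟩ := locDeg_biUnion Z Ω' hadm hd
  rw [← h2]
  refine locDeg_excision hF (isOpen_biUnion ho) (iUnion₂_subset hsub) fun x hx h0 => ?_
  obtain ⟨i, hi, hxi⟩ := hz x hx h0
  exact mem_biUnion hi hxi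

lemma IsPreconnected.eq_of_eventually_eq {X α : Type*} [TopologicalSpace X] {S : Set X}
    (hS : IsPreconnected S) {d : X → α} (h : ∀ x ∈ S, ∀ᶠ y in 𝓝[S] x, d y = d x) {x y : X}
    (hx : x ∈ S) (hy : y ∈ S) : d x = d y := by
  have := isPreconnected_iff_preconnectedSpace.1 hS
  have hl : IsLocallyConstant fun x : S => d x := by
    rw [IsLocallyConstant.iff_eventually_eq]
    intro x
    have := h x x.2
    rw [nhdsWithin_eq_map_subtype_coe x.2, eventually_map] at this
    exact this
  exact hl.apply_eq_of_isPreconnected isPreconnected_univ (mem_univ (⟨x, hx⟩ : S)) (mem_univ (⟨y, hy⟩ : S))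

/-- `F : Ω → ℝ^n` is proper over `V`. -/
def ProperOver {n : ℕ} (F : Euc n → Euc n) (Ω V : Set (Euc n)) : Prop :=
  ∀ A ⊆ V, IsCompact A → IsCompact (Ω ∩ F ⁻¹' A)

lemma ProperOver.degAdm {n : ℕ} {F : Euc n → Euc n} {Ω V : Set (Euc n)} (h : ProperOver F Ω V)
    (hΩ : IsOpen Ω) (hF : ContinuousOn F Ω) {q : Euc n} (hq : q ∈ V) :
    DegAdm (fun x => F x - q) Ω := by
  refine ⟨hΩ, hF.sub continuousOn_const, ?_⟩
  convert h {q} (singleton_subset_iff.2 hq) isCompact_singleton using 1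
  ext x
  simp [sub_eq_zero]

lemma locDeg_sub_eventually_eq {n : ℕ} {F : Euc n → Euc n} {Ω A : Set (Euc n)} (hΩ : IsOpen Ω)
    (hF : ContinuousOn F Ω) {q₀ : Euc n} (hA : A ∈ 𝓝 q₀) (hc : IsCompact (Ω ∩ F ⁻¹' A)) :
    ∀ᶠ q in 𝓝 q₀, locDeg (fun x => F x - q) Ω = locDeg (fun x => F x - q₀) Ω := by
  obtain ⟨r, hr, hball⟩ := Metric.mem_nhds_iff.1 hA
  filter_upwards [ball_mem_nhds q₀ hr] with q hq
  refine locDeg_eq_of_homotopy hΩ (hF.sub continuousOn_const) (hF.sub continuousOn_const) hc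
    inter_subset_left fun t ht x hx h0 => ⟨hx, hball ?_⟩
  have h1 : F x = q₀ + (1 - t) • (q - q₀) := by
    have : F x - q + t • (F x - q₀ - (F x - q)) = F x - (q₀ + (1 - t) • (q - q₀)) := by module
    rw [this] at h0
    exact sub_eq_zero.1 h0
  rw [h1, mem_ball, dist_eq_norm, add_sub_cancel_left, norm_smul,
    Real.norm_of_nonneg (sub_nonneg.2 ht.2), ← dist_eq_norm]
  have := mem_ball.1 hq
  nlinarith [ht.1, ht.2, dist_nonneg (x := q) (y := q₀)]

lemma ProperOver.eventually_eq {n : ℕ} {F : Euc n → Euc n} {Ω V : Set (Euc n)}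
    (h : ProperOver F Ω V) (hΩ : IsOpen Ω) (hF : ContinuousOn F Ω) (hV : IsOpen V) {q₀ : Euc n}
    (hq₀ : q₀ ∈ V) :
    ∀ᶠ q in 𝓝 q₀, locDeg (fun x => F x - q) Ω = locDeg (fun x => F x - q₀) Ω := by
  obtain ⟨r, hr, hball⟩ := Metric.nhds_basis_closedBall.mem_iff.1 (hV.mem_nhds hq₀)
  exact locDeg_sub_eventually_eq hΩ hF (closedBall_mem_nhds q₀ hr)
    (h _ hball (isCompact_closedBall _ _))

lemma ProperOver.locDeg_eq {n : ℕ} {F : Euc n → Euc n} {Ω V : Set (Euc n)}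
    (h : ProperOver F Ω V) (hΩ : IsOpen Ω) (hF : ContinuousOn F Ω) (hV : IsOpen V)
    (hVc : IsPreconnected V) {q q' : Euc n} (hq : q ∈ V) (hq' : q' ∈ V) :
    locDeg (fun x => F x - q) Ω = locDeg (fun x => F x - q') Ω :=
  hVc.eq_of_eventually_eq (d := fun q => locDeg (fun x => F x - q) Ω) (fun _ hx =>
    (h.eventually_eq hΩ hF hV hx).filter_mono nhdsWithin_le_nhds) hq hq'

lemma locDeg_linear {n : ℕ} {F : Euc n → Euc n} {Ω : Set (Euc n)} (hF : DegAdm F Ω)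
    (A : Euc n ≃L[ℝ] Euc n) :
    locDeg (fun x => A (F x)) Ω = SignType.sign (A : Euc n →L[ℝ] Euc n).det * locDeg F Ω := by
  obtain ⟨O, ε, F₀, φ₀, d⟩ := hF.exists_data
  set a := ‖(A : Euc n →L[ℝ] Euc n)‖ + 1 with ha
  set b := ‖(A.symm : Euc n →L[ℝ] Euc n)‖ + 1 with hb
  have ha0 : 0 < a := by positivity
  have hb0 : 0 < b := by positivity
  have hAle : ∀ v, ‖A v‖ ≤ a * ‖v‖ := fun v =>
    ((A : Euc n →L[ℝ] Euc n).le_opNorm v).trans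
      (mul_le_mul_of_nonneg_right (by linarith) (norm_nonneg v))
  have hAge : ∀ v, ‖v‖ ≤ b * ‖A v‖ := fun v => by
    have := ((A.symm : Euc n →L[ℝ] Euc n).le_opNorm (A v)).trans
      (mul_le_mul_of_nonneg_right (by linarith : _ ≤ b) (norm_nonneg (A v)))
    simpa using this
  have hεp := d.pos
  have hη : 0 < ε / b := by positivity
  have hδ : 0 < min ε (ε / b / a) := lt_min hεp (by positivity)
  obtain ⟨F', hF', happ⟩ := exists_smooth_approx isClosed_closure (hF.cont.mono d.closure_subset) hδ
  obtain ⟨φ, hφ⟩ := exists_isTest n hη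
  set ψ : Euc n → ℝ := fun y => |(A : Euc n →L[ℝ] Euc n).det| * φ (A y) with hψd
  have hψ : IsTest ψ ε := by
    refine ⟨contDiff_const.mul (hφ.smooth.comp A.contDiff), ?_, ?_⟩
    · intro y hy
      have h1 : A y ∈ tsupport φ := by
        have : tsupport ψ ⊆ A ⁻¹' tsupport φ := by
          refine closure_minimal (fun z hz => ?_) ((isClosed_tsupport φ).preimage A.continuous)
          exact subset_tsupport _ (right_ne_zero_of_mul hz)
        exact this hy
      have h2 := mem_ball_zero_iff.1 (hφ.supp h1)
      rw [mem_ball_zero_iff]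
      calc ‖y‖ ≤ b * ‖A y‖ := hAge y
        _ < b * (ε / b) := by gcongr
        _ = ε := by field_simp
    · have := integral_image_eq_integral_abs_det_fderiv_smul (volume : Measure (Euc n))
        (s := univ) MeasurableSet.univ (f := A) (f' := fun _ => (A : Euc n →L[ℝ] Euc n))
        (fun x _ => A.hasFDerivAt.hasFDerivWithinAt) A.injective.injOn φ
      rw [image_univ, A.surjective.range_eq, setIntegral_univ, setIntegral_univ, hφ.int] at this
      exact this.symm
  have d₁ : IsDegData F Ω O ε F' ψ := ⟨d.isOpen, d.bdd, d.closure_subset, d.zeros, d.pos,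
    d.frontier_le, hF', fun x hx => (happ x hx).trans (min_le_left _ _), hψ⟩
  have d₂ : IsDegData (fun x => A (F x)) Ω O (ε / b) (fun x => A (F' x)) φ := by
    refine ⟨d.isOpen, d.bdd, d.closure_subset, ?_, hη, ?_, A.contDiff.comp hF', ?_, hφ⟩
    · intro x hx h0
      exact d.zeros x hx (by simpa using h0)
    · intro x hx
      have h1 := (d.frontier_le x hx).trans (hAge (F x))
      calc 4 * (ε / b) = (4 * ε) / b := by ring
        _ ≤ (b * ‖A (F x)‖) / b := by gcongr
        _ = ‖A (F x)‖ := by field_simp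
    · intro x hx
      rw [← map_sub]
      calc ‖A (F' x - F x)‖ ≤ a * ‖F' x - F x‖ := hAle _
        _ ≤ a * (ε / b / a) := by gcongr; exact (happ x hx).trans (min_le_right _ _)
        _ = ε / b := by field_simp
  rw [d₁.locDeg_eq hF.cont, d₂.locDeg_eq (A.continuous.comp_continuousOn hF.cont), degIntegral,
    degIntegral, ← integral_const_mul]
  congr 1
  funext x
  have hd : fderiv ℝ (fun x => A (F' x)) x = (A : Euc n →L[ℝ] Euc n).comp (fderiv ℝ F' x) :=
    (A.hasFDerivAt.comp x (hF'.differentiable (by simp) x).hasFDerivAt).fderiv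
  have hc : ((A : Euc n →L[ℝ] Euc n).comp (fderiv ℝ F' x)).det =
      (A : Euc n →L[ℝ] Euc n).det * (fderiv ℝ F' x).det := LinearMap.det_comp _ _
  rw [hd, hc, hψd]
  have := sign_mul_abs (A : Euc n →L[ℝ] Euc n).det
  conv_lhs => rw [← this]
  ring

lemma eventually_segment_ne_zero {n : ℕ} {G : Euc n → Euc n} {y : Euc n}
    (A : Euc n ≃L[ℝ] Euc n) (hG : HasFDerivAt G (A : Euc n →L[ℝ] Euc n) y) (h0 : G y = 0) :
    ∀ᶠ z in 𝓝 y, ∀ s ∈ Icc (0 : ℝ) 1, G z + s • (A (z - y) - G z) = 0 → z = y := by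
  set b := ‖(A.symm : Euc n →L[ℝ] Euc n)‖ + 1 with hb
  have hb0 : 0 < b := by positivity
  have hAge : ∀ v, ‖v‖ ≤ b * ‖A v‖ := fun v => by
    have := ((A.symm : Euc n →L[ℝ] Euc n).le_opNorm (A v)).trans
      (mul_le_mul_of_nonneg_right (by linarith : _ ≤ b) (norm_nonneg (A v)))
    simpa using this
  filter_upwards [hG.isLittleO.bound (c := 1 / (2 * b)) (by positivity)] with z hz s hs hzero
  rw [h0, sub_zero, ContinuousLinearEquiv.coe_coe] at hz
  have h1 : A (z - y) = -((1 - s) • (G z - A (z - y))) := by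
    rw [← sub_eq_zero, ← hzero]; module
  have h2 : ‖A (z - y)‖ ≤ ‖G z - A (z - y)‖ := by
    rw [h1, norm_neg, norm_smul, Real.norm_of_nonneg (sub_nonneg.2 hs.2), ← h1]
    exact mul_le_of_le_one_left (norm_nonneg _) (by linarith [hs.1])
  have h3 : ‖z - y‖ ≤ b * (1 / (2 * b) * ‖z - y‖) :=
    (hAge _).trans (mul_le_mul_of_nonneg_left (h2.trans hz) hb0.le)
  have h4 : b * (1 / (2 * b) * ‖z - y‖) = ‖z - y‖ / 2 := by field_simp
  rw [h4] at h3
  have h5 : ‖z - y‖ ≤ 0 := by linarith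
  exact sub_eq_zero.1 (norm_le_zero_iff.1 h5)

lemma exists_regular_sub {n : ℕ} {G : Euc n → Euc n} (hG : ContDiff ℝ ∞ G) {ε : ℝ} (hε : 0 < ε) :
    ∃ c : Euc n, ‖c‖ < ε ∧ ∀ x, G x = c → (fderiv ℝ G x).det ≠ 0 := by
  set s : Set (Euc n) := {x | (fderiv ℝ G x).det = 0}
  have h0 : volume (G '' s) = 0 :=
    addHaar_image_eq_zero_of_det_fderivWithin_eq_zero volume
      (fun x _ => (hG.differentiable (by simp) x).hasFDerivAt.hasFDerivWithinAt) fun x hx => hx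
  have h1 : 0 < volume (ball (0 : Euc n) ε) := measure_ball_pos _ _ hε
  obtain ⟨c, hc, hcs⟩ : ∃ c ∈ ball (0 : Euc n) ε, c ∉ G '' s := by
    by_contra! h
    exact absurd (measure_mono_null (fun c hc => h c hc) h0) h1.ne'
  exact ⟨c, mem_ball_zero_iff.1 hc, fun x hx h => hcs ⟨x, h, hx⟩⟩

set_option maxHeartbeats 1000000 in
lemma exists_regular_representation {n : ℕ} {G : Euc n → Euc n} {V : Set (Euc n)}
    (hG : DegAdm G V) : ∃ (Z : Finset (Euc n)) (s : Euc n → ℤ), (∀ y ∈ Z, y ∈ V) ∧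
      ∀ (Ω : Set (Euc n)) (F : Euc n → Euc n), IsOpen Ω → ContinuousOn F Ω → MapsTo F Ω V →
        ProperOver F Ω V → locDeg (fun x => G (F x)) Ω =
          ∑ y ∈ Z, (s y : ℝ) * locDeg (fun x => F x - y) Ω := by
  classical
  obtain ⟨O, ε, G', φ, d⟩ := hG.exists_data
  have hε := d.pos
  obtain ⟨c, hc, hreg⟩ := exists_regular_sub d.smooth hε
  set G₂ : Euc n → Euc n := fun x => G' x - c with hG₂
  have hG₂c : Continuous G₂ := d.smooth.continuous.sub continuous_const
  have hclose : ∀ x ∈ closure O, ‖G₂ x - G x‖ ≤ 2 * ε := by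
    intro x hx
    have h1 := d.approx x hx
    have h2 : G₂ x - G x = (G' x - G x) - c := by simp only [hG₂]; abel
    rw [h2]
    refine (norm_sub_le _ _).trans (by linarith)
  set C : Set (Euc n) := closure O ∩ {x | ‖G x‖ ≤ 2 * ε} with hC
  have hCc : IsCompact C := by
    refine d.bdd.isCompact_closure.of_isClosed_subset ?_ inter_subset_left
    exact ((hG.cont.mono d.closure_subset).norm).preimage_isClosed_of_isClosed isClosed_closure
      isClosed_Iic
  have hCO : C ⊆ O := by
    intro x hx
    by_contra hxO
    have := d.frontier_le x (by rw [d.isOpen.frontier_eq]; exact ⟨hx.1, hxO⟩)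
    have := hx.2
    simp only [mem_setOf_eq] at this
    linarith
  have hOV : O ⊆ V := subset_closure.trans d.closure_subset
  set Zs : Set (Euc n) := closure O ∩ G₂ ⁻¹' {0} with hZs
  have hZc : IsCompact Zs := d.bdd.isCompact_closure.inter_right (isClosed_singleton.preimage hG₂c)
  have hZC : Zs ⊆ C := by
    intro x hx
    refine ⟨hx.1, ?_⟩
    have := hclose x hx.1
    have h0 : G₂ x = 0 := hx.2
    rw [h0, zero_sub, norm_neg] at this
    exact this
  have hA : ∀ y ∈ Zs, ∃ A : Euc n ≃L[ℝ] Euc n, HasFDerivAt G₂ (A : Euc n →L[ℝ] Euc n) y := by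
    intro y hy
    have h0 : G₂ y = 0 := hy.2
    have hdet := hreg y (sub_eq_zero.1 h0)
    refine ⟨(fderiv ℝ G' y).toContinuousLinearEquivOfDetNeZero hdet, ?_⟩
    rw [ContinuousLinearMap.coe_toContinuousLinearEquivOfDetNeZero]
    exact (d.smooth.differentiable (by simp) y).hasFDerivAt.sub_const c
  choose! A hA using hA
  have hev := fun y (hy : y ∈ Zs) => eventually_segment_ne_zero (A y) (hA y hy) hy.2
  have hfin : Zs.Finite := by
    obtain ⟨t, ht, hcov⟩ := hZc.elim_nhds_subcover
      (fun y => {z | ∀ s ∈ Icc (0 : ℝ) 1, G₂ z + s • (A y (z - y) - G₂ z) = 0 → z = y}) hev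
    refine t.finite_toSet.subset fun x hx => ?_
    obtain ⟨y, hy, hxy⟩ := mem_iUnion₂.1 (hcov hx)
    have h0 : G₂ x = 0 := hx.2
    have := hxy 0 (by simp) (by simp [h0])
    rw [this]
    exact hy
  obtain ⟨U, hU, hUd⟩ := hfin.t2_separation
  have hB : ∀ y ∈ Zs, ∃ B : Set (Euc n), IsOpen B ∧ y ∈ B ∧ B ⊆ U y ∧ B ⊆ O ∧
      ∀ z ∈ B, ∀ s ∈ Icc (0 : ℝ) 1, G₂ z + s • (A y (z - y) - G₂ z) = 0 → z = y := by
    intro y hy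
    have h1 : U y ∩ O ∈ 𝓝 y := inter_mem ((hU y).2.mem_nhds (hU y).1) (d.isOpen.mem_nhds (hCO (hZC hy)))
    obtain ⟨B, hB, hBo, hyB⟩ := _root_.mem_nhds_iff.1 (inter_mem h1 (hev y hy))
    exact ⟨B, hBo, hyB, fun z hz => (hB hz).1.1, fun z hz => (hB hz).1.2, fun z hz => (hB hz).2⟩
  choose! B hBo hyB hBU hBO hBz using hB
  refine ⟨hfin.toFinset, fun y => SignType.sign (A y : Euc n →L[ℝ] Euc n).det, fun y hy =>
    hOV (hCO (hZC (hfin.mem_toFinset.1 hy))), ?_⟩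
  intro Ω F hΩ hF hmaps hprop
  have hGF : DegAdm (fun x => G (F x)) Ω := by
    refine ⟨hΩ, hG.cont.comp hF hmaps, ?_⟩
    convert hprop _ (fun x hx => hx.1) hG.compact using 1
    ext x
    exact ⟨fun h => ⟨h.1, hmaps h.1, h.2⟩, fun h => ⟨h.1, h.2.2⟩⟩
  set Ω₁ := Ω ∩ F ⁻¹' O with hΩ₁
  have hpre : ∀ S : Set (Euc n), IsOpen S → IsOpen (Ω ∩ F ⁻¹' S) := fun S hS =>
    hF.isOpen_inter_preimage hΩ hS
  have e1 : locDeg (fun x => G (F x)) Ω = locDeg (fun x => G (F x)) Ω₁ :=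
    locDeg_excision hGF (hpre O d.isOpen) inter_subset_left
      fun x hx h0 => ⟨hx, d.zeros _ (hmaps hx) h0⟩
  have hFΩ₁ : ContinuousOn F Ω₁ := hF.mono inter_subset_left
  have hKK : IsCompact (Ω ∩ F ⁻¹' C) := hprop C (hCO.trans hOV) hCc
  have hKsub : Ω ∩ F ⁻¹' C ⊆ Ω₁ := fun x hx => ⟨hx.1, hCO hx.2⟩
  have hG₂F : ContinuousOn (fun x => G₂ (F x)) Ω₁ := hG₂c.comp_continuousOn hFΩ₁
  have e2 : locDeg (fun x => G (F x)) Ω₁ = locDeg (fun x => G₂ (F x)) Ω₁ := by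
    refine locDeg_eq_of_homotopy (hpre O d.isOpen)
      (hGF.cont.mono inter_subset_left) hG₂F hKK hKsub ?_
    intro t ht x hx h0
    have hxc : F x ∈ closure O := subset_closure hx.2
    refine ⟨hx.1, hxc, ?_⟩
    have h1 : G (F x) = -(t • (G₂ (F x) - G (F x))) := eq_neg_of_add_eq_zero_left h0
    have h2 : ‖G (F x)‖ ≤ ‖G₂ (F x) - G (F x)‖ := by
      rw [h1, norm_neg, norm_smul, Real.norm_of_nonneg ht.1, ← h1]
      exact mul_le_of_le_one_left (norm_nonneg _) ht.2
    exact h2.trans (hclose _ hxc)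
  have hadm : DegAdm (fun x => G₂ (F x)) Ω₁ := by
    refine ⟨hpre O d.isOpen, hG₂F, ?_⟩
    convert hprop Zs (hZC.trans (hCO.trans hOV)) hZc using 1
    ext x
    exact ⟨fun h => ⟨h.1.1, subset_closure h.1.2, h.2⟩,
      fun h => ⟨⟨h.1, hCO (hZC h.2)⟩, h.2.2⟩⟩
  have e3 : locDeg (fun x => G₂ (F x)) Ω₁ =
      ∑ y ∈ hfin.toFinset, locDeg (fun x => G₂ (F x)) (Ω ∩ F ⁻¹' B y) := by
    refine locDeg_eq_sum hadm _ _ (fun y hy => hpre _ (hBo y (hfin.mem_toFinset.1 hy)))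
      (fun y hy x hx => ⟨hx.1, hBO y (hfin.mem_toFinset.1 hy) hx.2⟩) ?_ ?_
    · intro y hy y' hy' hne
      have hy := hfin.mem_toFinset.1 hy
      have hy' := hfin.mem_toFinset.1 hy'
      have := (hUd hy hy' hne).mono (hBU y hy) (hBU y' hy')
      exact ((this.preimage F).mono inter_subset_right inter_subset_right)
    · intro x hx h0
      have : F x ∈ Zs := ⟨subset_closure hx.2, h0⟩
      exact ⟨F x, hfin.mem_toFinset.2 this, hx.1, hyB _ this⟩
  rw [e1, e2, e3]
  refine Finset.sum_congr rfl fun y hy => ?_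
  replace hy := hfin.mem_toFinset.1 hy
  have hyV := hOV (hCO (hZC hy))
  have hB' := hpre _ (hBo y hy)
  have hF' : ContinuousOn F (Ω ∩ F ⁻¹' B y) := hF.mono inter_subset_left
  have hadm1 := hprop.degAdm hΩ hF hyV
  have hz1 : ∀ x ∈ Ω, F x - y = 0 → x ∈ Ω ∩ F ⁻¹' B y := fun x hx h0 =>
    ⟨hx, by rw [mem_preimage, sub_eq_zero.1 h0]; exact hyB y hy⟩
  have hadm2 := hadm1.mono hB' inter_subset_left hz1
  have e4 : locDeg (fun x => G₂ (F x)) (Ω ∩ F ⁻¹' B y) =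
      locDeg (fun x => A y (F x - y)) (Ω ∩ F ⁻¹' B y) := by
    refine locDeg_eq_of_homotopy hB' (hG₂c.comp_continuousOn hF')
      ((A y).continuous.comp_continuousOn hadm2.cont) hadm2.compact (fun x hx => hx.1) ?_
    intro t ht x hx h0
    exact ⟨hx, sub_eq_zero.2 (hBz y hy _ hx.2 t ht h0)⟩
  rw [e4, locDeg_linear hadm2 (A y), ← locDeg_excision hadm1 hB' inter_subset_left hz1]
  norm_num

lemma properOver_id {n : ℕ} (V : Set (Euc n)) : ProperOver (fun x => x) V V := by
  intro A hA hAc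
  have : V ∩ (fun x : Euc n => x) ⁻¹' A = A := inter_eq_right.2 hA
  rwa [this]

lemma exists_int_locDeg_eq {n : ℕ} {G : Euc n → Euc n} {V : Set (Euc n)}
    (hG : DegAdm G V) : ∃ k : ℤ, locDeg G V = k := by
  obtain ⟨Z, s, hZ, h⟩ := exists_regular_representation hG
  have := h V (fun x => x) hG.isOpen continuousOn_id (fun x hx => hx) (properOver_id V)
  refine ⟨∑ y ∈ Z, s y, ?_⟩
  change locDeg G V = _ at this
  rw [this, Int.cast_sum]
  refine Finset.sum_congr rfl fun y hy => ?_
  rw [locDeg_id_sub hG.isOpen (hZ y hy), mul_one]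

/-- Multiplicativity of the degree. -/
lemma locDeg_comp {n : ℕ} {G F : Euc n → Euc n} {V Ω : Set (Euc n)}
    (hG : DegAdm G V) (hΩ : IsOpen Ω) (hF : ContinuousOn F Ω) (hmaps : MapsTo F Ω V)
    (hprop : ProperOver F Ω V) {d : ℝ} (hd : ∀ y ∈ V, locDeg (fun x => F x - y) Ω = d) :
    locDeg (fun x => G (F x)) Ω = d * locDeg G V := by
  obtain ⟨Z, s, hZ, h⟩ := exists_regular_representation hG
  have := h V (fun x => x) hG.isOpen continuousOn_id (fun x hx => hx) (properOver_id V)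
  change locDeg G V = _ at this
  rw [this, h Ω F hΩ hF hmaps hprop, Finset.mul_sum]
  refine Finset.sum_congr rfl fun y hy => ?_
  rw [locDeg_id_sub hG.isOpen (hZ y hy), hd y (hZ y hy)]
  ring

lemma isCompact_inter_preimage_of_frontier {n : ℕ} {Ω A : Set (Euc n)} {F : Euc n → Euc n}
    (hb : Bornology.IsBounded Ω) (hF : ContinuousOn F (closure Ω)) (hA : IsClosed A)
    (hfr : ∀ x ∈ closure Ω, x ∉ Ω → F x ∉ A) : IsCompact (Ω ∩ F ⁻¹' A) := by
  have : Ω ∩ F ⁻¹' A = closure Ω ∩ F ⁻¹' A := by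
    refine Subset.antisymm (inter_subset_inter_left _ subset_closure) fun x hx => ⟨?_, hx.2⟩
    by_contra h
    exact hfr x hx.1 h hx.2
  rw [this]
  exact hb.isCompact_closure.of_isClosed_subset
    (hF.preimage_isClosed_of_isClosed isClosed_closure hA) inter_subset_left

lemma properOver_of_frontier {n : ℕ} {Ω V : Set (Euc n)} {F : Euc n → Euc n}
    (hb : Bornology.IsBounded Ω) (hF : ContinuousOn F (closure Ω))
    (hfr : ∀ x ∈ closure Ω, x ∉ Ω → F x ∉ V) : ProperOver F Ω V := fun _ hAV hA =>
  isCompact_inter_preimage_of_frontier hb hF hA.isClosed fun x hx hxΩ h => hfr x hx hxΩ (hAV h)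

lemma degAdm_sub_of_frontier {n : ℕ} {Ω : Set (Euc n)} {F : Euc n → Euc n} (hΩ : IsOpen Ω)
    (hb : Bornology.IsBounded Ω) (hF : ContinuousOn F (closure Ω)) {q : Euc n}
    (hfr : ∀ x ∈ closure Ω, x ∉ Ω → F x ≠ q) : DegAdm (fun x => F x - q) Ω :=
  (properOver_of_frontier hb hF (V := {q}) hfr).degAdm hΩ (hF.mono subset_closure) rfl

lemma locDeg_sub_eventually_eq_of_frontier {n : ℕ} {Ω : Set (Euc n)} {F : Euc n → Euc n}
    (hΩ : IsOpen Ω) (hb : Bornology.IsBounded Ω) (hF : ContinuousOn F (closure Ω)) {q₀ : Euc n}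
    (hfr : ∀ x ∈ closure Ω, x ∉ Ω → F x ≠ q₀) :
    ∀ᶠ q in 𝓝 q₀, (∀ x ∈ closure Ω, x ∉ Ω → F x ≠ q) ∧
      locDeg (fun x => F x - q) Ω = locDeg (fun x => F x - q₀) Ω := by
  have hc : IsCompact (F '' (closure Ω \ Ω)) :=
    (hb.isCompact_closure.diff hΩ).image_of_continuousOn (hF.mono diff_subset)
  have hn : (F '' (closure Ω \ Ω))ᶜ ∈ 𝓝 q₀ := hc.isClosed.isOpen_compl.mem_nhds (by
    rintro ⟨x, hx, rfl⟩
    exact hfr x hx.1 hx.2 rfl)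
  obtain ⟨r, hr, hball⟩ := Metric.nhds_basis_closedBall.mem_iff.1 hn
  have h1 := locDeg_sub_eventually_eq hΩ (hF.mono subset_closure) (closedBall_mem_nhds q₀ hr)
    (isCompact_inter_preimage_of_frontier hb hF isClosed_closedBall
      fun x hx hxΩ h => hball h ⟨x, ⟨hx, hxΩ⟩, rfl⟩)
  filter_upwards [h1, hn] with q hq hqn
  exact ⟨fun x hx hxΩ h => hqn ⟨x, ⟨hx, hxΩ⟩, h⟩, hq⟩

/-- Maps of a bounded open set agreeing on the frontier have the same degree. -/
lemma locDeg_eq_of_eqOn_frontier {n : ℕ} {Ω : Set (Euc n)} {F G : Euc n → Euc n}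
    (hΩ : IsOpen Ω) (hb : Bornology.IsBounded Ω) (hF : ContinuousOn F (closure Ω))
    (hG : ContinuousOn G (closure Ω)) (h : ∀ x ∈ closure Ω, x ∉ Ω → F x = G x ∧ F x ≠ 0) :
    locDeg F Ω = locDeg G Ω := by
  have hc : IsCompact (closure Ω) := hb.isCompact_closure
  set S : Set (ℝ × Euc n) := (Icc (0 : ℝ) 1 ×ˢ closure Ω) ∩
    (fun p => F p.2 + p.1 • (G p.2 - F p.2)) ⁻¹' {0} with hS
  have hs : MapsTo Prod.snd (Icc (0 : ℝ) 1 ×ˢ closure Ω) (closure Ω) := fun p hp => hp.2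
  have hSc : IsCompact S := by
    refine (isCompact_Icc.prod hc).of_isClosed_subset ?_ inter_subset_left
    refine ContinuousOn.preimage_isClosed_of_isClosed ?_ (isClosed_Icc.prod isClosed_closure)
      isClosed_singleton
    exact (hF.comp continuousOn_snd hs).add (continuousOn_fst.smul
      ((hG.comp continuousOn_snd hs).sub (hF.comp continuousOn_snd hs)))
  refine locDeg_eq_of_homotopy hΩ (hF.mono subset_closure) (hG.mono subset_closure)
    (hSc.image continuous_snd) ?_ fun t ht x hx h0 => ⟨(t, x), ⟨⟨ht, subset_closure hx⟩, h0⟩, rfl⟩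
  rintro _ ⟨⟨t, x⟩, ⟨⟨-, hx⟩, h0⟩, rfl⟩
  by_contra hxΩ
  obtain ⟨h1, h2⟩ := h x hx hxΩ
  refine h2 ?_
  simpa [← h1] using h0

lemma exists_extension_avoiding {n : ℕ} {φ : Euc n → Euc n} (hφ : Continuous φ) {T Q : Set (Euc n)}
    (hT : IsClosed T) (hQ : IsCompact Q) (hQ0 : volume Q = 0) {x : Euc n}
    (hx : ∀ y ∈ T, y ∈ Q → φ y ≠ x) :
    ∃ Φ : Euc n → Euc n, Continuous Φ ∧ EqOn Φ φ T ∧ ∀ y ∈ Q, Φ y ≠ x := by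
  obtain ⟨m, hm, hmin⟩ := exists_pos_le_norm (K := T ∩ Q) (hQ.inter_left hT)
    (F := fun y => φ y - x) (hφ.sub continuous_const).continuousOn
    fun y hy => sub_ne_zero.2 (hx y hy.1 hy.2)
  obtain ⟨Φ₀, hΦ₀, happ, -⟩ := hφ.exists_contDiff_approx (⊤ : ℕ∞) (ε := fun _ => m / 4)
    continuous_const (fun _ => by linarith)
  have hnull : volume (Φ₀ '' Q) = 0 := addHaar_image_eq_zero_of_differentiableOn_of_addHaar_eq_zero
    volume (hΦ₀.differentiable (by simp)).differentiableOn hQ0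
  obtain ⟨c, hc, hcQ⟩ : ∃ c ∈ ball x (m / 4), c ∉ Φ₀ '' Q := by
    by_contra! h
    exact (measure_ball_pos volume x (by linarith : 0 < m / 4)).ne'
      (measure_mono_null (fun c hc => h c hc) hnull)
  set N : Set (Euc n) := {y | m / 2 < ‖φ y - x‖} with hN
  have hNo : IsOpen N := isOpen_lt continuous_const (hφ.sub continuous_const).norm
  obtain ⟨l, hl0, hl1, hl⟩ := exists_continuous_zero_one_of_isClosed hT (hQ.isClosed.sdiff hNo)
    (by
      rw [Set.disjoint_left]
      intro y hyT hy
      refine hy.2 ?_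
      have := hmin y ⟨hyT, hy.1⟩
      simp only [hN, mem_setOf_eq]
      linarith)
  refine ⟨fun y => φ y + l y • (Φ₀ y - c + x - φ y), ?_, fun y hy => ?_, fun y hy h => ?_⟩
  · have := hΦ₀.continuous
    have := l.continuous
    fun_prop
  · simp [hl0 hy]
  · replace h : φ y + l y • (Φ₀ y - c + x - φ y) = x := h
    by_cases hyN : y ∈ N
    · have h1 : ‖Φ₀ y - c + x - φ y‖ ≤ m / 2 := by
        have e : Φ₀ y - c + x - φ y = (Φ₀ y - φ y) - (c - x) := by abel
        rw [e]
        refine (norm_sub_le _ _).trans ?_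
        have h2 := happ y
        rw [dist_eq_norm] at h2
        have h3 := mem_ball_iff_norm.1 hc
        linarith
      have h2 : φ y - x = -(l y • (Φ₀ y - c + x - φ y)) := by
        rw [eq_neg_iff_add_eq_zero, ← sub_eq_zero.2 h]; abel
      have h3 : ‖φ y - x‖ ≤ m / 2 := by
        rw [h2, norm_neg, norm_smul, Real.norm_of_nonneg (hl y).1]
        exact (mul_le_of_le_one_left (norm_nonneg _) (hl y).2).trans h1
      exact absurd hyN (not_lt.2 h3)
    · rw [hl1 ⟨hy, hyN⟩, Pi.one_apply, one_smul] at h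
      refine hcQ ⟨y, hy, ?_⟩
      rw [← sub_eq_zero, ← sub_eq_zero.2 h]
      abel

open Classical in
lemma exists_locDeg_sub_eq_add_indicator {n : ℕ} {Ω : Set (Euc n)} (hΩ : IsOpen Ω)
    (hb : Bornology.IsBounded Ω) {Φ : Euc n → Euc n} (hΦ : Continuous Φ) {x : Euc n}
    {δ : ℝ} (hδ : 0 < δ) (hid : ∀ y ∈ closure Ω, y ∉ Ω → dist y x < δ → Φ y = y)
    (hne : ∀ y ∈ closure Ω, y ∉ Ω → y ≠ x → Φ y ≠ x) :
    ∃ r > 0, ∃ a : ℝ, ∀ z ∈ ball x r, (∀ y ∈ closure Ω, y ∉ Ω → y ≠ z) →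
      locDeg (fun y => Φ y - z) Ω = a + if z ∈ Ω then 1 else 0 := by
  obtain ⟨l, hl0, hl1, hl⟩ := exists_continuous_zero_one_of_isClosed
    (isOpen_ball (x := x) (ε := δ)).isClosed_compl
    (isClosed_closedBall (x := x) (ε := δ / 2)) (by
      rw [disjoint_compl_left_iff_subset]
      exact closedBall_subset_ball (by linarith))
  set Ψ : Euc n → Euc n := fun y => Φ y + l y • (y - Φ y) with hΨ
  have hΨc : Continuous Ψ := by
    have := l.continuous
    fun_prop
  have hΨid : ∀ y ∈ closedBall x (δ / 2), Ψ y = y := fun y hy => by simp [hΨ, hl1 hy]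
  have hΨfr : ∀ y ∈ closure Ω, y ∉ Ω → Ψ y = Φ y := by
    intro y hy hyΩ
    by_cases h : dist y x < δ
    · simp [hΨ, hid y hy hyΩ h]
    · simp [hΨ, hl0 (show y ∈ (ball x δ)ᶜ from h)]
  set Ω₁ := Ω ∩ ball x (δ / 2)
  set Ω₂ := Ω \ closedBall x (δ / 2)
  have hΩ₁ : IsOpen Ω₁ := hΩ.inter isOpen_ball
  have hΩ₂ : IsOpen Ω₂ := hΩ.sdiff isClosed_closedBall
  have hfr₂ : ∀ y ∈ closure Ω₂, y ∉ Ω₂ → Ψ y ≠ x := by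
    intro y hy hyn
    have hyc : y ∈ closure Ω := closure_mono diff_subset hy
    have hyb : y ∉ ball x (δ / 2) := fun h => by
      obtain ⟨z, hz, hz2⟩ := mem_closure_iff.1 hy _ isOpen_ball h
      exact hz2.2 (ball_subset_closedBall hz)
    have hyx : y ≠ x := fun h => hyb (h ▸ mem_ball_self (by linarith))
    by_cases h : y ∈ closedBall x (δ / 2)
    · rw [hΨid y h]; exact hyx
    · have hyΩ : y ∉ Ω := fun h' => hyn ⟨h', h⟩
      rw [hΨfr y hyc hyΩ]
      exact hne y hyc hyΩ hyx
  obtain ⟨r, hr, hball⟩ := Metric.mem_nhds_iff.1 (locDeg_sub_eventually_eq_of_frontier hΩ₂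
    (hb.subset diff_subset) hΨc.continuousOn hfr₂)
  refine ⟨min r (δ / 2), lt_min hr (by linarith), locDeg (fun y => Ψ y - x) Ω₂, fun z hz hzfr => ?_⟩
  have hzr := hball (ball_subset_ball (min_le_left _ _) hz)
  have hzδ : z ∈ ball x (δ / 2) := ball_subset_ball (min_le_right _ _) hz
  have hfrz : ∀ y ∈ closure Ω, y ∉ Ω → Ψ y ≠ z := by
    intro y hy hyΩ
    by_cases h : y ∈ closedBall x (δ / 2)
    · rw [hΨid y h]; exact hzfr y hy hyΩ
    · refine hzr.1 y ?_ (fun h' => hyΩ h'.1)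
      have := isClosed_closedBall.isOpen_compl.inter_closure ⟨h, hy⟩
      rwa [inter_comm] at this
  have e1 : locDeg (fun y => Φ y - z) Ω = locDeg (fun y => Ψ y - z) Ω := by
    refine (locDeg_eq_of_eqOn_frontier hΩ hb (by fun_prop) (by fun_prop) fun y hy hyΩ => ⟨?_, ?_⟩).symm
    · rw [hΨfr y hy hyΩ]
    · exact sub_ne_zero.2 (hfrz y hy hyΩ)
  have hadm : DegAdm (fun y => Ψ y - z) Ω :=
    degAdm_sub_of_frontier hΩ hb hΨc.continuousOn hfrz
  have hadm₂ : DegAdm (fun y => Ψ y - z) Ω₂ :=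
    degAdm_sub_of_frontier hΩ₂ (hb.subset diff_subset) hΨc.continuousOn hzr.1
  have hadm₁ : DegAdm (fun y => Ψ y - z) Ω₁ := by
    refine ⟨hΩ₁, by fun_prop, ?_⟩
    by_cases hzΩ : z ∈ Ω
    · convert isCompact_singleton (x := z) using 1
      ext y
      constructor
      · rintro ⟨hy, h0⟩
        rw [hΨid y (ball_subset_closedBall hy.2)] at h0
        exact sub_eq_zero.1 h0
      · rintro rfl
        exact ⟨⟨hzΩ, hzδ⟩, by rw [hΨid _ (ball_subset_closedBall hzδ), sub_self]⟩
    · convert isCompact_empty using 1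
      ext y
      simp only [mem_setOf_eq, mem_empty_iff_false, iff_false, not_and]
      intro hy h0
      rw [hΨid y (ball_subset_closedBall hy.2)] at h0
      rw [sub_eq_zero] at h0
      exact hzΩ (h0 ▸ hy.1)
  have e2 : locDeg (fun y => Ψ y - z) Ω = locDeg (fun y => Ψ y - z) (Ω₁ ∪ Ω₂) := by
    refine locDeg_excision hadm (hΩ₁.union hΩ₂)
      (union_subset inter_subset_left diff_subset) fun y hy h0 => ?_
    by_cases h : y ∈ closedBall x (δ / 2)
    · rw [hΨid y h, sub_eq_zero] at h0
      exact Or.inl ⟨hy, h0 ▸ hzδ⟩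
    · exact Or.inr ⟨hy, h⟩
  rw [e1, e2, locDeg_union hadm₁ hadm₂ (by
    rw [Set.disjoint_left]
    exact fun y hy hy' => hy'.2 (ball_subset_closedBall hy.2)), hzr.2, add_comm]
  congr 1
  have hcg : locDeg (fun y => Ψ y - z) Ω₁ = locDeg (fun y => y - z) Ω₁ :=
    locDeg_congr hadm₁ fun y hy => by
      show Ψ y - z = y - z
      rw [hΨid y (ball_subset_closedBall hy.2)]
  rw [hcg]
  split_ifs with h
  · exact locDeg_id_sub hΩ₁ ⟨h, hzδ⟩
  · exact locDeg_eq_zero (by fun_prop) fun y hy h0 => h (sub_eq_zero.1 h0 ▸ hy.1)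

lemma exists_left_inverse_avoiding {n : ℕ} {e : Euc n → Euc n} (he : Continuous e)
    (hinj : InjOn e (sphere 0 1)) {w : Euc n} (hw : w ∈ sphere (0 : Euc n) 1) {ρ : ℝ}
    (hρ : ρ ≠ 0) :
    ∃ G : Euc n → Euc n, Continuous G ∧ (∀ s ∈ sphere (0 : Euc n) 1, G (e s) = s) ∧
      (∀ y, ‖G y‖ ≤ 1) ∧ ∀ y ∈ sphere (e w) ρ, G y ≠ w := by
  have : TietzeExtension (Euc n) := TietzeExtension.of_tvs ℝ
  have hemb : IsClosedEmbedding ((sphere (0 : Euc n) 1).restrict e) :=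
    (he.comp continuous_subtype_val).isClosedEmbedding hinj.injective
  obtain ⟨g, hg⟩ := ContinuousMap.exists_extension hemb
    (⟨Subtype.val, continuous_subtype_val⟩ : C(sphere (0 : Euc n) 1, Euc n))
  have hgs : ∀ s ∈ sphere (0 : Euc n) 1, g (e s) = s := fun s hs =>
    congrArg (fun k : C(sphere (0 : Euc n) 1, Euc n) => k ⟨s, hs⟩) hg
  obtain ⟨Φ, hΦ, hΦg, hΦw⟩ := exists_extension_avoiding g.continuous (T := e '' sphere 0 1)
    ((isCompact_sphere 0 1).image he).isClosed (isCompact_sphere (e w) ρ)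
    (Measure.addHaar_sphere_of_ne_zero volume (e w) hρ) (x := w) (by
      rintro _ ⟨s, hs, rfl⟩ h h'
      rw [hgs s hs] at h'
      rw [h', mem_sphere, dist_self] at h
      exact hρ h.symm)
  have hn : ∀ y, ‖(max 1 (‖Φ y‖ ^ 2))⁻¹ • Φ y‖ = ‖Φ y‖ / max 1 (‖Φ y‖ ^ 2) := fun y => by
    rw [norm_smul, norm_inv, Real.norm_of_nonneg (by positivity), div_eq_inv_mul]
  have hpos : ∀ y, 0 < max 1 (‖Φ y‖ ^ 2) := fun y => by positivity
  refine ⟨fun y => (max 1 (‖Φ y‖ ^ 2))⁻¹ • Φ y, ?_, fun s hs => ?_, fun y => ?_, fun y hy h => ?_⟩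
  · exact ((continuous_const.max (hΦ.norm.pow 2)).inv₀ fun y => (hpos y).ne').smul hΦ
  · have h1 : Φ (e s) = s := (hΦg ⟨s, hs, rfl⟩).trans (hgs s hs)
    simp only [h1]
    rw [mem_sphere_zero_iff_norm.1 hs]
    simp
  · rw [hn, div_le_one (hpos y)]
    rcases le_total ‖Φ y‖ 1 with h | h
    · exact h.trans (le_max_left _ _)
    · exact le_trans (by nlinarith) (le_max_right _ _)
  · refine hΦw y hy ?_
    have h1 : ‖Φ y‖ / max 1 (‖Φ y‖ ^ 2) = 1 := by
      rw [← hn]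
      exact (congrArg norm h).trans (mem_sphere_zero_iff_norm.1 hw)
    rw [div_eq_one_iff_eq (hpos y).ne'] at h1
    have h2 : max 1 (‖Φ y‖ ^ 2) = 1 := by
      rcases le_total 1 (‖Φ y‖ ^ 2) with h3 | h3
      · rw [max_eq_right h3] at h1 ⊢
        nlinarith
      · exact max_eq_left h3
    simpa [h2] using h

/-- The winding number around `z` of the restriction of `e` to the unit sphere. -/
def sphDeg {n : ℕ} (e : Euc n → Euc n) (z : Euc n) : ℝ := locDeg (fun x => e x - z) (ball 0 1)

lemma mem_sphere_of_mem_closure_ball {n : ℕ} {x c : Euc n} {r : ℝ} (hx : x ∈ closure (ball c r))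
    (hx' : x ∉ ball c r) : x ∈ sphere c r :=
  le_antisymm (closure_ball_subset_closedBall hx) (not_lt.1 hx')

lemma degAdm_sub_ball {n : ℕ} {e : Euc n → Euc n} (he : Continuous e) {z : Euc n}
    (hz : z ∉ e '' sphere 0 1) : DegAdm (fun x => e x - z) (ball 0 1) :=
  degAdm_sub_of_frontier isOpen_ball isBounded_ball he.continuousOn fun x hx hx' h =>
    hz ⟨x, mem_sphere_of_mem_closure_ball hx hx', h⟩

lemma sphDeg_eventually_eq {n : ℕ} {e : Euc n → Euc n} (he : Continuous e) {z : Euc n}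
    (hz : z ∉ e '' sphere 0 1) : ∀ᶠ y in 𝓝 z, sphDeg e y = sphDeg e z :=
  (locDeg_sub_eventually_eq_of_frontier isOpen_ball isBounded_ball he.continuousOn
    fun x hx hx' h => hz ⟨x, mem_sphere_of_mem_closure_ball hx hx', h⟩).mono fun _ h => h.2

lemma sphDeg_eq_zero {n : ℕ} {e : Euc n → Euc n} (he : Continuous e) {z : Euc n}
    (hz : z ∉ e '' closedBall 0 1) : sphDeg e z = 0 :=
  locDeg_eq_zero (by fun_prop) fun x hx h =>
    hz ⟨x, ball_subset_closedBall hx, sub_eq_zero.1 h⟩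

open Classical in
lemma exists_mul_sphDeg_eq {n : ℕ} {e : Euc n → Euc n} (he : Continuous e)
    (hinj : InjOn e (sphere 0 1)) (hne : (sphere (0 : Euc n) 1).Nonempty) {U : Set (Euc n)}
    (hU : IsOpen U) (hb : Bornology.IsBounded U) (hcl : closure U ⊆ U ∪ e '' sphere 0 1) :
    ∃ d : ℝ, ∀ z ∉ e '' sphere 0 1, d * sphDeg e z = if z ∈ U then 1 else 0 := by
  obtain ⟨w, hw⟩ := hne
  obtain ⟨G, hG, hGe, hG1, -⟩ := exists_left_inverse_avoiding he hinj hw one_ne_zero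
  have hfr : ∀ x ∈ closure U, x ∉ U → G x ∈ sphere (0 : Euc n) 1 ∧ e (G x) = x := by
    intro x hx hxU
    obtain ⟨s, hs, rfl⟩ := (hcl hx).resolve_left hxU
    rw [hGe s hs]
    exact ⟨hs, rfl⟩
  set U' := U ∩ G ⁻¹' ball 0 1 with hU'
  have hU'o : IsOpen U' := hU.inter (isOpen_ball.preimage hG)
  have hprop : ProperOver G U' (ball 0 1) := by
    refine properOver_of_frontier (hb.subset inter_subset_left) hG.continuousOn fun x hx hxn hxB => ?_
    by_cases hxU : x ∈ U
    · exact hxn ⟨hxU, hxB⟩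
    · have := (hfr x (closure_mono inter_subset_left hx) hxU).1
      rw [mem_sphere] at this
      exact hxB.ne this
  refine ⟨locDeg (fun x => G x - 0) U', fun z hz => ?_⟩
  have hcomp := locDeg_comp (degAdm_sub_ball he hz) hU'o hG.continuousOn (fun x hx => hx.2) hprop
    (fun y hy => hprop.locDeg_eq hU'o hG.continuousOn isOpen_ball (convex_ball 0 1).isPreconnected hy
      (mem_ball_self one_pos))
  rw [sphDeg, ← hcomp]
  have hadm : DegAdm (fun x => e (G x) - z) U :=
    degAdm_sub_of_frontier hU hb (he.comp hG).continuousOn fun x hx hxU h => hz (by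
      obtain ⟨h1, h2⟩ := hfr x hx hxU
      exact ⟨G x, h1, h⟩)
  rw [← locDeg_excision hadm hU'o inter_subset_left fun x hx h => ⟨hx, by
    rw [mem_preimage, mem_ball_zero_iff]
    refine (hG1 x).lt_of_ne fun h1 => hz ⟨G x, mem_sphere_zero_iff_norm.2 h1, sub_eq_zero.1 h⟩⟩]
  rw [locDeg_eq_of_eqOn_frontier (G := fun x => x - z) hU hb (by fun_prop) (by fun_prop)
    fun x hx hxU => by
      obtain ⟨h1, h2⟩ := hfr x hx hxU
      rw [h2]
      exact ⟨rfl, fun h => hz ⟨G x, h1, h2.trans (sub_eq_zero.1 h)⟩⟩]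
  split_ifs with h
  · exact locDeg_id_sub hU h
  · exact locDeg_eq_zero (by fun_prop) fun y hy h0 => h (sub_eq_zero.1 h0 ▸ hy)

lemma sphDeg_ne_zero_iff {n : ℕ} {e : Euc n → Euc n} (he : Continuous e)
    (hinj : InjOn e (sphere 0 1)) (hne : (sphere (0 : Euc n) 1).Nonempty) {U : Set (Euc n)}
    (hU : IsOpen U) (hb : Bornology.IsBounded U) (hcl : closure U ⊆ U ∪ e '' sphere 0 1)
    (hd : Disjoint U (e '' sphere 0 1)) (hUne : U.Nonempty) :
    ∃ d : ℝ, d ≠ 0 ∧ ∀ z ∉ e '' sphere 0 1, (z ∈ U → sphDeg e z = d) ∧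
      (z ∉ U → sphDeg e z = 0) := by
  obtain ⟨d, h⟩ := exists_mul_sphDeg_eq he hinj hne hU hb hcl
  obtain ⟨z₀, hz₀⟩ := hUne
  have h0 := h z₀ (Set.disjoint_left.1 hd hz₀)
  rw [if_pos hz₀] at h0
  have hd0 : d ≠ 0 := left_ne_zero_of_mul_eq_one h0
  refine ⟨d⁻¹, inv_ne_zero hd0, fun z hz => ⟨fun hzU => ?_, fun hzU => ?_⟩⟩
  · have := h z hz
    rw [if_pos hzU] at this
    exact eq_inv_of_mul_eq_one_right this
  · have := h z hz
    rw [if_neg hzU] at this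
    exact (mul_eq_zero.1 this).resolve_left hd0

lemma eventually_norm_sub_notMem_of_isCompact {n : ℕ} {G : Euc n → Euc n} (hG : Continuous G)
    {Q : Set (Euc n)} (hQ : IsCompact Q) {w : Euc n} (h : ∀ y ∈ Q, G y ≠ w) :
    ∀ᶠ z in 𝓝 w, ∀ y ∈ Q, G y ≠ z := by
  filter_upwards [(hQ.image hG).isClosed.isOpen_compl.mem_nhds (x := w)
    (fun ⟨y, hy, hyw⟩ => h y hy hyw)] with z hz y hy hyz
  exact hz ⟨y, hy, hyz⟩

set_option maxHeartbeats 1000000 in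
/-- Near every point of an embedded sphere the winding number is not constant. -/
lemma exists_sphDeg_ne {n : ℕ} {e : Euc n → Euc n} (he : Continuous e)
    (hinj : InjOn e (sphere 0 1)) {w : Euc n} (hw : w ∈ sphere (0 : Euc n) 1) {ρ : ℝ}
    (hρ : 0 < ρ) (c₀ : ℝ) :
    ∃ z ∈ ball (e w) ρ, z ∉ e '' sphere 0 1 ∧ sphDeg e z ≠ c₀ := by
  classical
  by_contra! hconst
  have hK : IsClosed (e '' sphere (0 : Euc n) 1) := ((isCompact_sphere 0 1).image he).isClosed
  obtain ⟨G, hG, hGe, hG1, hGw⟩ := exists_left_inverse_avoiding he hinj hw hρ.ne'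
  set V₀ := ball (e w) ρ with hV₀
  set V := V₀ \ e '' sphere 0 1 with hV
  have hVo : IsOpen V := isOpen_ball.sdiff hK
  set Ω := ball 0 1 ∩ e ⁻¹' V₀ with hΩ
  have hΩo : IsOpen Ω := isOpen_ball.inter (isOpen_ball.preimage he)
  have hΩb : Bornology.IsBounded Ω := isBounded_ball.subset inter_subset_left
  have hfrΩ : ∀ y ∈ closure Ω, y ∉ Ω → y ∈ sphere (0 : Euc n) 1 ∨ e y ∈ sphere (e w) ρ := by
    intro y hy hyΩ
    by_cases hyB : y ∈ ball (0 : Euc n) 1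
    · right
      have h1 : y ∉ e ⁻¹' V₀ := fun h => hyΩ ⟨hyB, h⟩
      refine mem_sphere_of_mem_closure_ball ?_ h1
      exact he.closure_preimage_subset _ (closure_mono inter_subset_right hy)
    · exact Or.inl (mem_sphere_of_mem_closure_ball (closure_mono inter_subset_left hy) hyB)
  have hwV₀ : e ⁻¹' V₀ ∈ 𝓝 w := he.continuousAt.preimage_mem_nhds (ball_mem_nhds _ hρ)
  obtain ⟨δ, hδ, hδball⟩ := Metric.mem_nhds_iff.1 hwV₀
  obtain ⟨r, hr, a, ha⟩ := exists_locDeg_sub_eq_add_indicator hΩo hΩb (hG.comp he) (x := w) hδ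
    (fun y hy hyΩ hyw => by
      rcases hfrΩ y hy hyΩ with h | h
      · exact hGe y h
      · have hyV : e y ∈ V₀ := hδball hyw
        exact absurd (mem_sphere.1 h) (mem_ball.1 hyV).ne)
    (fun y hy hyΩ hyw => by
      rcases hfrΩ y hy hyΩ with h | h
      · rwa [Function.comp_apply, hGe y h]
      · exact hGw _ h)
  set Ω' := Ω ∩ e ⁻¹' (e '' sphere 0 1)ᶜ with hΩ'
  have hΩ'o : IsOpen Ω' := hΩo.inter (hK.isOpen_compl.preimage he)
  have hprop : ProperOver e Ω' V := by
    refine properOver_of_frontier (hΩb.subset inter_subset_left) he.continuousOn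
      fun x hx hxn hxV => ?_
    by_cases hxB : x ∈ ball (0 : Euc n) 1
    · exact hxn ⟨⟨hxB, hxV.1⟩, hxV.2⟩
    · exact hxV.2 ⟨x, mem_sphere_of_mem_closure_ball (closure_mono
        (inter_subset_left.trans inter_subset_left) hx) hxB, rfl⟩
  have hdeg : ∀ y ∈ V, locDeg (fun x => e x - y) Ω' = c₀ := by
    intro y hy
    rw [← hconst y hy.1 hy.2, sphDeg]
    refine (locDeg_excision (degAdm_sub_ball he hy.2) hΩ'o
      (inter_subset_left.trans inter_subset_left) fun x hx h => ?_).symm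
    rw [sub_eq_zero] at h
    exact ⟨⟨hx, by rw [mem_preimage, h]; exact hy.1⟩, by rw [mem_preimage, h]; exact hy.2⟩
  have hV₀fr : ∀ y ∈ closure V₀, y ∉ V₀ → G y ≠ w := fun y hy hyn =>
    hGw y (mem_sphere_of_mem_closure_ball hy hyn)
  have key : ∀ᶠ z in 𝓝 w, z ∉ sphere (0 : Euc n) 1 →
      (a + if z ∈ ball (0 : Euc n) 1 then 1 else 0) = c₀ * locDeg (fun x => G x - w) V₀ := by
    filter_upwards [ball_mem_nhds w hr, ball_mem_nhds w hδ,
      locDeg_sub_eventually_eq_of_frontier isOpen_ball isBounded_ball hG.continuousOn hV₀fr]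
      with z hzr hzδ hzV₀ hzS
    have hzV₀' : e z ∈ V₀ := hδball hzδ
    have h1 := ha z hzr (fun y hy hyΩ hyz => by
      subst hyz
      rcases hfrΩ y hy hyΩ with h | h
      · exact hzS h
      · exact absurd (mem_sphere.1 h) (mem_ball.1 hzV₀').ne)
    have h2 : z ∈ Ω ↔ z ∈ ball (0 : Euc n) 1 := ⟨fun h => h.1, fun h => ⟨h, hzV₀'⟩⟩
    simp only [h2] at h1
    rw [← h1, ← hzV₀.2]
    have hadmV₀ : DegAdm (fun x => G x - z) V₀ :=
      degAdm_sub_of_frontier isOpen_ball isBounded_ball hG.continuousOn hzV₀.1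
    have hzV : ∀ x ∈ V₀, G x - z = 0 → x ∈ V := by
      intro x hx h
      refine ⟨hx, ?_⟩
      rintro ⟨s, hs, rfl⟩
      rw [hGe s hs, sub_eq_zero] at h
      exact hzS (h ▸ hs)
    rw [locDeg_excision hadmV₀ hVo diff_subset hzV,
      ← locDeg_comp (hadmV₀.mono hVo diff_subset hzV) hΩ'o he.continuousOn
        (fun x hx => ⟨hx.1.2, hx.2⟩) hprop hdeg]
    have hadmΩ : DegAdm (fun x => G (e x) - z) Ω := by
      refine degAdm_sub_of_frontier hΩo hΩb (hG.comp he).continuousOn fun y hy hyΩ h => ?_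
      rcases hfrΩ y hy hyΩ with h' | h'
      · rw [Function.comp_apply, hGe y h'] at h
        exact hzS (h ▸ h')
      · have hc : e y ∈ closure V₀ := by
          rw [closure_ball _ hρ.ne']
          exact sphere_subset_closedBall h'
        exact hzV₀.1 (e y) hc (fun h'' => h''.ne (mem_sphere.1 h')) h
    exact locDeg_excision hadmΩ hΩ'o inter_subset_left fun x hx h =>
      ⟨hx, (hzV (e x) hx.2 h).2⟩
  have hwn : ‖w‖ = 1 := mem_sphere_zero_iff_norm.1 hw
  have hcont : Tendsto (fun t : ℝ => (1 + t) • w) (𝓝 0) (𝓝 w) := by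
    have : Continuous fun t : ℝ => (1 + t) • w := by fun_prop
    simpa using this.tendsto 0
  obtain ⟨t, ht, htball⟩ := Metric.mem_nhds_iff.1 (hcont.eventually key)
  set s := min (t / 2) (1 / 2) with hs
  have hs0 : 0 < s := by positivity
  have hst : s < t := (min_le_left _ _).trans_lt (by linarith)
  have hs1 : s ≤ 1 / 2 := min_le_right _ _
  have hnorm : ∀ u : ℝ, -1 < u → ‖(1 + u) • w‖ = 1 + u := fun u hu => by
    rw [norm_smul, hwn, mul_one, Real.norm_of_nonneg (by linarith)]
  have e1 := htball (show s ∈ ball (0 : ℝ) t by simpa [abs_of_pos hs0] using hst)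
  have e2 := htball (show -s ∈ ball (0 : ℝ) t by simpa [abs_of_pos hs0] using hst)
  simp only [mem_setOf_eq, mem_sphere_zero_iff_norm, mem_ball_zero_iff, hnorm s (by linarith),
    hnorm (-s) (by linarith)] at e1 e2
  rw [if_neg (by linarith)] at e1
  rw [if_pos (by linarith)] at e2
  have := (e1 (by linarith)).trans (e2 (by linarith)).symm
  linarith

lemma exists_mul_locDeg_eq_add_indicator {n : ℕ} {e G E : Euc n → Euc n}
    (hG : Continuous G) (hGe : ∀ s ∈ sphere (0 : Euc n) 1, G (e s) = s) (hG1 : ∀ y, ‖G y‖ ≤ 1)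
    {w : Euc n} (hw : w ∈ sphere (0 : Euc n) 1) {ρ s : ℝ} (hs : 0 < s)
    (hGs : ∀ y ∈ sphere (e w) ρ, s < ‖G y - w‖)
    (hE : Continuous E) (hEe : EqOn E e (sphere 0 1)) (hEw : ∀ y ∈ sphere w s, E y ≠ e w)
    {P : Set (Euc n)} (hP : IsOpen P) (hPb : P ⊆ ball (e w) ρ)
    (hcl : closure P ∩ ball (e w) ρ ⊆ P ∪ e '' sphere 0 1) :
    ∃ α a : ℝ, ∀ᶠ z in 𝓝 (e w), z ∉ e '' sphere 0 1 → (z ∈ P → 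
        α * locDeg (fun y => E y - z) (ball 0 1 ∩ ball w s) = a + 1) ∧ (z ∉ P → 
        α * locDeg (fun y => E y - z) (ball 0 1 ∩ ball w s) = a) := by
  classical
  set D := ball (0 : Euc n) 1 ∩ ball w s with hD
  have hDo : IsOpen D := isOpen_ball.inter isOpen_ball
  have hDc : IsPreconnected D := ((convex_ball _ _).inter (convex_ball _ _)).isPreconnected
  have hDne : D.Nonempty := by
    have : w ∈ closure (ball (0 : Euc n) 1) := by
      rw [closure_ball _ one_ne_zero]
      exact sphere_subset_closedBall hw
    obtain ⟨v, hv, hv'⟩ := mem_closure_iff.1 this _ isOpen_ball (mem_ball_self hs)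
    exact ⟨v, hv', hv⟩
  obtain ⟨v, hv⟩ := hDne
  have hPbdd : Bornology.IsBounded P := isBounded_ball.subset hPb
  set Ω := P ∩ G ⁻¹' ball w s with hΩ
  set Ω' := P ∩ G ⁻¹' D with hΩ'
  have hΩo : IsOpen Ω := hP.inter (isOpen_ball.preimage hG)
  have hΩ'o : IsOpen Ω' := hP.inter (hDo.preimage hG)
  have hΩb : Bornology.IsBounded Ω := hPbdd.subset inter_subset_left
  have hclP : ∀ y ∈ closure P, y ∉ P → G y ∈ closedBall w s → G y ∈ sphere (0 : Euc n) 1 ∧ 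
      e (G y) = y := by
    intro y hy hyP hGy
    by_cases hyb : y ∈ ball (e w) ρ
    · obtain ⟨t, ht, rfl⟩ := (hcl ⟨hy, hyb⟩).resolve_left hyP
      rw [hGe t ht]
      exact ⟨ht, rfl⟩
    · have := hGs y (mem_sphere_of_mem_closure_ball (closure_mono hPb hy) hyb)
      rw [mem_closedBall, dist_eq_norm] at hGy
      linarith
  have hGx : G (e w) = w := hGe w hw
  have hnhds : G ⁻¹' ball w s ∈ 𝓝 (e w) :=
    hG.continuousAt.preimage_mem_nhds (by rw [hGx]; exact ball_mem_nhds _ hs)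
  have hprop : ProperOver G Ω' D := by
    refine properOver_of_frontier (hPbdd.subset inter_subset_left) hG.continuousOn
      fun y hy hyn hyD => ?_
    by_cases hyP : y ∈ P
    · exact hyn ⟨hyP, hyD⟩
    · have := (hclP y (closure_mono inter_subset_left hy) hyP (ball_subset_closedBall hyD.2)).1
      exact (mem_ball.1 hyD.1).ne (mem_sphere.1 this)
  have hfr : ∀ y ∈ closure Ω, y ∉ Ω →
      (G y ∈ sphere (0 : Euc n) 1 ∧ e (G y) = y) ∨ G y ∈ sphere w s := by
    intro y hy hyΩ
    have h1 : G y ∈ closure (ball w s) :=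
      hG.closure_preimage_subset _ (closure_mono inter_subset_right hy)
    by_cases hyP : y ∈ P
    · have h2 : G y ∉ ball w s := fun h => hyΩ ⟨hyP, h⟩
      exact Or.inr (mem_sphere_of_mem_closure_ball h1 h2)
    · exact Or.inl (hclP y (closure_mono inter_subset_left hy) hyP
        (closure_ball_subset_closedBall h1))
  obtain ⟨δ, hδ, hδball⟩ := Metric.mem_nhds_iff.1 hnhds
  obtain ⟨r, hr, a, ha⟩ := exists_locDeg_sub_eq_add_indicator hΩo hΩb (hE.comp hG) (x := e w) hδ
    (fun y hy hyΩ hyw => by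
      rcases hfr y hy hyΩ with ⟨h, h'⟩ | h
      · rw [Function.comp_apply, hEe h, h']
      · have hyV : G y ∈ ball w s := hδball hyw
        exact absurd (mem_sphere.1 h) (mem_ball.1 hyV).ne)
    (fun y hy hyΩ hyw => by
      rcases hfr y hy hyΩ with ⟨h, h'⟩ | h
      · rwa [Function.comp_apply, hEe h, h']
      · exact hEw _ h)
  refine ⟨locDeg (fun y => G y - v) Ω', a, ?_⟩
  filter_upwards [ball_mem_nhds (e w) hr, hnhds,
    eventually_norm_sub_notMem_of_isCompact hE (isCompact_sphere w s) hEw] with z hzr hzn hzE hzK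
  have hzG : G z ∈ ball w s := hzn
  have h1 := ha z hzr (fun y hy hyΩ hyz => by
    subst hyz
    rcases hfr y hy hyΩ with ⟨h, h'⟩ | h
    · exact hzK ⟨_, h, h'⟩
    · exact absurd (mem_sphere.1 h) (mem_ball.1 hzG).ne)
  have h2 : z ∈ Ω ↔ z ∈ P := ⟨fun h => h.1, fun h => ⟨h, hzG⟩⟩
  simp only [h2] at h1
  have hadmD : DegAdm (fun y => E y - z) D := by
    refine degAdm_sub_of_frontier hDo (isBounded_ball.subset inter_subset_left) hE.continuousOn
      fun y hy hyD h => ?_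
    by_cases hyB : y ∈ ball (0 : Euc n) 1
    · have h3 : y ∉ ball w s := fun h => hyD ⟨hyB, h⟩
      exact hzE y (mem_sphere_of_mem_closure_ball (closure_mono inter_subset_right hy) h3) h
    · have h3 := mem_sphere_of_mem_closure_ball (closure_mono inter_subset_left hy) hyB
      exact hzK ⟨y, h3, (hEe h3).symm.trans h⟩
  have hadmΩ : DegAdm (fun y => (E ∘ G) y - z) Ω := by
    refine degAdm_sub_of_frontier hΩo hΩb (hE.comp hG).continuousOn fun y hy hyΩ h => ?_
    rcases hfr y hy hyΩ with ⟨h3, h4⟩ | h3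
    · exact hzK ⟨G y, h3, (hEe h3).symm.trans h⟩
    · exact hzE _ h3 h
  have h3 := locDeg_excision hadmΩ hΩ'o (inter_subset_inter_right _
    (preimage_mono inter_subset_right)) fun y hy h => ⟨hy.1, by
      refine ⟨?_, hy.2⟩
      rw [mem_ball_zero_iff]
      refine (hG1 y).lt_of_ne fun h4 => hzK ?_
      have h5 := mem_sphere_zero_iff_norm.2 h4
      exact ⟨G y, h5, (hEe h5).symm.trans (sub_eq_zero.1 h)⟩⟩
  have h4 := locDeg_comp hadmD hΩ'o hG.continuousOn (fun y hy => hy.2) hprop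
    (fun y hy => hprop.locDeg_eq hΩ'o hG.continuousOn hDo hDc hy hv)
  have h5 : locDeg (fun y => G y - v) Ω' * locDeg (fun y => E y - z) D =
      a + if z ∈ P then 1 else 0 := by
    rw [← h1, h3, ← h4]
    rfl
  rw [h5]
  exact ⟨fun h => by rw [if_pos h], fun h => by rw [if_neg h, add_zero]⟩

/-- An embedded sphere has at most two local sides at each of its points. -/
lemma not_three_local_sides {n : ℕ} {e : Euc n → Euc n} (he : Continuous e)
    (hinj : InjOn e (sphere 0 1)) {w : Euc n} (hw : w ∈ sphere (0 : Euc n) 1) {ρ : ℝ}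
    (hρ : 0 < ρ) {P : Fin 3 → Set (Euc n)} (hP : ∀ i, IsOpen (P i))
    (hPb : ∀ i, P i ⊆ ball (e w) ρ) (hPK : ∀ i, Disjoint (P i) (e '' sphere 0 1))
    (hcl : ∀ i, closure (P i) ∩ ball (e w) ρ ⊆ P i ∪ e '' sphere 0 1)
    (hd : ∀ i j, i ≠ j → Disjoint (P i) (P j)) (hx : ∀ i, e w ∈ closure (P i)) : False := by
  obtain ⟨G, hG, hGe, hG1, hGw⟩ := exists_left_inverse_avoiding he hinj hw hρ.ne'
  obtain ⟨m, hm, hGm⟩ := exists_pos_le_norm (isCompact_sphere (e w) ρ) (F := fun y => G y - w)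
    (by fun_prop) fun y hy => sub_ne_zero.2 (hGw y hy)
  obtain ⟨E, hE, hEe, hEw⟩ := exists_extension_avoiding he (T := sphere 0 1) isClosed_sphere
    (isCompact_sphere w (m / 2)) (Measure.addHaar_sphere_of_ne_zero volume w (by positivity))
    (x := e w) (fun y hy hyQ h => by
      rw [hinj hy hw h, mem_sphere, dist_self] at hyQ
      linarith)
  choose α a ha using fun i => exists_mul_locDeg_eq_add_indicator hG hGe hG1 hw
    (by positivity : 0 < m / 2) (fun y hy => by linarith [hGm y hy]) hE hEe hEw (hP i) (hPb i)
    (hcl i)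
  have hall := eventually_all.2 ha
  choose z hz using fun j => mem_closure_iff_nhds.1 (hx j) _ hall
  set c := fun j => locDeg (fun y => E y - z j) (ball 0 1 ∩ ball w (m / 2)) with hc
  have hnK : ∀ j, z j ∉ e '' sphere 0 1 := fun j => Set.disjoint_left.1 (hPK j) (hz j).2
  have hpos : ∀ i, α i * c i = a i + 1 := fun i => ((hz i).1 i (hnK i)).1 (hz i).2
  have hneg : ∀ i j, i ≠ j → α i * c j = a i := fun i j hij =>
    ((hz j).1 i (hnK j)).2 fun h => Set.disjoint_left.1 (hd i j hij) h (hz j).2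
  have h01 := hneg 0 1 (by decide)
  have h02 := hneg 0 2 (by decide)
  have h12 := hneg 1 2 (by decide)
  have h00 := hpos 0
  have h11 := hpos 1
  have hα : α 0 ≠ 0 := by
    intro h
    rw [h, zero_mul] at h01 h00
    linarith
  have : c 1 = c 2 := mul_left_cancel₀ hα (h01.trans h02.symm)
  rw [this] at h11
  linarith

/-- `U` is a bounded open set whose frontier is contained in the closed set `K`. -/
structure IsSide {n : ℕ} (U K : Set (Euc n)) : Prop where
  isOpen : IsOpen U
  isBounded : Bornology.IsBounded U
  closure_subset : closure U ⊆ U ∪ K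
  disjoint : Disjoint U K
  nonempty : U.Nonempty

lemma exists_isSide {n : ℕ} {e : Euc n → Euc n} (he : Continuous e)
    (hinj : InjOn e (sphere 0 1)) (hne : (sphere (0 : Euc n) 1).Nonempty) :
    ∃ P, IsSide P (e '' sphere 0 1) := by
  have hK : IsClosed (e '' sphere (0 : Euc n) 1) := ((isCompact_sphere 0 1).image he).isClosed
  refine ⟨{z | z ∉ e '' sphere 0 1 ∧ sphDeg e z ≠ 0}, ?_, ?_, ?_, ?_, ?_⟩
  · rw [isOpen_iff_mem_nhds]
    intro z hz
    filter_upwards [hK.isOpen_compl.mem_nhds hz.1, sphDeg_eventually_eq he hz.1] with y hy h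
    exact ⟨hy, h ▸ hz.2⟩
  · refine ((isCompact_closedBall (0 : Euc n) 1).image he).isBounded.subset fun z hz => ?_
    by_contra h
    exact hz.2 (sphDeg_eq_zero he h)
  · intro z hz
    by_cases hzK : z ∈ e '' sphere 0 1
    · exact Or.inr hzK
    · obtain ⟨y, hy, hy'⟩ := mem_closure_iff_nhds.1 hz _ (sphDeg_eventually_eq he hzK)
      exact Or.inl ⟨hzK, (show sphDeg e y = sphDeg e z from hy) ▸ hy'.2⟩
  · rw [Set.disjoint_left]
    exact fun z hz => hz.1
  · obtain ⟨w, hw⟩ := hne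
    obtain ⟨z, -, hz, hz'⟩ := exists_sphDeg_ne he hinj hw one_pos 0
    exact ⟨z, hz, hz'⟩

lemma IsSide.subset_closure {n : ℕ} {e : Euc n → Euc n} (he : Continuous e)
    (hinj : InjOn e (sphere 0 1)) {U : Set (Euc n)} (h : IsSide U (e '' sphere 0 1)) :
    e '' sphere 0 1 ⊆ closure U ∩ closure (U ∪ e '' sphere 0 1)ᶜ := by
  rintro _ ⟨w, hw, rfl⟩
  obtain ⟨d, -, hd⟩ := sphDeg_ne_zero_iff he hinj ⟨w, hw⟩ h.isOpen h.isBounded h.closure_subset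
    h.disjoint h.nonempty
  constructor
  · rw [Metric.mem_closure_iff]
    intro ρ hρ
    obtain ⟨z, hz, hzK, hz0⟩ := exists_sphDeg_ne he hinj hw hρ 0
    refine ⟨z, ?_, by rwa [dist_comm]⟩
    by_contra hzU
    exact hz0 ((hd z hzK).2 hzU)
  · rw [Metric.mem_closure_iff]
    intro ρ hρ
    obtain ⟨z, hz, hzK, hz0⟩ := exists_sphDeg_ne he hinj hw hρ d
    refine ⟨z, ?_, by rwa [dist_comm]⟩
    rintro (hzU | h')
    · exact hz0 ((hd z hzK).1 hzU)
    · exact hzK h'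

lemma isOpen_diff_connectedComponentIn {X : Type*} [TopologicalSpace X] [LocallyConnectedSpace X]
    {M : Set X} (hM : IsOpen M) (y : X) : IsOpen (M \ connectedComponentIn M y) := by
  rw [isOpen_iff_mem_nhds]
  intro x hx
  refine mem_of_superset (hM.connectedComponentIn.mem_nhds (mem_connectedComponentIn hx.1))
    fun z hz => ⟨connectedComponentIn_subset M x hz, fun hz' => hx.2 ?_⟩
  rw [connectedComponentIn_eq hz', ← connectedComponentIn_eq hz]
  exact mem_connectedComponentIn hx.1

/-- A preconnected set meeting an open set `M` and leaving it does so through the closure of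
the component of `M` it starts in. -/
lemma exists_mem_closure_connectedComponentIn {X : Type*} [TopologicalSpace X]
    [LocallyConnectedSpace X] {M Z : Set X} (hM : IsOpen M) (hZ : IsPreconnected Z) {x y : X}
    (hy : y ∈ Z) (hyM : y ∈ M) (hx : x ∈ Z) (hxM : x ∉ M) :
    ∃ z ∈ Z, z ∉ M ∧ z ∈ closure (connectedComponentIn M y) := by
  by_contra! h
  have hsub := connectedComponentIn_subset M y
  have hdis : ∀ z ∈ M, z ∉ connectedComponentIn M y → z ∉ closure (connectedComponentIn M y) := by
    intro z hz hzn hzc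
    obtain ⟨t, ht, ht'⟩ := mem_closure_iff.1 hzc _ (isOpen_diff_connectedComponentIn hM y) ⟨hz, hzn⟩
    exact ht.2 ht'
  obtain ⟨z, -, hz, hz'⟩ := hZ _ _ hM.connectedComponentIn
    (isClosed_closure (s := connectedComponentIn M y)).isOpen_compl
    (fun z hz => by
      by_cases hzM : z ∈ M
      · by_cases hzn : z ∈ connectedComponentIn M y
        · exact Or.inl hzn
        · exact Or.inr (hdis z hzM hzn)
      · exact Or.inr (h z hz hzM))
    ⟨y, hy, mem_connectedComponentIn hyM⟩ ⟨x, hx, h x hx hxM⟩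
  exact hz' (_root_.subset_closure hz)

lemma properOver_of_isSide {n : ℕ} {U V K L : Set (Euc n)} {f : Euc n → Euc n} (hU : IsSide U K)
    (hV : IsSide V L) (hf : Continuous f) (hKL : f '' K = L) : ProperOver f U V :=
  properOver_of_frontier hU.isBounded hf.continuousOn fun x hx hxU hxV =>
    Set.disjoint_left.1 hV.disjoint hxV
      (hKL ▸ ⟨x, (hU.closure_subset hx).resolve_left hxU, rfl⟩)

/-- A map of sides restricting to a homeomorphism of the boundaries has degree `±1`. -/
lemma isUnit_locDeg_of_isSide {n : ℕ} {U V K L : Set (Euc n)} {f g : Euc n → Euc n}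
    (hU : IsSide U K) (hV : IsSide V L) (hVc : IsPreconnected V) (hf : Continuous f)
    (hg : Continuous g) (hUV : MapsTo f U V) (hKL : f '' K = L) (hgf : ∀ x ∈ K, g (f x) = x)
    {v : Euc n} (hv : v ∈ V) : ∃ d k : ℤ, locDeg (fun x => f x - v) U = d ∧ d * k = 1 := by
  obtain ⟨z, hz⟩ := hU.nonempty
  have hprop := properOver_of_isSide hU hV hf hKL
  have hzK : z ∉ K := Set.disjoint_left.1 hU.disjoint hz
  have hadm : DegAdm (fun y => g y - z) V := by
    refine degAdm_sub_of_frontier hV.isOpen hV.isBounded hg.continuousOn fun y hy hyV h => ?_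
    obtain ⟨x, hx, rfl⟩ := hKL.symm ▸ (hV.closure_subset hy).resolve_left hyV
    rw [hgf x hx] at h
    exact hzK (h ▸ hx)
  obtain ⟨d, hd⟩ := exists_int_locDeg_eq (hprop.degAdm hU.isOpen hf.continuousOn hv)
  obtain ⟨k, hk⟩ := exists_int_locDeg_eq hadm
  refine ⟨d, k, hd, ?_⟩
  have hcomp := locDeg_comp hadm hU.isOpen hf.continuousOn hUV hprop
    (fun y hy => (hprop.locDeg_eq hU.isOpen hf.continuousOn hV.isOpen hVc hy hv).trans hd)
  rw [hk, locDeg_eq_of_eqOn_frontier (G := fun x => x - z) hU.isOpen hU.isBounded (by fun_prop)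
    (by fun_prop) (fun x hx hxU => by
      have hxK := (hU.closure_subset hx).resolve_left hxU
      rw [hgf x hxK]
      exact ⟨rfl, fun h => hzK (sub_eq_zero.1 h ▸ hxK)⟩), locDeg_id_sub hU.isOpen hz] at hcomp
  exact_mod_cast hcomp.symm

/-- Degree `±1` localizes to the component of `f⁻¹(O)` adjacent to a connected boundary patch. -/
lemma isUnit_locDeg_connectedComponentIn {n : ℕ} {e : Euc n → Euc n} (he : Continuous e)
    (hinj : InjOn e (sphere 0 1)) {U V K L : Set (Euc n)} (hKe : K = e '' sphere 0 1)
    {f g : Euc n → Euc n} (hU : IsSide U K) (hV : IsSide V L) (hVc : IsPreconnected V)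
    (hf : Continuous f) (hg : Continuous g) (hUV : MapsTo f U V) (hKL : f '' K = L)
    (hgf : ∀ x ∈ K, g (f x) = x) {O Z : Set (Euc n)} (hO : IsOpen O)
    (hW : IsPreconnected (O ∩ (V ∪ L))) (hKW : IsPreconnected (K ∩ f ⁻¹' O))
    (hZ : IsPreconnected Z) (hZs : Z ⊆ (U ∪ K) ∩ f ⁻¹' O) {x₀ y₀ : Euc n} (hx₀ : x₀ ∈ Z)
    (hx₀K : x₀ ∈ K) (hy₀ : y₀ ∈ Z) (hy₀U : y₀ ∈ U) :
    ProperOver f (connectedComponentIn (U ∩ f ⁻¹' O) y₀) (V ∩ O) ∧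
    ∃ d k : ℤ, locDeg (fun x => f x - f y₀) (connectedComponentIn (U ∩ f ⁻¹' O) y₀) = d ∧
      d * k = 1 := by
  set M := U ∩ f ⁻¹' O with hM
  set M₀ := connectedComponentIn M y₀ with hM₀
  have hfO : IsOpen (f ⁻¹' O) := hO.preimage hf
  have hMo : IsOpen M := hU.isOpen.inter hfO
  have hM₀o : IsOpen M₀ := hMo.connectedComponentIn
  have hM₀s : M₀ ⊆ M := connectedComponentIn_subset M y₀
  set M₁ := M \ M₀ with hM₁
  have hM₁o : IsOpen M₁ := isOpen_diff_connectedComponentIn hMo y₀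
  have hdis : Disjoint M₀ M₁ := disjoint_sdiff_right
  have hprop := properOver_of_isSide hU hV hf hKL
  have hpM : ∀ A ⊆ V ∩ O, IsCompact A → IsCompact (M ∩ f ⁻¹' A) := by
    intro A hA hAc
    convert hprop A (hA.trans inter_subset_left) hAc using 1
    ext x
    exact ⟨fun h => ⟨h.1.1, h.2⟩, fun h => ⟨⟨h.1, (hA h.2).2⟩, h.2⟩⟩
  have hpM₀ : ProperOver f M₀ (V ∩ O) := by
    intro A hA hAc
    convert (hpM A hA hAc).diff hM₁o using 1
    ext x
    exact ⟨fun h => ⟨⟨hM₀s h.1, h.2⟩, fun h' => h'.2 h.1⟩,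
      fun h => ⟨by by_contra h'; exact h.2 ⟨h.1.1, h'⟩, h.1.2⟩⟩
  have hpM₁ : ProperOver f M₁ (V ∩ O) := by
    intro A hA hAc
    convert (hpM A hA hAc).diff hM₀o using 1
    ext x
    exact ⟨fun h => ⟨⟨h.1.1, h.2⟩, h.1.2⟩, fun h => ⟨⟨h.1.1, h.2⟩, h.1.2⟩⟩
  refine ⟨hpM₀, ?_⟩
  have hfZ : ∀ z ∈ Z, f z ∈ O := fun z hz => (hZs hz).2
  have hVO : IsOpen (V ∩ O) := hV.isOpen.inter hO
  have hq : f y₀ ∈ V ∩ O := ⟨hUV hy₀U, hfZ y₀ hy₀⟩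
  have hy₀M : y₀ ∈ M := ⟨hy₀U, hfZ y₀ hy₀⟩
  have hKU : ∀ x ∈ K, x ∉ U := fun x hx hxU => Set.disjoint_left.1 hU.disjoint hxU hx
  have hKc : IsClosed K := hKe ▸ ((isCompact_sphere 0 1).image he).isClosed
  have hUK : IsClosed (U ∪ K) := by
    refine isClosed_of_closure_subset ?_
    rw [closure_union, hKc.closure_eq]
    exact union_subset hU.closure_subset subset_union_right
  obtain ⟨x₁, hx₁Z, hx₁M, hx₁⟩ := exists_mem_closure_connectedComponentIn hMo hZ hy₀ hy₀M hx₀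
    (fun h => hKU x₀ hx₀K h.1)
  have hx₁K : x₁ ∈ K := (hZs hx₁Z).1.resolve_left fun h => hx₁M ⟨h, (hZs hx₁Z).2⟩
  have hcov : K ∩ f ⁻¹' O ⊆ closure M₀ ∪ closure M₁ := by
    intro x hx
    rw [← closure_union, hM₁, union_diff_cancel hM₀s, hM, inter_comm]
    have h1 : x ∈ closure U := ((IsSide.subset_closure he hinj (hKe ▸ hU)) (hKe ▸ hx.1)).1
    exact hfO.inter_closure ⟨hx.2, h1⟩
  have hdisj : ∀ x ∈ K ∩ f ⁻¹' O, x ∈ closure M₀ → x ∉ closure M₁ := by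
    intro x hx h0 h1
    have h2 : x ∈ closure (U ∪ K)ᶜ := by
      have := (IsSide.subset_closure he hinj (hKe ▸ hU)) (hKe ▸ hx.1)
      rw [← hKe] at this
      exact this.2
    obtain ⟨ρ, hρ, hball⟩ := Metric.mem_nhds_iff.1 (hfO.mem_nhds hx.2)
    obtain ⟨w, hw, rfl⟩ : x ∈ e '' sphere 0 1 := hKe ▸ hx.1
    have hlocal : ∀ A B : Set (Euc n), A ∪ B = M → Disjoint A B → IsOpen B →
        closure (A ∩ ball (e w) ρ) ∩ ball (e w) ρ ⊆ A ∩ ball (e w) ρ ∪ e '' sphere 0 1 := by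
      rintro A B hAB hd hB y ⟨hy, hyb⟩
      have hyA : y ∈ closure A := closure_mono inter_subset_left hy
      have hAU : A ⊆ U := (hAB ▸ subset_union_left : A ⊆ M).trans inter_subset_left
      rcases hU.closure_subset (closure_mono hAU hyA) with h | h
      · have hyM : y ∈ A ∪ B := hAB ▸ ⟨h, hball hyb⟩
        rcases hyM with h' | h'
        · exact Or.inl ⟨h', hyb⟩
        · obtain ⟨t, ht, ht'⟩ := mem_closure_iff.1 hyA B hB h'
          exact absurd ht (Set.disjoint_left.1 hd ht')
      · exact Or.inr (hKe ▸ h)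
    refine not_three_local_sides he hinj hw hρ
      (P := ![M₀ ∩ ball (e w) ρ, M₁ ∩ ball (e w) ρ, (U ∪ K)ᶜ ∩ ball (e w) ρ])
      ?_ ?_ ?_ ?_ ?_ ?_
    · intro i
      fin_cases i
      exacts [hM₀o.inter isOpen_ball, hM₁o.inter isOpen_ball, hUK.isOpen_compl.inter isOpen_ball]
    · intro i
      fin_cases i <;> exact inter_subset_right
    · rw [← hKe]
      intro i
      have hMK : Disjoint M K := hU.disjoint.mono_left inter_subset_left
      fin_cases i
      exacts [hMK.mono_left (inter_subset_left.trans hM₀s),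
        hMK.mono_left (inter_subset_left.trans diff_subset),
        (disjoint_compl_left.mono_right subset_union_right).mono_left inter_subset_left]
    · intro i
      fin_cases i
      · exact hlocal M₀ M₁ (union_diff_cancel hM₀s) hdis hM₁o
      · exact hlocal M₁ M₀ (diff_union_of_subset hM₀s) hdis.symm hM₀o
      · rintro y ⟨hy, hyb⟩
        by_cases hyK : y ∈ K
        · exact Or.inr (hKe ▸ hyK)
        · refine Or.inl ⟨?_, hyb⟩
          rintro (h | h)
          · obtain ⟨t, ht, ht'⟩ := mem_closure_iff.1 hy U hU.isOpen h
            exact ht'.1 (Or.inl ht)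
          · exact hyK h
    · have h01 : Disjoint (M₀ ∩ ball (e w) ρ) (M₁ ∩ ball (e w) ρ) :=
        hdis.mono inter_subset_left inter_subset_left
      have hMU : Disjoint M (U ∪ K)ᶜ :=
        disjoint_compl_right.mono_left (inter_subset_left.trans subset_union_left)
      have h02 : Disjoint (M₀ ∩ ball (e w) ρ) ((U ∪ K)ᶜ ∩ ball (e w) ρ) :=
        hMU.mono (inter_subset_left.trans hM₀s) inter_subset_left
      have h12 : Disjoint (M₁ ∩ ball (e w) ρ) ((U ∪ K)ᶜ ∩ ball (e w) ρ) :=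
        hMU.mono (inter_subset_left.trans diff_subset) inter_subset_left
      intro i j hij
      fin_cases i <;> fin_cases j
      exacts [absurd rfl hij, h01, h02, h01.symm, absurd rfl hij, h12, h02.symm, h12.symm,
        absurd rfl hij]
    · have hcl : ∀ A, e w ∈ closure A → e w ∈ closure (A ∩ ball (e w) ρ) := fun A hA => by
        rw [inter_comm]
        exact isOpen_ball.inter_closure ⟨mem_ball_self hρ, hA⟩
      intro i
      fin_cases i
      exacts [hcl _ h0, hcl _ h1, hcl _ h2]
  have hT₂ : ∀ x ∈ K ∩ f ⁻¹' O, x ∉ closure M₁ := by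
    intro x hx hx'
    obtain ⟨t, ht, ht0, ht1⟩ := isPreconnected_closed_iff.1 hKW _ _ isClosed_closure
      isClosed_closure hcov ⟨x₁, ⟨hx₁K, (hZs hx₁Z).2⟩, hx₁⟩ ⟨x, hx, hx'⟩
    exact hdisj t ht ht0 ht1
  have hzero : locDeg (fun x => f x - f y₀) M₁ = 0 := by
    obtain ⟨w, hw, hwN, hwc⟩ := exists_mem_closure_connectedComponentIn hVO hW
      (y := f y₀) (x := f x₀) ⟨hq.2, Or.inl hq.1⟩ hq
      ⟨hfZ x₀ hx₀, Or.inr (hKL ▸ ⟨x₀, hx₀K, rfl⟩)⟩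
      (fun h => Set.disjoint_left.1 hV.disjoint h.1 (hKL ▸ ⟨x₀, hx₀K, rfl⟩))
    have hwV : w ∉ V := fun h => hwN ⟨h, hw.1⟩
    have hM₁c : IsCompact (closure M₁) :=
      (hU.isBounded.subset (diff_subset.trans inter_subset_left)).isCompact_closure
    have hwn : w ∉ f '' closure M₁ := by
      rintro ⟨y, hy, rfl⟩
      have hyU : y ∈ closure U := closure_mono (diff_subset.trans inter_subset_left) hy
      rcases hU.closure_subset hyU with h | h
      · exact hwV (hUV h)
      · exact hT₂ y ⟨h, hw.1⟩ hy
    obtain ⟨q, hq1, hq2⟩ := mem_closure_iff.1 hwc _ (hM₁c.image hf).isClosed.isOpen_compl hwn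
    have hsub := connectedComponentIn_subset (V ∩ O) (f y₀)
    have hpN : ProperOver f M₁ (connectedComponentIn (V ∩ O) (f y₀)) :=
      fun A hA hAc => hpM₁ A (hA.trans hsub) hAc
    rw [hpN.locDeg_eq hM₁o hf.continuousOn hVO.connectedComponentIn
      isPreconnected_connectedComponentIn (mem_connectedComponentIn hq) hq2]
    exact locDeg_eq_zero (by fun_prop) fun y hy h =>
      hq1 ⟨y, _root_.subset_closure hy, sub_eq_zero.1 h⟩
  obtain ⟨d, k, hd, hdk⟩ := isUnit_locDeg_of_isSide hU hV hVc hf hg hUV hKL hgf hq.1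
  refine ⟨d, k, ?_, hdk⟩
  rw [← hd, locDeg_excision (hprop.degAdm hU.isOpen hf.continuousOn hq.1) hMo inter_subset_left
    fun x hx h => ⟨hx, by rw [mem_preimage, sub_eq_zero.1 h]; exact hq.2⟩]
  have h := locDeg_union (hpM₀.degAdm hM₀o hf.continuousOn hq)
    (hpM₁.degAdm hM₁o hf.continuousOn hq) hdis
  rw [hzero, add_zero, hM₁, union_diff_cancel hM₀s] at h
  exact h.symm

/-- A homotopy class of paths in `N` which is represented by a path lying in `B`. -/
def IsSmall {n : ℕ} {N : Set (Euc n)} (B : Set (Euc n)) {a b : N}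
    (κ : Path.Homotopic.Quotient a b) : Prop :=
  ∃ s : Path a b, Path.Homotopic.Quotient.mk s = κ ∧ ∀ t, (s t : Euc n) ∈ B

namespace IsSmall

variable {n : ℕ} {N B : Set (Euc n)} {a b c : N}

lemma refl (ha : (a : Euc n) ∈ B) : IsSmall B (Path.Homotopic.Quotient.refl a) :=
  ⟨Path.refl a, rfl, fun _ => ha⟩

lemma trans {κ : Path.Homotopic.Quotient a b} {τ : Path.Homotopic.Quotient b c}
    (hκ : IsSmall B κ) (hτ : IsSmall B τ) : IsSmall B (κ.trans τ) := by
  obtain ⟨s, rfl, hs⟩ := hκ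
  obtain ⟨t, rfl, ht⟩ := hτ
  refine ⟨s.trans t, Path.Homotopic.Quotient.mk_trans s t, fun u => ?_⟩
  have hu : (s.trans t) u ∈ range s ∪ range t := by
    rw [← Path.trans_range]; exact mem_range_self u
  rcases hu with ⟨v, hv⟩ | ⟨v, hv⟩
  · rw [← hv]; exact hs v
  · rw [← hv]; exact ht v

lemma mono {κ : Path.Homotopic.Quotient a b} {B' : Set (Euc n)} (h : IsSmall B κ) (hB : B ⊆ B') :
    IsSmall B' κ := by
  obtain ⟨s, hs, hs'⟩ := h
  exact ⟨s, hs, fun t => hB (hs' t)⟩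

lemma left_mem {κ : Path.Homotopic.Quotient a b} (h : IsSmall B κ) : (a : Euc n) ∈ B := by
  obtain ⟨s, -, hs⟩ := h
  simpa using hs 0

lemma right_mem {κ : Path.Homotopic.Quotient a b} (h : IsSmall B κ) : (b : Euc n) ∈ B := by
  obtain ⟨s, -, hs⟩ := h
  simpa using hs 1

lemma map {M A : Set (Euc n)} (F : C(M, N)) (hF : ∀ x : M, (x : Euc n) ∈ A → (F x : Euc n) ∈ B)
    {a b : M} {κ : Path.Homotopic.Quotient a b} (h : IsSmall A κ) : IsSmall B (κ.map F) := by
  obtain ⟨s, rfl, hs⟩ := h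
  exact ⟨s.map F.continuous, Path.Homotopic.Quotient.mk_map s F, fun t => hF _ (hs t)⟩

lemma eq (hB : Convex ℝ B) (hBN : B ⊆ N) {κ τ : Path.Homotopic.Quotient a b}
    (hκ : IsSmall B κ) (hτ : IsSmall B τ) : κ = τ := by
  have ha := hκ.left_mem
  have hb := hκ.right_mem
  have : ContractibleSpace B := hB.contractibleSpace ⟨_, ha⟩
  obtain ⟨s, rfl, hs⟩ := hκ
  obtain ⟨t, rfl, ht⟩ := hτ
  let i : C(B, N) := ⟨inclusion hBN, continuous_inclusion hBN⟩
  let s' : Path (⟨a, ha⟩ : B) ⟨b, hb⟩ :=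
    { toFun := fun u => ⟨s u, hs u⟩
      continuous_toFun := by fun_prop
      source' := by simp
      target' := by simp }
  let t' : Path (⟨a, ha⟩ : B) ⟨b, hb⟩ :=
    { toFun := fun u => ⟨t u, ht u⟩
      continuous_toFun := by fun_prop
      source' := by simp
      target' := by simp }
  have := (SimplyConnectedSpace.paths_homotopic s' t').map i
  exact Path.Homotopic.Quotient.eq.2 this

lemma exists_of_mem (hB : Convex ℝ B) (hBN : B ⊆ N) (ha : (a : Euc n) ∈ B)
    (hb : (b : Euc n) ∈ B) : ∃ κ : Path.Homotopic.Quotient a b, IsSmall B κ := by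
  have : ContractibleSpace B := hB.contractibleSpace ⟨_, ha⟩
  let i : C(B, N) := ⟨inclusion hBN, continuous_inclusion hBN⟩
  let s : Path (⟨a, ha⟩ : B) ⟨b, hb⟩ := PathConnectedSpace.somePath _ _
  let s' : Path a b := s.map i.continuous
  exact ⟨Path.Homotopic.Quotient.mk s', s', rfl, fun t => (s t).2⟩

end IsSmall

lemma quotient_map_trans {X Y : Type*} [TopologicalSpace X] [TopologicalSpace Y] (F : C(X, Y))
    {a b c : X} (κ : Path.Homotopic.Quotient a b) (τ : Path.Homotopic.Quotient b c) :
    (κ.trans τ).map F = (κ.map F).trans (τ.map F) := by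
  induction κ using Path.Homotopic.Quotient.ind with | mk s =>
  induction τ using Path.Homotopic.Quotient.ind with | mk t =>
  rw [← Path.Homotopic.Quotient.mk_trans, ← Path.Homotopic.Quotient.mk_map,
    ← Path.Homotopic.Quotient.mk_map, ← Path.Homotopic.Quotient.mk_map,
    ← Path.Homotopic.Quotient.mk_trans, Path.map_trans]

lemma quotient_map_symm {X Y : Type*} [TopologicalSpace X] [TopologicalSpace Y] (F : C(X, Y))
    {a b : X} (κ : Path.Homotopic.Quotient a b) : κ.symm.map F = (κ.map F).symm := by
  induction κ using Path.Homotopic.Quotient.ind with | mk s =>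
  rw [← Path.Homotopic.Quotient.mk_symm, ← Path.Homotopic.Quotient.mk_map,
    ← Path.Homotopic.Quotient.mk_map, ← Path.Homotopic.Quotient.mk_symm, Path.map_symm]

/-- The points `x` such that the class `p`, followed by a path inside `B` ending at `F x`,
lifts along `F` to a class of paths from `y₀` to `x`. -/
def liftSet {n : ℕ} {M N : Set (Euc n)} (F : C(M, N)) {y₀ : M} {q : N}
    (p : Path.Homotopic.Quotient (F y₀) q) (B : Set (Euc n)) : Set (Euc n) :=
  {x | ∃ hx : x ∈ M, ∃ α : Path.Homotopic.Quotient y₀ ⟨x, hx⟩,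
    ∃ κ : Path.Homotopic.Quotient q (F ⟨x, hx⟩), IsSmall B κ ∧ α.map F = p.trans κ}

section LiftSet

variable {n : ℕ} {M N : Set (Euc n)} {F : C(M, N)} {y₀ : M} {q q' : N}
  {p : Path.Homotopic.Quotient (F y₀) q} {B B' : Set (Euc n)} {f : Euc n → Euc n}

lemma mem_liftSet_of_convex {A : Set (Euc n)} (hA : Convex ℝ A) (hAM : A ⊆ M)
    (hF : ∀ x : M, (x : Euc n) ∈ A → (F x : Euc n) ∈ B) {x x' : Euc n} (hx : x ∈ A) (hx' : x' ∈ A)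
    (h : x ∈ liftSet F p B) : x' ∈ liftSet F p B := by
  obtain ⟨hxM, α, κ, hκ, hα⟩ := h
  obtain ⟨τ, hτ⟩ := IsSmall.exists_of_mem (a := ⟨x, hxM⟩) (b := ⟨x', hAM hx'⟩) hA hAM hx hx'
  refine ⟨hAM hx', α.trans τ, κ.trans (τ.map F), hκ.trans (hτ.map F hF), ?_⟩
  rw [quotient_map_trans, hα, Path.Homotopic.Quotient.trans_assoc]

lemma liftSet_subset (hfF : ∀ x : M, (F x : Euc n) = f x) : liftSet F p B ⊆ M ∩ f ⁻¹' B := by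
  rintro x ⟨hx, α, κ, hκ, -⟩
  refine ⟨hx, ?_⟩
  have := hκ.right_mem
  rwa [hfF] at this

lemma isOpen_liftSet (hM : IsOpen M) (hB : IsOpen B) (hf : Continuous f)
    (hfF : ∀ x : M, (F x : Euc n) = f x) : IsOpen (liftSet F p B) := by
  rw [Metric.isOpen_iff]
  intro x hx
  obtain ⟨ε, hε, hb⟩ := Metric.isOpen_iff.1 (hM.inter (hB.preimage hf)) x (liftSet_subset hfF hx)
  refine ⟨ε, hε, fun y hy => ?_⟩
  refine mem_liftSet_of_convex (convex_ball x ε) (fun z hz => (hb hz).1) (fun z hz => ?_)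
    (mem_ball_self hε) hy hx
  rw [hfF]; exact (hb hz).2

lemma isOpen_diff_liftSet (hM : IsOpen M) (hB : IsOpen B) (hf : Continuous f)
    (hfF : ∀ x : M, (F x : Euc n) = f x) : IsOpen ((M ∩ f ⁻¹' B) \ liftSet F p B) := by
  rw [Metric.isOpen_iff]
  intro x hx
  obtain ⟨ε, hε, hb⟩ := Metric.isOpen_iff.1 (hM.inter (hB.preimage hf)) x hx.1
  refine ⟨ε, hε, fun y hy => ⟨hb hy, fun h => hx.2 ?_⟩⟩
  refine mem_liftSet_of_convex (convex_ball x ε) (fun z hz => (hb hz).1) (fun z hz => ?_)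
    hy (mem_ball_self hε) h
  rw [hfF]; exact (hb hz).2

lemma properOver_liftSet (hM : IsOpen M) (hB : IsOpen B) (hBN : B ⊆ N) (hf : Continuous f)
    (hfF : ∀ x : M, (F x : Euc n) = f x) (hP : ProperOver f M N) :
    ProperOver f (liftSet F p B) B := by
  intro A hA hAc
  have : liftSet F p B ∩ f ⁻¹' A = (M ∩ f ⁻¹' A) \ ((M ∩ f ⁻¹' B) \ liftSet F p B) := by
    ext x
    constructor
    · rintro ⟨hx, hxA⟩
      exact ⟨⟨(liftSet_subset hfF hx).1, hxA⟩, fun h => h.2 hx⟩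
    · rintro ⟨⟨hx, hxA⟩, h⟩
      refine ⟨?_, hxA⟩
      by_contra hc
      exact h ⟨⟨hx, hA hxA⟩, hc⟩
  rw [this]
  exact (hP A (hA.trans hBN) hAc).diff (isOpen_diff_liftSet hM hB hf hfF)

lemma liftSet_trans (hBc : Convex ℝ B) (hBN : B ⊆ N) (hBc' : Convex ℝ B') (hBB : B' ⊆ B)
    (hq' : (q' : Euc n) ∈ B') (hfF : ∀ x : M, (F x : Euc n) = f x)
    {κ : Path.Homotopic.Quotient q q'} (hκ : IsSmall B κ) :
    liftSet F (p.trans κ) B' = liftSet F p B ∩ f ⁻¹' B' := by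
  ext x
  constructor
  · intro h
    refine ⟨?_, (liftSet_subset hfF h).2⟩
    obtain ⟨hx, α, τ, hτ, hα⟩ := h
    exact ⟨hx, α, κ.trans τ, hκ.trans (hτ.mono hBB),
      by rw [hα, Path.Homotopic.Quotient.trans_assoc]⟩
  · rintro ⟨⟨hx, α, ρ, hρ, hα⟩, hxB⟩
    have hxB' : (F ⟨x, hx⟩ : Euc n) ∈ B' := by rw [hfF]; exact hxB
    obtain ⟨τ, hτ⟩ := IsSmall.exists_of_mem hBc' (hBB.trans hBN) hq' hxB'
    refine ⟨hx, α, τ, hτ, ?_⟩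
    rw [hα, IsSmall.eq hBc hBN hρ (hκ.trans (hτ.mono hBB)), Path.Homotopic.Quotient.trans_assoc]

lemma locDeg_liftSet_trans (hM : IsOpen M) (hf : Continuous f)
    (hfF : ∀ x : M, (F x : Euc n) = f x) (hP : ProperOver f M N)
    (hB : IsOpen B) (hBc : Convex ℝ B) (hBN : B ⊆ N)
    (hB' : IsOpen B') (hBc' : Convex ℝ B') (hBB : B' ⊆ B) (hq' : (q' : Euc n) ∈ B')
    {κ : Path.Homotopic.Quotient q q'} (hκ : IsSmall B κ) :
    locDeg (fun x => f x - q') (liftSet F (p.trans κ) B')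
      = locDeg (fun x => f x - q) (liftSet F p B) := by
  have hPl : ProperOver f (liftSet F p B) B := properOver_liftSet hM hB hBN hf hfF hP
  have ho : IsOpen (liftSet F p B) := isOpen_liftSet hM hB hf hfF
  rw [liftSet_trans hBc hBN hBc' hBB hq' hfF hκ,
    hPl.locDeg_eq ho hf.continuousOn hB hBc.isPreconnected hκ.left_mem (hBB hq')]
  symm
  refine locDeg_excision (hPl.degAdm ho hf.continuousOn (hBB hq'))
    (ho.inter (hB'.preimage hf)) inter_subset_left fun x hx h0 => ⟨hx, ?_⟩
  have : f x = q' := sub_eq_zero.1 h0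
  rw [mem_preimage, this]; exact hq'

lemma locDeg_liftSet_eq (hM : IsOpen M) (hf : Continuous f)
    (hfF : ∀ x : M, (F x : Euc n) = f x) (hP : ProperOver f M N) {r r' : ℝ} (hr : 0 < r)
    (hr' : 0 < r') (hB : ball (q : Euc n) r ⊆ N) (hB' : ball (q : Euc n) r' ⊆ N) :
    locDeg (fun x => f x - q) (liftSet F p (ball (q : Euc n) r))
      = locDeg (fun x => f x - q) (liftSet F p (ball (q : Euc n) r')) := by
  wlog h : r ≤ r' generalizing r r'
  · exact (this hr' hr hB' hB (le_of_not_ge h)).symm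
  have := locDeg_liftSet_trans (p := p) hM hf hfF hP isOpen_ball (convex_ball _ _) hB' isOpen_ball
    (convex_ball _ _) (ball_subset_ball h) (mem_ball_self hr)
    (IsSmall.refl (a := q) (mem_ball_self hr'))
  rwa [Path.Homotopic.Quotient.trans_refl] at this

end LiftSet

section LiftDegree

variable {n : ℕ} {M N : Set (Euc n)} {F : C(M, N)} {y₀ : M} {f : Euc n → Euc n}

lemma locDeg_liftSet_subpath (hM : IsOpen M) (hN : IsOpen N) (hf : Continuous f)
    (hfF : ∀ x : M, (F x : Euc n) = f x) (hP : ProperOver f M N) {a b : N} (β : Path a b)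
    (p : Path.Homotopic.Quotient (F y₀) (β 0)) {r r' : ℝ} (hr : 0 < r) (hr' : 0 < r')
    (hB : ball (β 0 : Euc n) r ⊆ N) (hB' : ball (β 1 : Euc n) r' ⊆ N) :
    locDeg (fun x => f x - β 1)
        (liftSet F (p.trans (Path.Homotopic.Quotient.mk (β.subpath 0 1))) (ball (β 1 : Euc n) r'))
      = locDeg (fun x => f x - β 0) (liftSet F p (ball (β 0 : Euc n) r)) := by
  have hR : ∀ q : N, ∃ ε > 0, ball (q : Euc n) ε ⊆ N := fun q =>
    Metric.isOpen_iff.1 hN q q.2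
  choose R hR0 hRN using hR
  let d : I → ℝ := fun t => locDeg (fun x => f x - β t)
    (liftSet F (p.trans (Path.Homotopic.Quotient.mk (β.subpath 0 t))) (ball (β t : Euc n) (R (β t))))
  have hd : d 1 = d 0 := by
    refine IsPreconnected.eq_of_eventually_eq (S := univ) isPreconnected_univ (fun t _ => ?_)
      (mem_univ _) (mem_univ _)
    rw [nhdsWithin_univ]
    have hβ : Continuous fun s => (β s : Euc n) := continuous_subtype_val.comp β.continuous
    obtain ⟨ε, hε, hb⟩ := Metric.mem_nhds_iff.1
      (hβ.continuousAt.preimage_mem_nhds (ball_mem_nhds (β t : Euc n) (hR0 (β t))))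
    filter_upwards [ball_mem_nhds t hε] with s hs
    have hsub : ∀ u ∈ uIcc t s, (β u : Euc n) ∈ ball (β t : Euc n) (R (β t)) := by
      intro u hu
      apply hb
      rw [mem_ball] at hs ⊢
      refine lt_of_le_of_lt ?_ hs
      rw [Subtype.dist_eq, Subtype.dist_eq, Real.dist_eq, Real.dist_eq]
      refine abs_sub_left_of_mem_uIcc ?_
      rw [mem_uIcc] at hu ⊢
      exact hu
    have hsm : IsSmall (ball (β t : Euc n) (R (β t)))
        (Path.Homotopic.Quotient.mk (β.subpath t s)) := by
      refine ⟨_, rfl, fun v => ?_⟩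
      have hv : (β.subpath t s) v ∈ β '' uIcc t s := by
        rw [← Path.range_subpath]; exact mem_range_self v
      obtain ⟨u, hu, huv⟩ := hv
      rw [← huv]; exact hsub u hu
    have hcomp : Path.Homotopic.Quotient.mk (β.subpath 0 s)
        = (Path.Homotopic.Quotient.mk (β.subpath 0 t)).trans
          (Path.Homotopic.Quotient.mk (β.subpath t s)) := by
      rw [← Path.Homotopic.Quotient.mk_trans]
      exact (Path.Homotopic.Quotient.eq.2 ⟨Path.Homotopy.subpathTransSubpath β 0 t s⟩).symm
    obtain ⟨r₁, hr₁, hb₁⟩ := Metric.isOpen_iff.1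
      (isOpen_ball (x := (β t : Euc n)) (ε := R (β t))) _ hsm.right_mem
    have h1 := locDeg_liftSet_trans (p := p.trans (Path.Homotopic.Quotient.mk (β.subpath 0 t)))
      hM hf hfF hP isOpen_ball (convex_ball _ _) (hRN (β t)) isOpen_ball (convex_ball _ r₁) hb₁
      (mem_ball_self hr₁) hsm
    rw [Path.Homotopic.Quotient.trans_assoc, ← hcomp] at h1
    change locDeg _ _ = locDeg _ _
    rw [← h1]
    exact locDeg_liftSet_eq hM hf hfF hP (hR0 _) hr₁ (hRN _) (hb₁.trans (hRN _))
  have h0 : p.trans (Path.Homotopic.Quotient.mk (β.subpath 0 0)) = p := by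
    rw [Path.subpath_self]
    exact Path.Homotopic.Quotient.trans_refl p
  rw [locDeg_liftSet_eq hM hf hfF hP hr' (hR0 _) hB' (hRN _),
    locDeg_liftSet_eq (p := p) hM hf hfF hP hr (hR0 _) hB (hRN _)]
  change d 1 = _
  rw [hd]
  change locDeg _ (liftSet F (p.trans (Path.Homotopic.Quotient.mk (β.subpath 0 0))) _) = _
  rw [h0]

lemma locDeg_liftSet_trans_mk (hM : IsOpen M) (hN : IsOpen N) (hf : Continuous f)
    (hfF : ∀ x : M, (F x : Euc n) = f x) (hP : ProperOver f M N) {a b : N}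
    (p : Path.Homotopic.Quotient (F y₀) a) (β : Path a b) {r r' : ℝ} (hr : 0 < r) (hr' : 0 < r')
    (hB : ball (a : Euc n) r ⊆ N) (hB' : ball (b : Euc n) r' ⊆ N) :
    locDeg (fun x => f x - b)
        (liftSet F (p.trans (Path.Homotopic.Quotient.mk β)) (ball (b : Euc n) r'))
      = locDeg (fun x => f x - a) (liftSet F p (ball (a : Euc n) r)) := by
  have key : ∀ {a' b' : N} (β' : Path a' b') (ha : a' = a) (hb : b' = b)
      (_ : β' = β.cast ha hb) (p' : Path.Homotopic.Quotient (F y₀) a')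
      (_ : p' = p.cast rfl ha),
      locDeg (fun x => f x - b')
        (liftSet F (p'.trans (Path.Homotopic.Quotient.mk β')) (ball (b' : Euc n) r'))
      = locDeg (fun x => f x - a') (liftSet F p' (ball (a' : Euc n) r)) →
      locDeg (fun x => f x - b)
        (liftSet F (p.trans (Path.Homotopic.Quotient.mk β)) (ball (b : Euc n) r'))
      = locDeg (fun x => f x - a) (liftSet F p (ball (a : Euc n) r)) := by
    intro a' b' β' ha hb hβ' p' hp' h
    subst ha hb hβ' hp'
    simpa using h
  refine key (β.subpath 0 1) β.source β.target (Path.subpath_zero_one β) (p.cast rfl β.source) rfl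
    (locDeg_liftSet_subpath hM hN hf hfF hP β _ hr hr' ?_ ?_)
  · rw [β.source]; exact hB
  · rw [β.target]; exact hB'

lemma liftSet_eq_of_mem {q : N} {p p' : Path.Homotopic.Quotient (F y₀) q} {B : Set (Euc n)}
    (hBc : Convex ℝ B) (hBN : B ⊆ N) {x : Euc n} (hx : x ∈ liftSet F p B)
    (hx' : x ∈ liftSet F p' B) : liftSet F p B = liftSet F p' B := by
  have key : ∀ {p p' : Path.Homotopic.Quotient (F y₀) q}, x ∈ liftSet F p B →
      x ∈ liftSet F p' B → liftSet F p B ⊆ liftSet F p' B := by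
    rintro p p' ⟨hxM, α, κ, hκ, hα⟩ ⟨_, α', κ', hκ', hα'⟩ z ⟨hz, β, τ, hτ, hβ⟩
    obtain rfl : κ' = κ := IsSmall.eq hBc hBN hκ' hκ
    refine ⟨hz, α'.trans (α.symm.trans β), τ, hτ, ?_⟩
    have hp : p = (α.map F).trans κ'.symm := by
      rw [hα, Path.Homotopic.Quotient.trans_assoc, Path.Homotopic.Quotient.trans_symm,
        Path.Homotopic.Quotient.trans_refl]
    have hp' : p' = (α'.map F).trans κ'.symm := by
      rw [hα', Path.Homotopic.Quotient.trans_assoc, Path.Homotopic.Quotient.trans_symm,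
        Path.Homotopic.Quotient.trans_refl]
    rw [quotient_map_trans, quotient_map_trans, quotient_map_symm, hβ, hp', hp]
    simp only [Path.Homotopic.Quotient.trans_assoc]
    rw [← Path.Homotopic.Quotient.trans_assoc (α.map F).symm, Path.Homotopic.Quotient.symm_trans,
      Path.Homotopic.Quotient.refl_trans]
  exact (key hx hx').antisymm (key hx' hx)

lemma exists_mem_liftSet [PathConnectedSpace M] {q : N} {B : Set (Euc n)}
    (hBc : Convex ℝ B) (hBN : B ⊆ N) (hq : (q : Euc n) ∈ B) {x : M} (hx : (F x : Euc n) ∈ B) :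
    ∃ b : Path.Homotopic.Quotient (F y₀) q, (x : Euc n) ∈ liftSet F b B := by
  obtain ⟨κ, hκ⟩ := IsSmall.exists_of_mem hBc hBN hq hx
  let α : Path.Homotopic.Quotient y₀ x :=
    Path.Homotopic.Quotient.mk (PathConnectedSpace.somePath y₀ x)
  refine ⟨(α.map F).trans κ.symm, x.2, α, κ, hκ, ?_⟩
  rw [Path.Homotopic.Quotient.trans_assoc, Path.Homotopic.Quotient.symm_trans,
    Path.Homotopic.Quotient.trans_refl]

/-- A proper map of degree `±1` between open sets induces an epimorphism of fundamental groups. -/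
theorem exists_path_map_homotopic [PathConnectedSpace M] (hM : IsOpen M) (hN : IsOpen N)
    (hf : Continuous f) (hfF : ∀ x : M, (F x : Euc n) = f x) (hP : ProperOver f M N) {d k : ℤ}
    (hd : locDeg (fun x => f x - f y₀) M = d) (hdk : d * k = 1) (γ : Path (F y₀) (F y₀)) :
    ∃ a : Path y₀ y₀, (a.map F.continuous).Homotopic γ := by
  classical
  let q : N := F y₀
  have hfq : (q : Euc n) = f y₀ := hfF y₀
  obtain ⟨r, hr, hBN⟩ := Metric.isOpen_iff.1 hN q q.2
  set B := ball (q : Euc n) r with hBdef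
  have hqB : (q : Euc n) ∈ B := mem_ball_self hr
  have hBc : Convex ℝ B := convex_ball _ _
  let Ω : Path.Homotopic.Quotient (F y₀) q → Set (Euc n) := fun b => liftSet F b B
  have hΩo : ∀ b, IsOpen (Ω b) := fun b => isOpen_liftSet hM isOpen_ball hf hfF
  have hΩM : ∀ b, Ω b ⊆ M := fun b x hx => (liftSet_subset hfF hx).1
  have hΩeq : ∀ b b' x, x ∈ Ω b → x ∈ Ω b' → Ω b = Ω b' := fun b b' x hx hx' =>
    liftSet_eq_of_mem hBc hBN hx hx'
  have hdeg : ∀ b, locDeg (fun x => f x - q) (Ω b)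
      = locDeg (fun x => f x - q) (Ω (Path.Homotopic.Quotient.refl q)) := by
    intro b
    induction b using Path.Homotopic.Quotient.ind with | mk β =>
    have := locDeg_liftSet_trans_mk hM hN hf hfF hP (Path.Homotopic.Quotient.refl (F y₀)) β hr hr
      hBN hBN
    rwa [Path.Homotopic.Quotient.refl_trans] at this
  have hadm : DegAdm (fun x => f x - q) (Ω (Path.Homotopic.Quotient.refl q)) :=
    (properOver_liftSet hM isOpen_ball hBN hf hfF hP).degAdm (hΩo _) hf.continuousOn hqB
  obtain ⟨e, he⟩ := exists_int_locDeg_eq hadm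
  have hcov : ∀ x ∈ M, f x = q → ∃ b, x ∈ Ω b := by
    intro x hx hxq
    have hxB : (F ⟨x, hx⟩ : Euc n) ∈ B := by rw [hfF, hxq]; exact hqB
    exact exists_mem_liftSet hBc hBN hqB hxB
  have hfib : IsCompact (M ∩ f ⁻¹' {(q : Euc n)}) :=
    hP _ (singleton_subset_iff.2 q.2) isCompact_singleton
  obtain ⟨t, ht⟩ := hfib.elim_finite_subcover Ω hΩo fun x hx => by
    obtain ⟨b, hb⟩ := hcov x hx.1 hx.2
    exact mem_iUnion.2 ⟨b, hb⟩
  have ht' : ∀ x ∈ M, f x = q → ∃ b ∈ t, x ∈ Ω b := by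
    intro x hx hxq
    have := ht ⟨hx, hxq⟩
    simpa only [mem_iUnion, exists_prop] using this
  let Z : Finset (Set (Euc n)) := t.image Ω
  have hZ : ∀ S ∈ Z, ∃ b, Ω b = S := fun S hS => by
    obtain ⟨b, -, hb⟩ := Finset.mem_image.1 hS
    exact ⟨b, hb⟩
  have hsum : locDeg (fun x => f x - q) M = ∑ S ∈ Z, locDeg (fun x => f x - q) S := by
    refine locDeg_eq_sum (hP.degAdm hM hf.continuousOn q.2) Z (fun S => S) ?_ ?_ ?_ ?_
    · intro S hS
      obtain ⟨b, rfl⟩ := hZ S hS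
      exact hΩo b
    · intro S hS
      obtain ⟨b, rfl⟩ := hZ S hS
      exact hΩM b
    · intro S hS S' hS' hne
      obtain ⟨b, rfl⟩ := hZ S hS
      obtain ⟨b', rfl⟩ := hZ S' hS'
      exact Set.disjoint_left.2 fun x hx hx' => hne (hΩeq b b' x hx hx')
    · intro x hx h0
      obtain ⟨b, hb, hxb⟩ := ht' x hx (sub_eq_zero.1 h0)
      exact ⟨Ω b, Finset.mem_image_of_mem _ hb, hxb⟩
  have hcard : locDeg (fun x => f x - q) M = Z.card * (e : ℝ) := by
    rw [hsum, Finset.sum_congr rfl (g := fun _ => (e : ℝ)), Finset.sum_const, nsmul_eq_mul]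
    intro S hS
    obtain ⟨b, rfl⟩ := hZ S hS
    rw [hdeg b, he]
  have hde : (Z.card : ℤ) * e = d := by
    have : ((Z.card : ℤ) : ℝ) * (e : ℝ) = d := by
      rw [← hd, ← hfq, hcard]; simp
    exact_mod_cast this
  have hZ1 : Z.card = 1 := by
    have hu : IsUnit (Z.card : ℤ) := IsUnit.of_mul_eq_one (e * k) (by rw [← mul_assoc, hde, hdk])
    simpa using Int.isUnit_iff_natAbs_eq.1 hu
  have he0 : e ≠ 0 := by
    rintro rfl
    rw [mul_zero] at hde
    rw [← hde, zero_mul] at hdk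
    exact zero_ne_one hdk
  let g : Path.Homotopic.Quotient (F y₀) q := Path.Homotopic.Quotient.mk γ
  have hex : ∃ x ∈ Ω g, f x = q := by
    by_contra hc
    push Not at hc
    have h0 : locDeg (fun x => f x - q) (Ω g) = 0 :=
      locDeg_eq_zero (hf.sub continuous_const).continuousOn fun x hx => sub_ne_zero.2 (hc x hx)
    rw [hdeg, he] at h0
    exact he0 (by exact_mod_cast h0)
  obtain ⟨x, hxg, hxq⟩ := hex
  obtain ⟨b, hb, hxb⟩ := ht' x (hΩM _ hxg) hxq
  obtain ⟨b', hb', hyb'⟩ := ht' y₀ y₀.2 hfq.symm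
  have hbb' : Ω b = Ω b' := Finset.card_le_one.1 hZ1.le _ (Finset.mem_image_of_mem _ hb) _
    (Finset.mem_image_of_mem _ hb')
  have hyg : (y₀ : Euc n) ∈ Ω g := by
    rw [hΩeq g b x hxg hxb, hbb']; exact hyb'
  obtain ⟨hy, α, κ, hκ, hα⟩ := hyg
  have hκr : κ = Path.Homotopic.Quotient.refl q := IsSmall.eq hBc hBN hκ (IsSmall.refl hqB)
  rw [hκr] at hα
  have hα' : α.map F = g := hα.trans (Path.Homotopic.Quotient.trans_refl g)
  obtain ⟨a, rfl⟩ := Path.Homotopic.Quotient.mk_surjective α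
  exact ⟨a, Path.Homotopic.Quotient.eq.1 ((Path.Homotopic.Quotient.mk_map a F).trans hα')⟩

end LiftDegree

lemma exists_stereographic {n : ℕ} {p : Amb n} (hp : p ∈ Sph n) :
    ∃ (φ : Amb n → Euc n) (ψ : Euc n → Amb n), ContinuousOn φ (Sph n \ {p}) ∧ Continuous ψ ∧
      (∀ y, ψ y ∈ Sph n \ {p}) ∧ (∀ y, φ (ψ y) = y) ∧ ∀ x ∈ Sph n \ {p}, ψ (φ x) = x := by
  classical
  have : Fact (Module.finrank ℝ (Amb n) = n + 1) := ⟨finrank_euclideanSpace_fin⟩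
  let v : sphere (0 : Amb n) 1 := ⟨p, hp⟩
  let s := stereographic' n v
  have hsrc : s.source = {v}ᶜ := stereographic'_source v
  have htgt : s.target = univ := stereographic'_target v
  have hφ : ∀ x (hx : x ∈ sphere (0 : Amb n) 1),
      (if h : x ∈ sphere (0 : Amb n) 1 then s ⟨x, h⟩ else 0) = s ⟨x, hx⟩ := fun x hx => dif_pos hx
  have hs : ∀ y, s.symm y ≠ v := fun y => by
    have := s.map_target (x := y) (by rw [htgt]; trivial)
    rwa [hsrc] at this
  refine ⟨fun x => if h : x ∈ sphere (0 : Amb n) 1 then s ⟨x, h⟩ else 0, fun y => s.symm y,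
    ?_, ?_, ?_, ?_, ?_⟩
  · rw [continuousOn_iff_continuous_restrict]
    have h1 : Continuous fun x : ↥(Sph n \ {p}) => (⟨(x : Amb n), x.2.1⟩ : sphere (0 : Amb n) 1) := by
      fun_prop
    have h2 := s.continuousOn.comp_continuous h1 (fun x => by
      rw [hsrc]
      exact fun hx => x.2.2 (congrArg Subtype.val hx))
    refine h2.congr fun x => (hφ x x.2.1).symm
  · have := s.continuousOn_symm
    rw [htgt, continuousOn_univ] at this
    exact continuous_subtype_val.comp this
  · exact fun y => ⟨(s.symm y).2, fun h => hs y (Subtype.ext h)⟩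
  · intro y
    simp only [hφ _ (s.symm y).2]
    exact s.right_inv (by rw [htgt]; trivial)
  · intro x hx
    simp only [hφ _ hx.1]
    have : (⟨x, hx.1⟩ : sphere (0 : Amb n) 1) ∈ s.source := by
      rw [hsrc]
      exact fun h => hx.2 (congrArg Subtype.val h)
    rw [s.left_inv this]

namespace CrumpledCube

variable {n : ℕ}

lemma isCompact_bd (C : CrumpledCube n) : IsCompact C.bd := by
  obtain ⟨e, he, -, hr⟩ := C.exists_embedding
  have : CompactSpace (Sph (n - 1)) := isCompact_iff_compactSpace.1 (isCompact_sphere _ _)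
  rw [← hr]
  exact isCompact_range he

lemma int_subset (C : CrumpledCube n) : C.int ⊆ Sph n \ C.bd := by
  obtain ⟨x, hx, h⟩ := C.int_component
  rw [h]; exact connectedComponentIn_subset _ _

lemma int_nonempty (C : CrumpledCube n) : C.int.Nonempty := by
  obtain ⟨x, hx, h⟩ := C.int_component
  exact ⟨x, h ▸ mem_connectedComponentIn hx⟩

lemma isPreconnected_int (C : CrumpledCube n) : IsPreconnected C.int := by
  obtain ⟨x, hx, h⟩ := C.int_component
  rw [h]; exact isPreconnected_connectedComponentIn

lemma subset_int (C : CrumpledCube n) {S : Set (Amb n)} (hS : IsPreconnected S)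
    (hsub : S ⊆ Sph n \ C.bd) {x : Amb n} (hx : x ∈ S) (hxi : x ∈ C.int) : S ⊆ C.int := by
  obtain ⟨z, hz, h⟩ := C.int_component
  have : C.int = connectedComponentIn (Sph n \ C.bd) x := by
    rw [h]; exact connectedComponentIn_eq (h ▸ hxi)
  rw [this]
  exact hS.subset_connectedComponentIn hx hsub

lemma carrier_subset (C : CrumpledCube n) : C.carrier ⊆ Sph n :=
  union_subset C.bd_subset_sphere (C.int_subset.trans diff_subset)

lemma exists_planar_embedding (hn : 2 ≤ n) (C : CrumpledCube n) {φ : Amb n → Euc n}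
    {ψ : Euc n → Amb n} {S : Set (Amb n)} (hφ : ContinuousOn φ S) (hS : C.bd ⊆ S)
    (hφψ : ∀ y, φ (ψ y) = y) (hψφ : ∀ x ∈ S, ψ (φ x) = x) :
    (sphere (0 : Euc n) 1).Nonempty ∧ ∃ e : Euc n → Euc n, Continuous e ∧
      InjOn e (sphere 0 1) ∧ ψ ⁻¹' C.bd = e '' sphere 0 1 := by
  classical
  obtain ⟨m, rfl⟩ : ∃ m, n = m + 1 := ⟨n - 1, by omega⟩
  obtain ⟨e₀, he₀, hinj, hr⟩ := C.exists_embedding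
  let e₁ : Euc (m + 1) → Euc (m + 1) := fun x =>
    if h : x ∈ sphere (0 : Euc (m + 1)) 1 then φ (e₀ ⟨x, h⟩) else 0
  have he₁ : ∀ x (hx : x ∈ sphere (0 : Euc (m + 1)) 1), e₁ x = φ (e₀ ⟨x, hx⟩) :=
    fun x hx => dif_pos hx
  have hmem : ∀ x, e₀ x ∈ C.bd := fun x => by rw [← hr]; exact mem_range_self x
  have hc : ContinuousOn e₁ (sphere 0 1) := by
    rw [continuousOn_iff_continuous_restrict]
    have h1 : Continuous fun x : ↥(Sph m) => φ (e₀ x) :=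
      hφ.comp_continuous he₀ fun x => hS (hmem x)
    exact h1.congr fun x => (he₁ x x.2).symm
  obtain ⟨e, he, hee⟩ := exists_continuous_extension Metric.isClosed_sphere hc
  refine ⟨⟨EuclideanSpace.single 0 1, by simp⟩, e, he, ?_, ?_⟩
  · intro x hx y hy hxy
    rw [hee hx, hee hy, he₁ x hx, he₁ y hy] at hxy
    have h1 := congrArg ψ hxy
    rw [hψφ _ (hS (hmem _)), hψφ _ (hS (hmem _))] at h1
    exact congrArg Subtype.val (hinj h1)
  · ext y
    constructor
    · intro hy
      have hy' : ψ y ∈ range e₀ := by rw [hr]; exact hy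
      obtain ⟨⟨x, hx₀⟩, hx⟩ := hy'
      refine ⟨x, hx₀, ?_⟩
      rw [hee hx₀, he₁ x hx₀, hx, hφψ]
    · rintro ⟨x, hx, rfl⟩
      rw [mem_preimage, hee hx, he₁ x hx, hψφ _ (hS (hmem _))]
      exact hmem _

lemma exists_exterior_nhds (hn : 2 ≤ n) (C : CrumpledCube n) :
    ∃ p ∈ Sph n, ∃ u : Set (Amb n), IsOpen u ∧ p ∈ u ∧ Disjoint u C.carrier := by
  obtain ⟨x, hxi⟩ := C.int_nonempty
  obtain ⟨hxS, hxb⟩ := C.int_subset hxi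
  obtain ⟨φ, ψ, hφ, hψ, hψS, hφψ, hψφ⟩ := exists_stereographic hxS
  have hbS : C.bd ⊆ Sph n \ {x} := fun z hz => ⟨C.bd_subset_sphere hz, by rintro rfl; exact hxb hz⟩
  obtain ⟨hne, e, he, hinj, hK⟩ := C.exists_planar_embedding hn hφ hbS hφψ hψφ
  obtain ⟨P, hP⟩ := exists_isSide he hinj hne
  rw [← hK] at hP
  have hPK : IsCompact (P ∪ ψ ⁻¹' C.bd) := by
    have h1 : P ∪ ψ ⁻¹' C.bd = closure P ∪ ψ ⁻¹' C.bd :=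
      (union_subset_union_left _ _root_.subset_closure).antisymm
        (union_subset hP.closure_subset subset_union_right)
    rw [h1, hK]
    exact hP.isBounded.isCompact_closure.union ((isCompact_sphere 0 1).image he)
  have hT : IsClosed (ψ '' (P ∪ ψ ⁻¹' C.bd)) := (hPK.image hψ).isClosed
  obtain ⟨u, hu, huP⟩ := (_root_.continuousOn_iff'.1 hφ) P hP.isOpen
  obtain ⟨y, hy⟩ := hP.nonempty
  have huP' : ∀ z, z ∈ Sph n → z ∈ u ∩ {x}ᶜ → z ∈ ψ '' P := fun z hz hzu => by
    have : z ∈ φ ⁻¹' P ∩ (Sph n \ {x}) := by rw [huP]; exact ⟨hzu.1, hz, hzu.2⟩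
    exact ⟨φ z, this.1, hψφ z this.2⟩
  have hPu : ∀ y ∈ P, ψ y ∈ u ∩ {x}ᶜ := fun y hy => by
    have : ψ y ∈ φ ⁻¹' P ∩ (Sph n \ {x}) := ⟨by rw [mem_preimage, hφψ]; exact hy, hψS y⟩
    rw [huP] at this
    exact ⟨this.1, (hψS y).2⟩
  have hPb : ∀ y ∈ P, ψ y ∉ C.bd := fun y hy h => Set.disjoint_left.1 hP.disjoint hy h
  refine ⟨ψ y, (hψS y).1, u ∩ {x}ᶜ, hu.inter isClosed_singleton.isOpen_compl, hPu y hy, ?_⟩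
  rw [Set.disjoint_left]
  rintro z hzu (hzb | hzi)
  · obtain ⟨w, hw, rfl⟩ := huP' z (C.bd_subset_sphere hzb) hzu
    exact hPb w hw hzb
  · obtain ⟨w, hwi, hwT, hwu⟩ := C.isPreconnected_int _ _ hT.isOpen_compl
      (hu.inter isClosed_singleton.isOpen_compl) (fun w hw => by
        by_cases h : w ∈ ψ '' (P ∪ ψ ⁻¹' C.bd)
        · right
          obtain ⟨y, hy | hy, rfl⟩ := h
          · exact hPu y hy
          · exact absurd hy (C.int_subset hw).2
        · exact Or.inl h)
      ⟨x, hxi, by rintro ⟨y, -, h⟩; exact (hψS y).2 h⟩ ⟨z, hzi, hzu⟩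
    exact hwT (image_mono subset_union_left (huP' w (C.int_subset hwi).1 hwu))

/-- A crumpled cube is homeomorphic, via a stereographic projection, to the closure of a bounded
complementary side of an embedded sphere in Euclidean space. -/
lemma exists_planar_model (hn : 2 ≤ n) (C : CrumpledCube n) :
    ∃ (φ : Amb n → Euc n) (ψ : Euc n → Amb n) (e : Euc n → Euc n), ContinuousOn φ C.carrier ∧
      Continuous ψ ∧ (∀ y, φ (ψ y) = y) ∧ (∀ x ∈ C.carrier, ψ (φ x) = x) ∧ Continuous e ∧
      InjOn e (sphere 0 1) ∧ ψ ⁻¹' C.bd = e '' sphere 0 1 ∧ IsSide (ψ ⁻¹' C.int) (ψ ⁻¹' C.bd) := by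
  obtain ⟨p, hp, u, hu, hpu, hd⟩ := C.exists_exterior_nhds hn
  obtain ⟨φ, ψ, hφ, hψ, hψS, hφψ, hψφ⟩ := exists_stereographic hp
  have hcS : C.carrier ⊆ Sph n \ {p} := fun z hz => ⟨C.carrier_subset hz, by
    rintro rfl; exact Set.disjoint_left.1 hd hpu hz⟩
  obtain ⟨-, e, he, hinj, hK⟩ := C.exists_planar_embedding hn hφ
    (C.bd_subset_carrier.trans hcS) hφψ hψφ
  refine ⟨φ, ψ, e, hφ.mono hcS, hψ, hφψ, fun x hx => hψφ x (hcS hx), he, hinj, hK, ?_⟩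
  obtain ⟨x, hxi⟩ := C.int_nonempty
  have hic : C.int ⊆ C.carrier := subset_union_right
  have hKc : IsOpen (ψ ⁻¹' C.bd)ᶜ := (C.isCompact_bd.isClosed.preimage hψ).isOpen_compl
  have hU : ψ ⁻¹' C.int = connectedComponentIn (ψ ⁻¹' C.bd)ᶜ (φ x) := by
    apply Subset.antisymm
    · have h1 : IsPreconnected (φ '' C.int) :=
        C.isPreconnected_int.image φ (hφ.mono (hic.trans hcS))
      refine Subset.trans ?_ (h1.subset_connectedComponentIn (mem_image_of_mem φ hxi) ?_)
      · exact fun y hy => ⟨ψ y, hy, hφψ y⟩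
      · rintro _ ⟨z, hz, rfl⟩ hzb
        rw [mem_preimage, hψφ z (hcS (hic hz))] at hzb
        exact (C.int_subset hz).2 hzb
    · have h1 : IsPreconnected (ψ '' connectedComponentIn (ψ ⁻¹' C.bd)ᶜ (φ x)) :=
        isPreconnected_connectedComponentIn.image ψ hψ.continuousOn
      have hψx : ψ (φ x) = x := hψφ x (hcS (hic hxi))
      have h2 := C.subset_int h1 (by
        rintro _ ⟨z, hz, rfl⟩
        exact ⟨(hψS z).1, connectedComponentIn_subset _ _ hz⟩)
        (mem_image_of_mem ψ (mem_connectedComponentIn (by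
          rw [mem_compl_iff, mem_preimage, hψx]; exact (C.int_subset hxi).2)))
        (by rw [hψx]; exact hxi)
      exact fun y hy => h2 (mem_image_of_mem ψ hy)
  refine ⟨?_, ?_, ?_, ?_, ?_⟩
  · rw [hU]; exact hKc.connectedComponentIn
  · have hc : IsCompact (Sph n \ u) := (isCompact_sphere (0 : Amb n) 1).diff hu
    have hsub : Sph n \ u ⊆ Sph n \ {p} := fun z hz => ⟨hz.1, by rintro rfl; exact hz.2 hpu⟩
    refine (hc.image_of_continuousOn (hφ.mono hsub)).isBounded.subset fun y hy => ?_
    exact ⟨ψ y, ⟨(C.int_subset hy).1, fun h => Set.disjoint_left.1 hd h (hic hy)⟩, hφψ y⟩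
  · intro y hy
    by_contra hc
    rw [mem_union, not_or, hU] at hc
    rw [hU] at hy
    obtain ⟨z, hz, hz'⟩ := mem_closure_iff.1 hy _ (isOpen_diff_connectedComponentIn hKc (φ x))
      ⟨hc.2, hc.1⟩
    exact hz.2 hz'
  · exact Set.disjoint_left.2 fun y hy hy' => (C.int_subset hy).2 hy'
  · exact ⟨φ x, by rw [mem_preimage, hψφ x (hcS (hic hxi))]; exact hxi⟩

end CrumpledCube

lemma continuousOn_dite_mem {X Y : Type*} [TopologicalSpace X] [TopologicalSpace Y] {S : Set X}
    [DecidablePred (· ∈ S)] {g : S → Y} (hg : Continuous g) (y : Y) :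
    ContinuousOn (fun x => if h : x ∈ S then g ⟨x, h⟩ else y) S := by
  rw [continuousOn_iff_continuous_restrict]
  exact hg.congr fun x => by simp

/-- **Lemma 3.1.** If `(C,D,h) ∈ 𝒲_n` with associated map `f`, `W` is a connected open
subset of `D` with `W ∩ Bd D` connected and nonempty, and `Y` is the component of
`f⁻¹(W)` containing `h⁻¹(W ∩ Bd D)`, then `f` induces an epimorphism
`π₁(Y ∩ Int C) → π₁(W ∩ Int D)`. -/
theorem stmt2 (n : ℕ) (hn : 2 ≤ n) (C D : CrumpledCube n) (h : ↥C.bd ≃ₜ ↥D.bd)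
    (f : ↥C.carrier → ↥D.carrier) (hf : IsAssociatedMap C D h f)
    (W : Set (Amb n)) (hWsub : W ⊆ D.carrier)
    (hWopen : ∃ V : Set (Amb n), IsOpen V ∧ W = V ∩ D.carrier)
    (hWconn : IsConnected W) (hWbd : IsConnected (W ∩ D.bd))
    (Y : Set ↥C.carrier) (x₀ : ↥C.carrier)
    (hx₀ : ((f x₀ : ↥D.carrier) : Amb n) ∈ W ∩ D.bd)
    (hY : Y = connectedComponentIn {x : ↥C.carrier | ((f x : ↥D.carrier) : Amb n) ∈ W} x₀)
    (hYcont : {x : ↥C.carrier | ((f x : ↥D.carrier) : Amb n) ∈ W ∩ D.bd} ⊆ Y) :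
    ∀ y₀ : ↥C.carrier, y₀ ∈ Y → (y₀ : Amb n) ∈ C.int →
      ∀ γ : Path (f y₀) (f y₀), (∀ t, ((γ t : ↥D.carrier) : Amb n) ∈ W ∩ D.int) →
        ∃ γ' : Path y₀ y₀,
          (∀ t, γ' t ∈ Y ∧ ((γ' t : ↥C.carrier) : Amb n) ∈ C.int) ∧
          ∃ F : Path.Homotopy (γ'.map hf.1) γ,
            ∀ z, ((F z : ↥D.carrier) : Amb n) ∈ W ∩ D.int := by
  classical
  obtain ⟨φ, ψ, e, hφ, hψ, hφψ, hψφ, he, hinj, hK, hU⟩ := C.exists_planar_model hn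
  obtain ⟨φ', ψ', e', hφ', hψ', hφψ', hψφ', he', hinj', hL, hV⟩ := D.exists_planar_model hn
  obtain ⟨V₀, hV₀, rfl⟩ := hWopen
  obtain ⟨hfc, hfh, hfb⟩ := hf
  have hCb : C.bd ⊆ C.carrier := subset_union_left
  have hCi : C.int ⊆ C.carrier := subset_union_right
  have hDb : D.bd ⊆ D.carrier := subset_union_left
  have hDi : D.int ⊆ D.carrier := subset_union_right
  have hbU : ∀ x : C.carrier, (x : Amb n) ∈ C.int → ((f x : D.carrier) : Amb n) ∈ D.int := by
    intro x hx
    rcases (f x).2 with h | h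
    · exact absurd ((hfb x).1 h) (C.int_subset hx).2
    · exact h
  have hKc : IsCompact (ψ ⁻¹' C.bd) := by rw [hK]; exact (isCompact_sphere 0 1).image he
  have hLc : IsCompact (ψ' ⁻¹' D.bd) := by rw [hL]; exact (isCompact_sphere 0 1).image he'
  have hcl : IsClosed (ψ ⁻¹' C.carrier) := by
    have h1 : ψ ⁻¹' C.carrier = closure (ψ ⁻¹' C.int) ∪ ψ ⁻¹' C.bd := by
      apply Subset.antisymm
      · rintro y (hy | hy)
        · exact Or.inr hy
        · exact Or.inl (_root_.subset_closure hy)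
      · refine union_subset (hU.closure_subset.trans ?_) fun y hy => Or.inl hy
        rintro y (hy | hy)
        · exact Or.inr hy
        · exact Or.inl hy
    rw [h1]
    exact isClosed_closure.union hKc.isClosed
  have hφf : Continuous fun x => φ' (f x) := hφ'.comp_continuous
    (continuous_subtype_val.comp hfc) fun x => (f x).2
  obtain ⟨f₁, hf₁, hf₁e⟩ := exists_continuous_extension hcl
    ((continuousOn_dite_mem hφf 0).comp hψ.continuousOn fun y hy => hy)
  have hf₁' : ∀ y (hy : ψ y ∈ C.carrier), f₁ y = φ' (f ⟨ψ y, hy⟩) := fun y hy =>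
    (hf₁e hy).trans (dif_pos hy)
  have hφh : Continuous fun x => φ (h.symm x) := hφ.comp_continuous
    (continuous_subtype_val.comp h.symm.continuous) fun x => hCb (h.symm x).2
  obtain ⟨g₁, hg₁, hg₁e⟩ := exists_continuous_extension hLc.isClosed
    ((continuousOn_dite_mem hφh 0).comp hψ'.continuousOn fun y hy => hy)
  have hg₁' : ∀ y (hy : ψ' y ∈ D.bd), g₁ y = φ (h.symm ⟨ψ' y, hy⟩) := fun y hy =>
    (hg₁e hy).trans (dif_pos hy)
  have hψf : ∀ y (hy : ψ y ∈ C.carrier), ψ' (f₁ y) = f ⟨ψ y, hy⟩ := fun y hy => by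
    rw [hf₁' y hy, hψφ' _ (f _).2]
  have hf₁φ : ∀ x : C.carrier, ψ' (f₁ (φ x)) = f x := fun x => by
    have h1 : (⟨ψ (φ x), by rw [hψφ x x.2]; exact x.2⟩ : C.carrier) = x :=
      Subtype.ext (hψφ x x.2)
    rw [hψf (φ x) (by rw [hψφ x x.2]; exact x.2), h1]
  have hUV : MapsTo f₁ (ψ ⁻¹' C.int) (ψ' ⁻¹' D.int) := fun y hy => by
    rw [mem_preimage, hψf y (hCi hy)]
    exact hbU _ hy
  have hKL : f₁ '' (ψ ⁻¹' C.bd) = ψ' ⁻¹' D.bd := by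
    apply Subset.antisymm
    · rintro _ ⟨y, hy, rfl⟩
      rw [mem_preimage, hψf y (hCb hy), hfb]
      exact hy
    · intro z hz
      have h1 : ψ (φ (h.symm ⟨ψ' z, hz⟩)) = h.symm ⟨ψ' z, hz⟩ := hψφ _ (hCb (h.symm _).2)
      refine ⟨φ (h.symm ⟨ψ' z, hz⟩), ?_, ?_⟩
      · rw [mem_preimage, h1]; exact (h.symm _).2
      · have h2 := hf₁φ ⟨h.symm ⟨ψ' z, hz⟩, hCb (h.symm _).2⟩
        rw [hfh _ (h.symm _).2] at h2
        simp only [Subtype.coe_eta, Homeomorph.apply_symm_apply] at h2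
        rw [← hφψ' (f₁ _), h2, hφψ']
  have hgf : ∀ y ∈ ψ ⁻¹' C.bd, g₁ (f₁ y) = y := by
    intro y hy
    have h1 : ψ' (f₁ y) = h ⟨ψ y, hy⟩ := by rw [hψf y (hCb hy), hfh ⟨ψ y, hCb hy⟩ hy]
    have h2 : ψ' (f₁ y) ∈ D.bd := by rw [h1]; exact (h _).2
    have h3 : (⟨ψ' (f₁ y), h2⟩ : D.bd) = h ⟨ψ y, hy⟩ := Subtype.ext h1
    rw [hg₁' _ h2, h3, h.symm_apply_apply, hφψ]
  have hO : IsOpen (ψ' ⁻¹' V₀) := hV₀.preimage hψ'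
  have hW₁ : ψ' ⁻¹' V₀ ∩ (ψ' ⁻¹' D.int ∪ ψ' ⁻¹' D.bd) = φ' '' (V₀ ∩ D.carrier) := by
    ext y
    constructor
    · rintro ⟨h1, h2 | h2⟩
      · exact ⟨ψ' y, ⟨h1, Or.inr h2⟩, hφψ' y⟩
      · exact ⟨ψ' y, ⟨h1, Or.inl h2⟩, hφψ' y⟩
    · rintro ⟨x, ⟨hx, hxD⟩, rfl⟩
      simp only [mem_inter_iff, mem_union, mem_preimage, hψφ' x hxD]
      exact ⟨hx, hxD.symm⟩
  have hW₂ : IsPreconnected (ψ' ⁻¹' V₀ ∩ (ψ' ⁻¹' D.int ∪ ψ' ⁻¹' D.bd)) := by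
    rw [hW₁]
    exact hWconn.isPreconnected.image φ' (hφ'.mono inter_subset_right)
  have hKW : IsPreconnected (ψ ⁻¹' C.bd ∩ f₁ ⁻¹' (ψ' ⁻¹' V₀)) := by
    have h1 : ψ ⁻¹' C.bd ∩ f₁ ⁻¹' (ψ' ⁻¹' V₀) = g₁ '' (φ' '' (V₀ ∩ D.carrier ∩ D.bd)) := by
      ext y
      constructor
      · rintro ⟨hy, hyV⟩
        have h2 : ψ' (f₁ y) ∈ D.bd := by
          have : f₁ y ∈ ψ' ⁻¹' D.bd := by rw [← hKL]; exact mem_image_of_mem _ hy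
          exact this
        exact ⟨f₁ y, ⟨ψ' (f₁ y), ⟨⟨hyV, hDb h2⟩, h2⟩, hφψ' _⟩, hgf y hy⟩
      · rintro ⟨_, ⟨z, ⟨⟨hzV, hzD⟩, hzb⟩, rfl⟩, rfl⟩
        have h2 : φ' z ∈ ψ' ⁻¹' D.bd := by rw [mem_preimage, hψφ' z hzD]; exact hzb
        rw [← hKL] at h2
        obtain ⟨y, hy, hyz⟩ := h2
        rw [← hyz, hgf y hy]
        refine ⟨hy, ?_⟩
        rw [mem_preimage, hyz, mem_preimage, hψφ' z hzD]
        exact hzV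
    rw [h1]
    exact (hWbd.isPreconnected.image φ' (hφ'.mono (inter_subset_right.trans hDb))).image g₁
      hg₁.continuousOn
  have hVc : IsPreconnected (ψ' ⁻¹' D.int) := by
    have h1 : ψ' ⁻¹' D.int = φ' '' D.int := by
      ext y
      constructor
      · exact fun hy => ⟨ψ' y, hy, hφψ' y⟩
      · rintro ⟨x, hx, rfl⟩
        rw [mem_preimage, hψφ' x (hDi hx)]
        exact hx
    rw [h1]
    exact D.isPreconnected_int.image φ' (hφ'.mono hDi)
  intro y₀ hy₀ hy₀i γ hγ
  have hφc : Continuous fun x : C.carrier => φ x := hφ.comp_continuous continuous_subtype_val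
    fun x => x.2
  have hZ : IsPreconnected ((fun x : C.carrier => φ x) '' Y) := by
    rw [hY]
    exact isPreconnected_connectedComponentIn.image _ hφc.continuousOn
  have hYW : ∀ x ∈ Y, ((f x : D.carrier) : Amb n) ∈ V₀ ∩ D.carrier := by
    rw [hY]
    intro x hx
    have h1 := connectedComponentIn_subset _ _ hx
    exact h1
  have hZs : (fun x : C.carrier => φ x) '' Y
      ⊆ (ψ ⁻¹' C.int ∪ ψ ⁻¹' C.bd) ∩ f₁ ⁻¹' (ψ' ⁻¹' V₀) := by
    rintro _ ⟨x, hx, rfl⟩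
    refine ⟨?_, ?_⟩
    · rcases x.2 with h1 | h1
      · right
        rw [mem_preimage, hψφ x x.2]; exact h1
      · left
        rw [mem_preimage, hψφ x x.2]; exact h1
    · rw [mem_preimage, mem_preimage, hf₁φ]
      exact (hYW x hx).1
  have hx₀K : φ x₀ ∈ ψ ⁻¹' C.bd := by
    rw [mem_preimage, hψφ _ x₀.2]
    exact (hfb x₀).1 hx₀.2
  have hy₀U : φ y₀ ∈ ψ ⁻¹' C.int := by
    rw [mem_preimage, hψφ _ y₀.2]
    exact hy₀i
  obtain ⟨hP, d, k, hd, hdk⟩ := isUnit_locDeg_connectedComponentIn he hinj hK hU hV hVc hf₁ hg₁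
    hUV hKL hgf hO hW₂ hKW hZ hZs (mem_image_of_mem _ (hYcont hx₀)) hx₀K
    (mem_image_of_mem _ hy₀) hy₀U
  set M := connectedComponentIn (ψ ⁻¹' C.int ∩ f₁ ⁻¹' (ψ' ⁻¹' V₀)) (φ y₀) with hMdef
  have hMsub : M ⊆ ψ ⁻¹' C.int ∩ f₁ ⁻¹' (ψ' ⁻¹' V₀) := connectedComponentIn_subset _ _
  have hyM : φ y₀ ∈ M := mem_connectedComponentIn ⟨hy₀U, (hZs (mem_image_of_mem _ hy₀)).2⟩
  have hMo : IsOpen M := (hU.isOpen.inter (hO.preimage hf₁)).connectedComponentIn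
  have hMc : IsConnected M := ⟨⟨_, hyM⟩, isPreconnected_connectedComponentIn⟩
  have : PathConnectedSpace M :=
    isPathConnected_iff_pathConnectedSpace.1 (hMo.isConnected_iff_isPathConnected.1 hMc)
  have hN : IsOpen (ψ' ⁻¹' D.int ∩ ψ' ⁻¹' V₀) := hV.isOpen.inter hO
  let F : C(M, ↥(ψ' ⁻¹' D.int ∩ ψ' ⁻¹' V₀)) :=
    ⟨fun x => ⟨f₁ x, hUV (hMsub x.2).1, (hMsub x.2).2⟩, by fun_prop⟩
  let y₁ : M := ⟨φ y₀, hyM⟩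
  have hFy : φ' (f y₀) = f₁ (φ y₀) := by rw [← hφψ' (f₁ _), hf₁φ]
  have hψ'γ : ∀ t, ψ' (φ' (γ t)) = γ t := fun t => hψφ' _ (γ t).2
  have hγm : ∀ t, φ' (γ t) ∈ ψ' ⁻¹' D.int ∩ ψ' ⁻¹' V₀ := fun t => by
    rw [mem_inter_iff, mem_preimage, mem_preimage, hψ'γ]
    exact ⟨(hγ t).2, (hγ t).1.1⟩
  let γ₁ : Path (F y₁) (F y₁) :=
    { toFun := fun t => ⟨φ' (γ t), hγm t⟩
      continuous_toFun := Continuous.subtype_mk (hφ'.comp_continuous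
        (continuous_subtype_val.comp γ.continuous) fun t => (γ t).2) hγm
      source' := Subtype.ext ((congrArg (fun x : D.carrier => φ' x) γ.source).trans hFy)
      target' := Subtype.ext ((congrArg (fun x : D.carrier => φ' x) γ.target).trans hFy) }
  obtain ⟨a, ⟨H⟩⟩ := exists_path_map_homotopic (F := F) (y₀ := y₁) hMo hN hf₁ (fun _ => rfl) hP
    hd hdk γ₁
  have hψM : ∀ x : M, ψ x ∈ C.carrier := fun x => hCi (hMsub x.2).1
  let r : C(M, C.carrier) := ⟨fun x => ⟨ψ x, hψM x⟩, by fun_prop⟩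
  have hry : r y₁ = y₀ := Subtype.ext (hψφ _ y₀.2)
  have hrY : ∀ x, r x ∈ Y := by
    have h1 : IsPreconnected (range r) := isPreconnected_range r.continuous
    have h2 : range r ⊆ {x : C.carrier | ((f x : D.carrier) : Amb n) ∈ V₀ ∩ D.carrier} := by
      rintro _ ⟨x, rfl⟩
      refine ⟨?_, (f _).2⟩
      have := (hMsub x.2).2
      rw [mem_preimage, mem_preimage, hψf x (hψM x)] at this
      exact this
    have h3 := h1.subset_connectedComponentIn (x := y₀) ⟨y₁, hry⟩ h2
    rw [hY] at hy₀ ⊢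
    rw [connectedComponentIn_eq hy₀]
    exact fun x => h3 (mem_range_self x)
  let s : C(↥(ψ' ⁻¹' D.int ∩ ψ' ⁻¹' V₀), D.carrier) :=
    ⟨fun x => ⟨ψ' x, hDi x.2.1⟩, by fun_prop⟩
  have hsF : ∀ x, s (F x) = f (r x) := fun x => Subtype.ext (hψf x (hψM x))
  have hsy : f y₀ = s (F y₁) := by rw [hsF, hry]
  refine ⟨(a.map r.continuous).cast hry.symm hry.symm, fun t => ⟨hrY _, (hMsub (a t).2).1⟩,
    ((H.map s).pathCast hsy hsy).cast ?_ ?_, fun z => ?_⟩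
  · exact Path.ext (funext fun t => hsF (a t))
  · exact Path.ext (funext fun t => Subtype.ext (hψ'γ t))
  · exact ⟨⟨(H z).2.2, hDi (H z).2.1⟩, (H z).2.1⟩
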